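/- Let V be a compact subset of (0,∞) × (0,∞) × (0,2). There exist C > 0, p > 0 and N ∈ ℕ such that for all n ≥ N, all θ = (σ,δ,α) ∈ V and all y ∈ ℝ: (i) |∂³_{σσσ} ln p_{1/n}(y, θ)| ≤ C (ln n)^p; and (ii) for every triple (a,b,c) ∈ {σ,δ,α}³ with (a,b,c) ≠ (σ,σ,σ), |∂³_{abc} ln p_{1/n}(y, θ)| ≤ C (ln n)^p · w_n(θ)^{α} ψ_{α}^{(3)}(√n y/σ) / ( φ(√n y/σ) + w_n(θ)^{α} ψ_{α}^{(0)}(√n y/σ) ), where ∂³_{abc} denotes the third partial derivative in the parameter coordinates a, b, c of θ = (σ,δ,α). -/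

import Mathlib

open MeasureTheory Filter Set Topology Matrix

noncomputable section

namespace LevyLAN

/-- Standard Gaussian density `φ`. -/
def gauss (y : ℝ) : ℝ := (Real.sqrt (2 * Real.pi))⁻¹ * Real.exp (-(y ^ 2) / 2)

/-- Symmetric `α`-stable density `φ_α`, defined by Fourier inversion. -/
def stableDensity (α z : ℝ) : ℝ :=
  (2 * Real.pi)⁻¹ * ∫ u : ℝ, Real.cos (z * u) * Real.exp (-(|u| ^ α))

/-- `∂_α φ_α`. -/
def stableDensityDalpha (α z : ℝ) : ℝ :=
  -(2 * Real.pi)⁻¹ * ∫ u : ℝ, Real.cos (z * u) * |u| ^ α * Real.log |u| * Real.exp (-(|u| ^ α))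

/-- The operator `(D f) y = (y * f y)' = f y + y * f' y`. -/
def Dop (f : ℝ → ℝ) (y : ℝ) : ℝ := f y + y * deriv f y

/-- `f_α(y, w)`. -/
def fFun (α y w : ℝ) : ℝ := ∫ z : ℝ, gauss (y - w * z) * stableDensity α z

/-- `g_α(y, w)`. -/
def gFun (α y w : ℝ) : ℝ := ∫ z : ℝ, Dop gauss (y - w * z) * stableDensity α z

/-- `h_α(y, w)`. -/
def hFun (α y w : ℝ) : ℝ := ∫ z : ℝ, gauss (y - w * z) * Dop (stableDensity α) z

/-- `k_α(y, w)`. -/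
def kFun (α y w : ℝ) : ℝ := ∫ z : ℝ, gauss (y - w * z) * stableDensityDalpha α z

/-- `c_α`. -/
def cAlpha (α : ℝ) : ℝ :=
  if α = 1 then 1 / Real.pi
  else -(α * (α - 1)) / (2 * Real.Gamma (2 - α) * Real.cos (Real.pi * α / 2))

/-- `w_n(θ) = n^{1/2 - 1/α} δ / σ`. -/
def wn (n : ℕ) (σ δ α : ℝ) : ℝ := (n : ℝ) ^ ((1 : ℝ) / 2 - 1 / α) * δ / σ

/-- `l_α(y, w)` (it depends on `n`). -/
def lFun (n : ℕ) (α y w : ℝ) : ℝ :=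
  ((Real.log n - Real.log (Real.log n)) / (2 * α) - Real.log n / α ^ 2) * hFun α y w
    + kFun α y w

def kappa0 (σ δ α : ℝ) : ℝ := 2 * cAlpha α / (α * (2 - α) ^ (α / 2)) * (δ / σ) ^ α

def kappa1 (σ δ α : ℝ) : ℝ :=
  Real.log (δ / σ) + deriv cAlpha α / cAlpha α - Real.log (2 - α) / 2 - 1 / α

/-- The density `p_{1/n}(y, θ)`, with parameter `θ = (σ, δ, α) : Fin 3 → ℝ`. -/
def pdens (n : ℕ) (θ : Fin 3 → ℝ) (y : ℝ) : ℝ :=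
  Real.sqrt n / θ 0 * fFun (θ 2) (Real.sqrt n * y / θ 0) (wn n (θ 0) (θ 1) (θ 2))

/-- The log-likelihood `ln L_n(θ)`. -/
def logLik (n : ℕ) (θ : Fin 3 → ℝ) (x : Fin n → ℝ) : ℝ :=
  ∑ i, Real.log (pdens n θ (x i))

/-- Partial derivative in the `j`-th parameter coordinate. -/
def pderiv (j : Fin 3) (F : (Fin 3 → ℝ) → ℝ) (θ : Fin 3 → ℝ) : ℝ :=
  deriv (fun t => F (Function.update θ j t)) (θ j)

/-- The score `G_n(θ) = ∇_θ ln L_n(θ)`. -/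
def scoreVec (n : ℕ) (θ : Fin 3 → ℝ) (x : Fin n → ℝ) : Fin 3 → ℝ :=
  fun j => pderiv j (fun θ' => logLik n θ' x) θ

/-- The Hessian matrix `J_n(θ)` of the log-likelihood. -/
def hessMat (n : ℕ) (θ : Fin 3 → ℝ) (x : Fin n → ℝ) : Matrix (Fin 3) (Fin 3) ℝ :=
  Matrix.of fun i j => pderiv i (fun θ' => pderiv j (fun θ'' => logLik n θ'' x) θ') θ

def rate (n : ℕ) (α : ℝ) : ℝ := Real.log n ^ (α / 4) / (n : ℝ) ^ (α / 4)

/-- The rate matrix `u_n(θ)`. -/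
def un (n : ℕ) (θ : Fin 3 → ℝ) : Matrix (Fin 3) (Fin 3) ℝ :=
  !![1 / Real.sqrt n, 0, 0;
     0, rate n (θ 2), -(rate n (θ 2) * (θ 1 / (2 * θ 2)) * (Real.log n - Real.log (Real.log n)));
     0, 0, rate n (θ 2)]

/-- The information matrix `I(θ)`. -/
def Imat (θ : Fin 3 → ℝ) : Matrix (Fin 3) (Fin 3) ℝ :=
  !![2 / θ 0 ^ 2, 0, 0;
     0, θ 2 ^ 2 / θ 1 ^ 2 * kappa0 (θ 0) (θ 1) (θ 2),
        θ 2 / θ 1 * kappa0 (θ 0) (θ 1) (θ 2) * kappa1 (θ 0) (θ 1) (θ 2);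
     0, θ 2 / θ 1 * kappa0 (θ 0) (θ 1) (θ 2) * kappa1 (θ 0) (θ 1) (θ 2),
        kappa0 (θ 0) (θ 1) (θ 2) * (kappa1 (θ 0) (θ 1) (θ 2) ^ 2 + 1 / θ 2 ^ 2)]

/-- `ℙ_n`, the `n`-fold product of the law with Lebesgue density `p_{1/n}(·, θ)`. -/
def Pn (n : ℕ) (θ : Fin 3 → ℝ) : Measure (Fin n → ℝ) :=
  Measure.pi fun _ => MeasureTheory.volume.withDensity fun y => ENNReal.ofReal (pdens n θ y)

/-- The standard Gaussian measure on `ℝ³`. -/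
def stdGauss3 : Measure (Fin 3 → ℝ) :=
  Measure.pi fun _ => ProbabilityTheory.gaussianReal 0 1

/-- Euclidean (Frobenius) norm of a real 3×3 matrix. -/
def frobNorm (M : Matrix (Fin 3) (Fin 3) ℝ) : ℝ := Real.sqrt (∑ i, ∑ j, M i j ^ 2)

/-- Euclidean norm of a vector of `ℝ³`. -/
def vecNorm (v : Fin 3 → ℝ) : ℝ := Real.sqrt (∑ j, v j ^ 2)

/-- The admissible families of functions `ψ_α^{(p)}`. -/
structure IsPsiFamily (ψ : ℝ → ℕ → ℝ → ℝ) : Prop where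
  contDiff : ∀ α ∈ Set.Ioo (0 : ℝ) 2, ∀ p : ℕ, ContDiff ℝ 2 (ψ α p)
  pos : ∀ α ∈ Set.Ioo (0 : ℝ) 2, ∀ p : ℕ, ∀ y : ℝ, 0 < ψ α p y
  even : ∀ α ∈ Set.Ioo (0 : ℝ) 2, ∀ p : ℕ, ∀ y : ℝ, ψ α p (-y) = ψ α p y
  eq_one : ∀ α ∈ Set.Ioo (0 : ℝ) 2, ∀ p : ℕ, ∀ y : ℝ, |y| ≤ 1 → ψ α p y = 1
  eq_tail : ∀ α ∈ Set.Ioo (0 : ℝ) 2, ∀ p : ℕ, ∀ y : ℝ, 3 ≤ |y| →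
    ψ α p y = Real.log |y| ^ p / |y| ^ (α + 1)
  unifBound : ∀ K : Set ℝ, K ⊆ Set.Ioo (0 : ℝ) 2 → IsCompact K → ∀ p : ℕ,
    ∃ c > (0 : ℝ), ∃ C : ℝ, ∀ α ∈ K, ∀ y : ℝ, 1 ≤ |y| → |y| ≤ 3 →
      c ≤ ψ α p y ∧ ψ α p y ≤ C

/-- `𝓘_α^{(k,l)}`. -/
def Ical (ψ : ℝ → ℕ → ℝ → ℝ) (α : ℝ) (k l : ℕ) (y : ℝ) : ℝ :=
  ∫ z in {z : ℝ | 1 < |z|}, Dop^[k] gauss (y - z) * ψ α l z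

/-- `f_α^{(k,l,m)}`. -/
def fklm (α : ℝ) (k l m : ℕ) (y w : ℝ) : ℝ :=
  ∫ z : ℝ, Dop^[k] gauss (y - w * z)
    * Dop^[l] (fun z' => iteratedDeriv m (fun a => stableDensity a z') α) z

def Gamman (n : ℕ) (α : ℝ) : ℝ := Real.sqrt ((1 - α / 2) * Real.log n)

def Mn (n : ℕ) (α : ℝ) : ℝ := Real.sqrt ((2 - α) * Real.log n)

def Kconst (σ δ α : ℝ) : ℝ := deriv cAlpha α + cAlpha α * Real.log (δ / σ)

/-! ## Part 1 : the symbol classes -/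

structure Box where
  s0 : ℝ
  s1 : ℝ
  d0 : ℝ
  d1 : ℝ
  a0 : ℝ
  a1 : ℝ
  hs0 : 0 < s0
  hd0 : 0 < d0
  ha0 : 0 < a0
  ha1 : a1 < 2

/-- The open box of parameters. -/
def Box.Om (B : Box) : Set (Fin 3 → ℝ) :=
  {θ | (B.s0 < θ 0 ∧ θ 0 < B.s1) ∧ (B.d0 < θ 1 ∧ θ 1 < B.d1) ∧ (B.a0 < θ 2 ∧ θ 2 < B.a1)}

def ell (n : ℕ) (δ u : ℝ) : ℝ := Real.log (Real.sqrt n * δ * u)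

def xx (n : ℕ) (δ α u : ℝ) : ℝ := Real.exp (α * ell n δ u) / n

/-- elementary symbols -/
def T (a b c i m : ℕ) (g : ℝ → ℝ) : ℕ → (Fin 3 → ℝ) → ℝ → ℝ := fun n θ u =>
  θ 0 ^ a * (θ 1)⁻¹ ^ b * θ 2 ^ c * u ^ (2 * i) * ell n (θ 1) u ^ m
    * Real.exp (-(θ 0 ^ 2 * u ^ 2 / 2)) * g (xx n (θ 1) (θ 2) u)

/-- functions of `x > 0` of order `x ^ o`, together with all their Euler derivatives. -/
def Good (o : ℕ) : Set (ℝ → ℝ) := {g | ∃ S : Set (ℝ → ℝ), g ∈ S ∧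
  ∀ h ∈ S, (∃ C : ℝ, ∀ x > 0, |h x| ≤ C * x ^ o) ∧
    ∃ h' ∈ S, ∀ x > 0, HasDerivAt h (h' x / x) x}

lemma Good.bound {o : ℕ} {g : ℝ → ℝ} (hg : g ∈ Good o) :
    ∃ C : ℝ, ∀ x > 0, |g x| ≤ C * x ^ o := by
  obtain ⟨S, hgS, hS⟩ := hg
  exact (hS g hgS).1

lemma Good.deriv {o : ℕ} {g : ℝ → ℝ} (hg : g ∈ Good o) :
    ∃ g' ∈ Good o, ∀ x > 0, HasDerivAt g (g' x / x) x := by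
  obtain ⟨S, hgS, hS⟩ := hg
  obtain ⟨g', hg', hd⟩ := (hS g hgS).2
  exact ⟨g', ⟨S, hg', hS⟩, hd⟩

lemma poly_exp_bound (P : Polynomial ℝ) :
    ∃ C : ℝ, ∀ x > 0, |P.eval x * Real.exp (-x)| ≤ C := by
  induction P using Polynomial.induction_on' with
  | add p q hp hq =>
    obtain ⟨C, hC⟩ := hp
    obtain ⟨D, hD⟩ := hq
    refine ⟨C + D, fun x hx => ?_⟩
    rw [Polynomial.eval_add, add_mul]
    exact (abs_add_le _ _).trans (add_le_add (hC x hx) (hD x hx))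
  | monomial k a =>
    refine ⟨|a| * (k.factorial : ℝ), fun x hx => ?_⟩
    rw [Polynomial.eval_monomial, mul_assoc, abs_mul]
    refine mul_le_mul_of_nonneg_left ?_ (abs_nonneg _)
    have h := Real.pow_div_factorial_le_exp x hx.le k
    rw [abs_of_pos (by positivity), Real.exp_neg, ← div_eq_mul_inv,
      div_le_iff₀ (Real.exp_pos x), mul_comm]
    rwa [div_le_iff₀ (by positivity)] at h

lemma hasDerivAt_polyexp (P : Polynomial ℝ) (x : ℝ) :
    HasDerivAt (fun x => P.eval x * Real.exp (-x))
      ((P.derivative.eval x - P.eval x) * Real.exp (-x)) x := by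
  have h := (P.hasDerivAt x).mul ((hasDerivAt_neg x).exp)
  refine h.congr_deriv ?_
  ring

lemma exp_good0 : (fun x => Real.exp (-x)) ∈ Good 0 := by
  refine ⟨{h | ∃ P : Polynomial ℝ, h = fun x => P.eval x * Real.exp (-x)}, ⟨1, by simp⟩, ?_⟩
  rintro h ⟨P, rfl⟩
  refine ⟨?_, ?_⟩
  · obtain ⟨C, hC⟩ := poly_exp_bound P
    exact ⟨C, fun x hx => by simpa using hC x hx⟩
  · refine ⟨_, ⟨Polynomial.X * (P.derivative - P), rfl⟩, fun x hx => ?_⟩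
    refine (hasDerivAt_polyexp P x).congr_deriv ?_
    simp only [Polynomial.eval_mul, Polynomial.eval_X, Polynomial.eval_sub]
    field_simp

lemma abs_exp_neg_sub_one {x : ℝ} (hx : 0 < x) : |Real.exp (-x) - 1| ≤ x := by
  rw [abs_of_nonpos (by simpa using hx.le)]
  have := Real.add_one_le_exp (-x)
  linarith

lemma abs_exp_neg_sub_two {x : ℝ} (hx : 0 < x) : |Real.exp (-x) - 1 + x| ≤ x ^ 2 := by
  have h1 := Real.add_one_le_exp (-x)
  rw [abs_of_nonneg (by linarith)]
  have h2 := Real.add_one_le_exp x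
  have h3 : Real.exp (-x) * Real.exp x = 1 := by rw [← Real.exp_add]; simp
  have h4 := Real.exp_pos (-x)
  have h5 : Real.exp (-x) * (x + 1) ≤ 1 := by nlinarith
  nlinarith

lemma good1_mem (c : ℝ) (P : Polynomial ℝ) :
    (fun x => c * (Real.exp (-x) - 1) + x * (P.eval x * Real.exp (-x))) ∈ Good 1 := by
  refine ⟨{h | ∃ (c : ℝ) (P : Polynomial ℝ),
    h = fun x => c * (Real.exp (-x) - 1) + x * (P.eval x * Real.exp (-x))}, ⟨c, P, rfl⟩, ?_⟩
  rintro h ⟨c, P, rfl⟩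
  refine ⟨?_, ?_⟩
  · obtain ⟨C, hC⟩ := poly_exp_bound P
    refine ⟨|c| + C, fun x hx => ?_⟩
    refine (abs_add_le _ _).trans ?_
    rw [abs_mul, abs_mul x, abs_of_pos hx, pow_one, add_mul]
    have := abs_exp_neg_sub_one hx
    have h2 := hC x hx
    rw [mul_comm x]
    gcongr
  · refine ⟨_, ⟨0, -Polynomial.C c + P + Polynomial.X * (P.derivative - P), rfl⟩,
      fun x hx => ?_⟩
    have h1 := (((hasDerivAt_neg x).exp).sub_const 1).const_mul c
    have h2 := (hasDerivAt_id x).mul (hasDerivAt_polyexp P x)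
    refine (h1.add h2).congr_deriv ?_
    simp only [Polynomial.eval_mul, Polynomial.eval_X, Polynomial.eval_sub, Polynomial.eval_add,
      Polynomial.eval_neg, Polynomial.eval_C, id]
    field_simp
    ring

lemma good2_mem :
    (fun x => Real.exp (-x) - 1 + x) ∈ Good 2 := by
  refine ⟨{h | ∃ (c d : ℝ) (P : Polynomial ℝ),
    h = fun x => c * (Real.exp (-x) - 1 + x) + d * (x * (Real.exp (-x) - 1))
      + x ^ 2 * (P.eval x * Real.exp (-x))}, ⟨1, 0, 0, by simp⟩, ?_⟩
  rintro h ⟨c, d, P, rfl⟩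
  refine ⟨?_, ?_⟩
  · obtain ⟨C, hC⟩ := poly_exp_bound P
    refine ⟨|c| + |d| + C, fun x hx => ?_⟩
    have h1 := abs_exp_neg_sub_one hx
    have h2 := hC x hx
    have h3 := abs_exp_neg_sub_two hx
    calc |c * (Real.exp (-x) - 1 + x) + d * (x * (Real.exp (-x) - 1))
      + x ^ 2 * (P.eval x * Real.exp (-x))|
        ≤ |c| * |Real.exp (-x) - 1 + x| + |d| * (x * |Real.exp (-x) - 1|)
          + x ^ 2 * |P.eval x * Real.exp (-x)| := by
          refine (abs_add_le _ _).trans (add_le_add ((abs_add_le _ _).trans ?_) ?_)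
          · rw [abs_mul, abs_mul d, abs_mul x, abs_of_pos hx]
          · rw [abs_mul, abs_of_pos (by positivity : 0 < x ^ 2)]
      _ ≤ |c| * x ^ 2 + |d| * (x * x) + x ^ 2 * C := by gcongr
      _ = _ := by ring
  · refine ⟨_, ⟨0, -c + d, -Polynomial.C d + 2 * P + Polynomial.X * (P.derivative - P), rfl⟩,
      fun x hx => ?_⟩
    have h1 := ((((hasDerivAt_neg x).exp).sub_const 1).add (hasDerivAt_id x)).const_mul c
    have h2 := ((hasDerivAt_id x).mul (((hasDerivAt_neg x).exp).sub_const 1)).const_mul d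
    have h3 := ((hasDerivAt_id x).pow 2).mul (hasDerivAt_polyexp P x)
    refine ((h1.add h2).add h3).congr_deriv ?_
    simp only [Polynomial.eval_mul, Polynomial.eval_X, Polynomial.eval_sub, Polynomial.eval_add,
      Polynomial.eval_neg, Polynomial.eval_C, id, Polynomial.eval_ofNat]
    simp
    field_simp
    ring

def Cl (o r : ℕ) : Submodule ℝ (ℕ → (Fin 3 → ℝ) → ℝ → ℝ) :=
  Submodule.span ℝ {F | ∃ a b c i m g, m ≤ r ∧ g ∈ Good o ∧ F = T a b c i m g}

def Pu : Submodule ℝ (ℕ → (Fin 3 → ℝ) → ℝ → ℝ) :=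
  Submodule.span ℝ {F | ∃ a i, F = T a 0 0 i 0 (fun x => Real.exp (-x))}

lemma T_mem_Cl {o r : ℕ} (a b c i : ℕ) {m : ℕ} {g : ℝ → ℝ} (hm : m ≤ r) (hg : g ∈ Good o) :
    T a b c i m g ∈ Cl o r := Submodule.subset_span ⟨a, b, c, i, m, g, hm, hg, rfl⟩

lemma T_mem_Pu (a i : ℕ) : T a 0 0 i 0 (fun x => Real.exp (-x)) ∈ Pu :=
  Submodule.subset_span ⟨a, i, rfl⟩

lemma Cl_mono {o r r' : ℕ} (h : r ≤ r') : Cl o r ≤ Cl o r' := by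
  refine Submodule.span_mono ?_
  rintro F ⟨a, b, c, i, m, g, hm, hg, rfl⟩
  exact ⟨a, b, c, i, m, g, hm.trans h, hg, rfl⟩

lemma Pu_le : Pu ≤ Cl 0 0 := by
  refine Submodule.span_mono ?_
  rintro F ⟨a, i, rfl⟩
  exact ⟨a, 0, 0, i, 0, _, le_rfl, exp_good0, rfl⟩

section derivs

variable {n : ℕ} {δ α u : ℝ}

lemma xx_pos (hn : 1 ≤ n) : 0 < xx n δ α u := by
  have : (0 : ℝ) < n := by exact_mod_cast hn
  unfold xx; positivity

lemma ell_deriv_u (hn : 1 ≤ n) (hδ : 0 < δ) (hu : 0 < u) :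
    HasDerivAt (fun u => ell n δ u) (1 / u) u := by
  have hn' : (0 : ℝ) < n := by exact_mod_cast hn
  have h0 : 0 < Real.sqrt n * δ := by positivity
  have h := ((hasDerivAt_id u).const_mul (Real.sqrt n * δ)).log (by simp only [id]; positivity)
  refine h.congr_deriv ?_
  simp only [id]; field_simp

lemma ell_deriv_δ (hn : 1 ≤ n) (hδ : 0 < δ) (hu : 0 < u) :
    HasDerivAt (fun δ => ell n δ u) (1 / δ) δ := by
  have hn' : (0 : ℝ) < n := by exact_mod_cast hn
  have h0 : 0 < Real.sqrt n := by positivity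
  have h := (((hasDerivAt_id δ).const_mul (Real.sqrt n)).mul_const u).log (by simp only [id]; positivity)
  refine h.congr_deriv ?_
  simp only [id]; field_simp

lemma xx_deriv_u (hn : 1 ≤ n) (hδ : 0 < δ) (hu : 0 < u) :
    HasDerivAt (fun u => xx n δ α u) (α * xx n δ α u / u) u := by
  have h := (((ell_deriv_u hn hδ hu).const_mul α).exp).div_const (n : ℝ)
  refine h.congr_deriv ?_
  unfold xx; field_simp

lemma xx_deriv_δ (hn : 1 ≤ n) (hδ : 0 < δ) (hu : 0 < u) :
    HasDerivAt (fun δ => xx n δ α u) (α * xx n δ α u / δ) δ := by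
  have h := (((ell_deriv_δ hn hδ hu).const_mul α).exp).div_const (n : ℝ)
  refine h.congr_deriv ?_
  unfold xx; field_simp

lemma xx_deriv_α : HasDerivAt (fun α => xx n δ α u) (ell n δ u * xx n δ α u) α := by
  have h := (((hasDerivAt_id α).mul_const (ell n δ u)).exp).div_const (n : ℝ)
  refine h.congr_deriv ?_
  unfold xx; simp only [id]; ring

end derivs

lemma T_deriv_u (a b c i m : ℕ) (g g' : ℝ → ℝ) (hg : ∀ x > 0, HasDerivAt g (g' x / x) x)
    (n : ℕ) (hn : 1 ≤ n) (θ : Fin 3 → ℝ) (h1 : 0 < θ 1) (u : ℝ) (hu : 0 < u) :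
    HasDerivAt (T a b c i m g n θ)
      (((2 * i : ℝ) • T a b c i m g + (-1 : ℝ) • T (a + 2) b c (i + 1) m g
        + (m : ℝ) • T a b c i (m - 1) g + T a b (c + 1) i m g') n θ u / u) u := by
  have hx := xx_pos (n := n) (δ := θ 1) (α := θ 2) (u := u) hn
  have e1 := (hasDerivAt_pow (2 * i) u).const_mul (θ 0 ^ a * (θ 1)⁻¹ ^ b * θ 2 ^ c)
  have e2 := (ell_deriv_u hn h1 hu).pow m
  have e3 : HasDerivAt (fun u : ℝ => Real.exp (-(θ 0 ^ 2 * u ^ 2 / 2)))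
      (Real.exp (-(θ 0 ^ 2 * u ^ 2 / 2)) * (-(θ 0 ^ 2 * u))) u := by
    have := ((((hasDerivAt_pow 2 u).const_mul (θ 0 ^ 2)).div_const 2).neg).exp
    refine this.congr_deriv ?_
    simp; ring
  have e4 := (hg _ hx).comp u (xx_deriv_u (α := θ 2) hn h1 hu)
  have h := ((e1.mul e2).mul e3).mul e4
  refine h.congr_deriv ?_
  simp only [Pi.add_apply, Pi.smul_apply, smul_eq_mul, T, Function.comp, Pi.mul_apply, Pi.pow_apply]
  rcases i with _ | i
  · push_cast
    field_simp
    simp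
    ring
  · have : 2 * (i + 1) - 1 = 2 * i + 1 := by omega
    rw [this]
    push_cast
    field_simp
    ring

lemma T_deriv_0 (a b c i m : ℕ) (g : ℝ → ℝ) (n : ℕ) (θ : Fin 3 → ℝ) (u : ℝ) :
    HasDerivAt (fun t => T a b c i m g n (Function.update θ 0 t) u)
      (((a : ℝ) • T (a - 1) b c i m g + (-1 : ℝ) • T (a + 1) b c (i + 1) m g) n θ u) (θ 0) := by
  have e3 : HasDerivAt (fun s : ℝ => Real.exp (-(s ^ 2 * u ^ 2 / 2)))
      (Real.exp (-(θ 0 ^ 2 * u ^ 2 / 2)) * (-(θ 0 * u ^ 2))) (θ 0) := by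
    have := ((((hasDerivAt_pow 2 (θ 0)).mul_const (u ^ 2)).div_const 2).neg).exp
    refine this.congr_deriv ?_
    simp; ring
  have h := (((((((hasDerivAt_pow a (θ 0)).mul_const ((θ 1)⁻¹ ^ b)).mul_const (θ 2 ^ c)).mul_const
    (u ^ (2 * i))).mul_const (ell n (θ 1) u ^ m)).mul e3)).mul_const (g (xx n (θ 1) (θ 2) u))
  have h2 := h.congr_deriv (g' := ((a : ℝ) • T (a - 1) b c i m g
    + (-1 : ℝ) • T (a + 1) b c (i + 1) m g) n θ u) (by
      simp only [Pi.add_apply, Pi.smul_apply, smul_eq_mul, T]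
      ring)
  exact h2

lemma T_deriv_1 (a b c i m : ℕ) (g g' : ℝ → ℝ) (hg : ∀ x > 0, HasDerivAt g (g' x / x) x)
    (n : ℕ) (hn : 1 ≤ n) (θ : Fin 3 → ℝ) (h1 : 0 < θ 1) (u : ℝ) (hu : 0 < u) :
    HasDerivAt (fun t => T a b c i m g n (Function.update θ 1 t) u)
      (((-(b : ℝ)) • T a (b + 1) c i m g + (m : ℝ) • T a (b + 1) c i (m - 1) g
        + T a (b + 1) (c + 1) i m g') n θ u) (θ 1) := by
  have hx := xx_pos (n := n) (δ := θ 1) (α := θ 2) (u := u) hn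
  have e1 : HasDerivAt (fun s : ℝ => s⁻¹ ^ b) (-(b : ℝ) * (θ 1)⁻¹ ^ (b + 1)) (θ 1) := by
    have := (hasDerivAt_inv h1.ne').pow b
    refine this.congr_deriv ?_
    rcases b with _ | b
    · simp
    · simp only [Nat.add_sub_cancel]; push_cast; rw [← inv_pow]; ring
  have e2 := (ell_deriv_δ hn h1 hu).pow m
  have e4 := (hg _ hx).comp (θ 1) (xx_deriv_δ (α := θ 2) hn h1 hu)
  have h := ((((((e1.const_mul (θ 0 ^ a)).mul_const (θ 2 ^ c)).mul_const
    (u ^ (2 * i))).mul e2).mul_const (Real.exp (-(θ 0 ^ 2 * u ^ 2 / 2))))).mul e4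
  have h2 := h.congr_deriv (g' := ((-(b : ℝ)) • T a (b + 1) c i m g
    + (m : ℝ) • T a (b + 1) c i (m - 1) g + T a (b + 1) (c + 1) i m g') n θ u) (by
      simp only [Pi.add_apply, Pi.smul_apply, smul_eq_mul, T, Function.comp, Pi.mul_apply,
        Pi.pow_apply]
      have hcan : g' (xx n (θ 1) (θ 2) u) / xx n (θ 1) (θ 2) u * (θ 2 * xx n (θ 1) (θ 2) u / θ 1)
        = g' (xx n (θ 1) (θ 2) u) * θ 2 * (θ 1)⁻¹ := by field_simp
      rw [hcan]
      simp only [pow_succ, one_div]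
      ring)
  exact h2

lemma T_deriv_2 (a b c i m : ℕ) (g g' : ℝ → ℝ) (hg : ∀ x > 0, HasDerivAt g (g' x / x) x)
    (n : ℕ) (hn : 1 ≤ n) (θ : Fin 3 → ℝ) (u : ℝ) :
    HasDerivAt (fun t => T a b c i m g n (Function.update θ 2 t) u)
      (((c : ℝ) • T a b (c - 1) i m g + T a b c i (m + 1) g') n θ u) (θ 2) := by
  have hx := xx_pos (n := n) (δ := θ 1) (α := θ 2) (u := u) hn
  have e4 := (hg _ hx).comp (θ 2) (xx_deriv_α (n := n) (δ := θ 1) (α := θ 2) (u := u))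
  have h := (((((hasDerivAt_pow c (θ 2)).const_mul (θ 0 ^ a * (θ 1)⁻¹ ^ b)).mul_const
    (u ^ (2 * i))).mul_const (ell n (θ 1) u ^ m)).mul_const
      (Real.exp (-(θ 0 ^ 2 * u ^ 2 / 2)))).mul e4
  have h2 := h.congr_deriv (g' := ((c : ℝ) • T a b (c - 1) i m g + T a b c i (m + 1) g') n θ u) (by
      simp only [Pi.add_apply, Pi.smul_apply, smul_eq_mul, T, Function.comp]
      field_simp
      ring)
  exact h2


/-! ## Part 2 : closure of the classes, bounds -/

abbrev Sy := ℕ → (Fin 3 → ℝ) → ℝ → ℝ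

lemma span_rel {S : Set Sy} {V : Submodule ℝ Sy} (R : Sy → Sy → Prop) (h0 : R 0 0)
    (hadd : ∀ F G F' G', R F F' → R G G' → R (F + G) (F' + G'))
    (hsmul : ∀ (k : ℝ) F F', R F F' → R (k • F) (k • F'))
    (hS : ∀ F ∈ S, ∃ F' ∈ V, R F F') {F : Sy} (hF : F ∈ Submodule.span ℝ S) :
    ∃ F' ∈ V, R F F' := by
  induction hF using Submodule.span_induction with
  | mem x hx => exact hS x hx
  | zero => exact ⟨0, V.zero_mem, h0⟩
  | add x y _ _ hx hy =>
    obtain ⟨x', hx', h1⟩ := hx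
    obtain ⟨y', hy', h2⟩ := hy
    exact ⟨x' + y', V.add_mem hx' hy', hadd _ _ _ _ h1 h2⟩
  | smul a x _ hx =>
    obtain ⟨x', hx', h1⟩ := hx
    exact ⟨a • x', V.smul_mem a hx', hsmul _ _ _ h1⟩

/-- `F'` is the Euler derivative of `F` in `u`. -/
def RelU (F F' : Sy) : Prop := ∀ n : ℕ, 1 ≤ n → ∀ θ : Fin 3 → ℝ, 0 < θ 1 → ∀ u : ℝ, 0 < u →
  HasDerivAt (F n θ) (F' n θ u / u) u

/-- `F'` is the derivative of `F` in the parameter `c`. -/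
def RelP (c : Fin 3) (F F' : Sy) : Prop := ∀ n : ℕ, 1 ≤ n → ∀ θ : Fin 3 → ℝ, 0 < θ 1 →
  ∀ u : ℝ, 0 < u → HasDerivAt (fun t => F n (Function.update θ c t) u) (F' n θ u) (θ c)

lemma Cl_deriv_u {o r : ℕ} {F : Sy} (hF : F ∈ Cl o r) : ∃ F' ∈ Cl o r, RelU F F' := by
  refine span_rel RelU ?_ ?_ ?_ ?_ hF
  · intro n _ θ _ u _
    simp [hasDerivAt_const]
  · intro F G F' G' h1 h2 n hn θ hθ u hu
    exact ((h1 n hn θ hθ u hu).add (h2 n hn θ hθ u hu)).congr_deriv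
      (by simp only [Pi.add_apply]; ring)
  · intro k F F' h1 n hn θ hθ u hu
    exact ((h1 n hn θ hθ u hu).const_mul k).congr_deriv
      (by simp only [Pi.smul_apply, smul_eq_mul]; ring)
  · rintro F ⟨a, b, c, i, m, g, hm, hg, rfl⟩
    obtain ⟨g', hg', hd⟩ := Good.deriv hg
    refine ⟨_, ?_, fun n hn θ hθ u hu => T_deriv_u a b c i m g g' hd n hn θ hθ u hu⟩
    refine (Cl o r).add_mem ((Cl o r).add_mem ((Cl o r).add_mem ?_ ?_) ?_) ?_
    · exact (Cl o r).smul_mem _ (T_mem_Cl _ _ _ _ hm hg)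
    · exact (Cl o r).smul_mem _ (T_mem_Cl _ _ _ _ hm hg)
    · exact (Cl o r).smul_mem _ (T_mem_Cl _ _ _ _ (by omega) hg)
    · exact T_mem_Cl _ _ _ _ hm hg'

lemma RelP_zero (c : Fin 3) : RelP c 0 0 := by
  intro n _ θ _ u _
  simpa using hasDerivAt_const (θ c) (0 : ℝ)

lemma RelP_add (c : Fin 3) (F G F' G' : Sy) (h1 : RelP c F F') (h2 : RelP c G G') :
    RelP c (F + G) (F' + G') := by
  intro n hn θ hθ u hu
  exact (h1 n hn θ hθ u hu).add (h2 n hn θ hθ u hu)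

lemma RelP_smul (c : Fin 3) (k : ℝ) (F F' : Sy) (h1 : RelP c F F') :
    RelP c (k • F) (k • F') := by
  intro n hn θ hθ u hu
  exact (h1 n hn θ hθ u hu).const_mul k

lemma Cl_deriv_p (j : Fin 3) {o r : ℕ} {F : Sy} (hF : F ∈ Cl o r) :
    ∃ F' ∈ Cl o (r + 1), RelP j F F' := by
  refine span_rel (RelP j) (RelP_zero j) (RelP_add j) (RelP_smul j) ?_ hF
  rintro F ⟨a, b, c, i, m, g, hm, hg, rfl⟩
  obtain ⟨g', hg', hd⟩ := Good.deriv hg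
  fin_cases j
  · refine ⟨_, ?_, fun n hn θ hθ u hu => T_deriv_0 a b c i m g n θ u⟩
    refine Submodule.add_mem _ ?_ ?_
    · exact Submodule.smul_mem _ _ (T_mem_Cl _ _ _ _ (by omega) hg)
    · exact Submodule.smul_mem _ _ (T_mem_Cl _ _ _ _ (by omega) hg)
  · refine ⟨_, ?_, fun n hn θ hθ u hu => T_deriv_1 a b c i m g g' hd n hn θ hθ u hu⟩
    refine Submodule.add_mem _ (Submodule.add_mem _ ?_ ?_) ?_
    · exact Submodule.smul_mem _ _ (T_mem_Cl _ _ _ _ (by omega) hg)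
    · exact Submodule.smul_mem _ _ (T_mem_Cl _ _ _ _ (by omega) hg)
    · exact T_mem_Cl _ _ _ _ (by omega) hg'
  · refine ⟨_, ?_, fun n hn θ hθ u hu => T_deriv_2 a b c i m g g' hd n hn θ u⟩
    refine Submodule.add_mem _ ?_ ?_
    · exact Submodule.smul_mem _ _ (T_mem_Cl _ _ _ _ (by omega) hg)
    · exact T_mem_Cl _ _ _ _ (by omega) hg'

lemma Pu_deriv_0 {F : Sy} (hF : F ∈ Pu) : ∃ F' ∈ Pu, RelP 0 F F' := by
  refine span_rel (RelP 0) (RelP_zero 0) (RelP_add 0) (RelP_smul 0) ?_ hF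
  rintro F ⟨a, i, rfl⟩
  refine ⟨_, ?_, fun n hn θ hθ u hu => T_deriv_0 a 0 0 i 0 _ n θ u⟩
  refine Submodule.add_mem _ ?_ ?_
  · exact Submodule.smul_mem _ _ (T_mem_Pu _ _)
  · exact Submodule.smul_mem _ _ (T_mem_Pu _ _)

lemma negxexp_good : (fun x => -x * Real.exp (-x)) ∈ Good 1 := by
  have := good1_mem 0 (-1)
  simpa using this

lemma hasDerivAt_exp_neg' (x : ℝ) (hx : x > 0) :
    HasDerivAt (fun x => Real.exp (-x)) ((fun x => -x * Real.exp (-x)) x / x) x := by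
  refine ((hasDerivAt_neg x).exp).congr_deriv ?_
  field_simp

lemma Pu_deriv_p (j : Fin 3) (hj : j ≠ 0) {F : Sy} (hF : F ∈ Pu) :
    ∃ F' ∈ Cl 1 1, RelP j F F' := by
  refine span_rel (RelP j) (RelP_zero j) (RelP_add j) (RelP_smul j) ?_ hF
  rintro F ⟨a, i, rfl⟩
  fin_cases j
  · exact absurd rfl hj
  · refine ⟨T a 1 1 i 0 (fun x => -x * Real.exp (-x)), T_mem_Cl _ _ _ _ (by omega) negxexp_good,
      fun n hn θ hθ u hu => ?_⟩
    have := T_deriv_1 a 0 0 i 0 _ _ hasDerivAt_exp_neg' n hn θ hθ u hu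
    simpa using this
  · refine ⟨T a 0 0 i 1 (fun x => -x * Real.exp (-x)), T_mem_Cl _ _ _ _ (by omega) negxexp_good,
      fun n hn θ hθ u hu => ?_⟩
    have := T_deriv_2 a 0 0 i 0 _ _ hasDerivAt_exp_neg' n hn θ u
    simpa using this

/-- mixed (`true`) or pure (`false`) symbols. -/
def Cls (flag : Bool) (r : ℕ) (F : Sy) : Prop := if flag then F ∈ Cl 1 r else F ∈ Pu

lemma Cls_step {flag : Bool} {r : ℕ} {F : Sy} (h : Cls flag r F) (j : Fin 3) :
    ∃ F', Cls (flag || decide (j ≠ 0)) (r + 1) F' ∧ RelP j F F' := by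
  cases flag with
  | true =>
    obtain ⟨F', h1, h2⟩ := Cl_deriv_p j (by simpa [Cls] using h : F ∈ Cl 1 r)
    exact ⟨F', by simpa [Cls] using h1, h2⟩
  | false =>
    have hF : F ∈ Pu := by simpa [Cls] using h
    by_cases hj : j = 0
    · subst hj
      obtain ⟨F', h1, h2⟩ := Pu_deriv_0 hF
      exact ⟨F', by simpa [Cls] using h1, h2⟩
    · obtain ⟨F', h1, h2⟩ := Pu_deriv_p j hj hF
      refine ⟨F', ?_, h2⟩
      have := Cl_mono (o := 1) (show 1 ≤ r + 1 by omega) h1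
      simpa [Cls, hj] using this

/-! ### bounds -/

def Lw (u : ℝ) : ℝ := 1 + |Real.log u|

lemma one_le_Lw (u : ℝ) : 1 ≤ Lw u := by unfold Lw; linarith [abs_nonneg (Real.log u)]

def Wp (n : ℕ) (θ : Fin 3 → ℝ) : ℝ := (n : ℝ) ^ (θ 2 / 2 - 1) * θ 1 ^ θ 2

lemma Wp_pos {n : ℕ} (hn : 1 ≤ n) {θ : Fin 3 → ℝ} (h1 : 0 < θ 1) : 0 < Wp n θ := by
  have : (0 : ℝ) < n := by exact_mod_cast hn
  unfold Wp; positivity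

lemma xx_eq {n : ℕ} (hn : 1 ≤ n) {θ : Fin 3 → ℝ} (h1 : 0 < θ 1) {u : ℝ} (hu : 0 < u) :
    xx n (θ 1) (θ 2) u = Wp n θ * u ^ θ 2 := by
  have hn' : (0 : ℝ) < n := by exact_mod_cast hn
  unfold xx ell Wp
  rw [mul_comm (θ 2), ← Real.rpow_def_of_pos (by positivity), Real.mul_rpow (by positivity) hu.le,
    Real.mul_rpow (by positivity) h1.le, Real.rpow_sub hn', Real.rpow_one, Real.sqrt_eq_rpow,
    ← Real.rpow_mul hn'.le]
  rw [show (1 / 2 * θ 2) = θ 2 / 2 by ring]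
  ring

lemma one_le_log {n : ℕ} (hn : 3 ≤ n) : 1 ≤ Real.log n := by
  rw [Real.le_log_iff_exp_le (by exact_mod_cast (by omega : 0 < n))]
  have h3 : (3 : ℝ) ≤ n := by exact_mod_cast hn
  linarith [Real.exp_one_lt_d9]

lemma ell_bound (B : Box) : ∃ C : ℝ, 1 ≤ C ∧ ∀ n : ℕ, 3 ≤ n → ∀ θ ∈ B.Om, ∀ u : ℝ, 0 < u →
    |ell n (θ 1) u| ≤ C * Real.log n * Lw u := by
  refine ⟨1 + (|Real.log B.d0| + |Real.log B.d1|), by linarith [abs_nonneg (Real.log B.d0), abs_nonneg (Real.log B.d1)], ?_⟩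
  intro n hn θ hθ u hu
  obtain ⟨-, ⟨h1, h2⟩, -⟩ := hθ
  have hn' : (0 : ℝ) < n := by exact_mod_cast (by omega : 0 < n)
  have hL := one_le_log hn
  have hd := B.hd0
  have hθ1 : 0 < θ 1 := hd.trans h1
  have e : ell n (θ 1) u = Real.log n / 2 + Real.log (θ 1) + Real.log u := by
    unfold ell
    rw [Real.log_mul (by positivity) hu.ne', Real.log_mul (by positivity) hθ1.ne',
      Real.log_sqrt hn'.le]
  have hb : |Real.log (θ 1)| ≤ |Real.log B.d0| + |Real.log B.d1| := by
    have l1 := Real.log_le_log hd h1.le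
    have l2 := Real.log_le_log hθ1 h2.le
    rw [abs_le]
    constructor
    · linarith [neg_abs_le (Real.log B.d0), abs_nonneg (Real.log B.d1)]
    · linarith [le_abs_self (Real.log B.d1), abs_nonneg (Real.log B.d0)]
  set D := |Real.log B.d0| + |Real.log B.d1|
  have hD : 0 ≤ D := by positivity
  have hu' : 0 ≤ |Real.log u| := abs_nonneg _
  calc |ell n (θ 1) u| ≤ Real.log n / 2 + D + |Real.log u| := by
        rw [e]
        refine (abs_add_le _ _).trans (add_le_add ((abs_add_le _ _).trans (add_le_add ?_ hb)) le_rfl)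
        rw [abs_of_nonneg (by linarith)]
    _ ≤ (1 + D) * Real.log n * Lw u := by
        unfold Lw
        have h3 : 0 ≤ D * (Real.log n - 1) := by apply mul_nonneg hD; linarith
        have h4 : 0 ≤ |Real.log u| * (Real.log n - 1) := by apply mul_nonneg hu'; linarith
        have h5 : 0 ≤ D * Real.log n * |Real.log u| := by positivity
        nlinarith

lemma gauss_pow_bound (s0 : ℝ) (hs0 : 0 < s0) (i : ℕ) : ∃ C : ℝ, 0 ≤ C ∧ ∀ s : ℝ, s0 < s →
    ∀ u : ℝ, 0 < u → u ^ (2 * i) * Real.exp (-(s ^ 2 * u ^ 2 / 2)) ≤ C * Real.exp (-u) := by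
  refine ⟨((2 * i).factorial : ℝ) * Real.exp (2 / s0 ^ 2), by positivity, fun s hs u hu => ?_⟩
  have h1 := Real.pow_div_factorial_le_exp u hu.le (2 * i)
  rw [div_le_iff₀ (by positivity)] at h1
  have h2 : -(s ^ 2 * u ^ 2 / 2) ≤ 2 / s0 ^ 2 - 2 * u := by
    have h3 : s0 ^ 2 * u ^ 2 ≤ s ^ 2 * u ^ 2 := by gcongr
    have h4 : 0 ≤ (s0 * u - 2 / s0) ^ 2 := sq_nonneg _
    have h5 : (s0 * u - 2 / s0) ^ 2 = s0 ^ 2 * u ^ 2 - 4 * u + 2 * (2 / s0 ^ 2) := by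
      field_simp; ring
    linarith
  calc u ^ (2 * i) * Real.exp (-(s ^ 2 * u ^ 2 / 2))
      ≤ (Real.exp u * ((2 * i).factorial : ℝ)) * Real.exp (2 / s0 ^ 2 - 2 * u) := by
        gcongr
    _ = _ := by
        rw [show 2 / s0 ^ 2 - 2 * u = -u + (2 / s0 ^ 2 + -u) by ring, Real.exp_add, Real.exp_add]
        have : Real.exp u * Real.exp (-u) = 1 := by rw [← Real.exp_add]; simp
        linear_combination ((2 * i).factorial : ℝ) * Real.exp (2 / s0 ^ 2) * Real.exp (-u) * this

lemma Cl_bound (B : Box) {o r : ℕ} {F : Sy} (hF : F ∈ Cl o r) : ∃ C : ℝ, 0 ≤ C ∧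
    ∀ n : ℕ, 3 ≤ n → ∀ θ ∈ B.Om, ∀ u : ℝ, 0 < u → |F n θ u| ≤
      C * (Wp n θ ^ o * Real.log n ^ r) * ((u ^ θ 2) ^ o * Lw u ^ r * Real.exp (-u)) := by
  unfold Cl at hF
  induction hF using Submodule.span_induction with
  | zero => exact ⟨0, le_rfl, by simp⟩
  | add x y _ _ hx hy =>
    obtain ⟨C, hC0, hC⟩ := hx
    obtain ⟨D, hD0, hD⟩ := hy
    refine ⟨C + D, by positivity, fun n hn θ hθ u hu => ?_⟩
    simp only [Pi.add_apply]
    refine (abs_add_le _ _).trans ((add_le_add (hC n hn θ hθ u hu) (hD n hn θ hθ u hu)).trans ?_)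
    apply le_of_eq; ring
  | smul a x _ hx =>
    obtain ⟨C, hC0, hC⟩ := hx
    refine ⟨|a| * C, by positivity, fun n hn θ hθ u hu => ?_⟩
    simp only [Pi.smul_apply, smul_eq_mul, abs_mul]
    calc _ ≤ |a| * _ := mul_le_mul_of_nonneg_left (hC n hn θ hθ u hu) (abs_nonneg a)
      _ = _ := by ring
  | mem F h =>
    obtain ⟨a, b, c, i, m, g, hm, hg, rfl⟩ := h
    obtain ⟨Cg, hCg⟩ := Good.bound hg
    obtain ⟨Ce, hCe1, hCe⟩ := ell_bound B
    obtain ⟨Cu, hCu0, hCu⟩ := gauss_pow_bound B.s0 B.hs0 i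
    have hCg0 : 0 ≤ Cg := by
      have := (abs_nonneg _).trans (hCg 1 one_pos)
      simpa using this
    refine ⟨|B.s1| ^ a * B.d0⁻¹ ^ b * 2 ^ c * Cu * Ce ^ m * Cg, ?_, ?_⟩
    · have := B.hd0
      positivity
    intro n hn θ hθ u hu
    have hn1 : 1 ≤ n := by omega
    have hθ' := hθ
    obtain ⟨⟨h1, h2⟩, ⟨h3, h4⟩, ⟨h5, h6⟩⟩ := hθ'
    have hd := B.hd0
    have hs := B.hs0
    have ha := B.ha0
    have ha1 := B.ha1
    have hθ0 : 0 < θ 0 := hs.trans h1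
    have hθ1 : 0 < θ 1 := hd.trans h3
    have hθ2 : 0 < θ 2 := ha.trans h5
    have hL := one_le_log hn
    have hLw := one_le_Lw u
    have hW := Wp_pos hn1 hθ1
    have e1 : |g (xx n (θ 1) (θ 2) u)| ≤ Cg * (Wp n θ ^ o * (u ^ θ 2) ^ o) := by
      have := hCg _ (xx_pos (n := n) (δ := θ 1) (α := θ 2) (u := u) hn1)
      rwa [xx_eq hn1 hθ1 hu, mul_pow, ← xx_eq hn1 hθ1 hu] at this
    have e2 : |ell n (θ 1) u| ^ m ≤ Ce ^ m * (Real.log n ^ r * Lw u ^ r) := by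
      calc |ell n (θ 1) u| ^ m ≤ (Ce * Real.log n * Lw u) ^ m := by
            gcongr; exact hCe n hn θ hθ u hu
        _ = Ce ^ m * (Real.log n ^ m * Lw u ^ m) := by ring
        _ ≤ _ := by
            gcongr
    have e3 := hCu (θ 0) h1 u hu
    have e4 : θ 0 ≤ |B.s1| := h2.le.trans (le_abs_self _)
    have e5 : (θ 1)⁻¹ ≤ B.d0⁻¹ := by gcongr
    have e6 : θ 2 ≤ 2 := by linarith
    calc |T a b c i m g n θ u| = θ 0 ^ a * (θ 1)⁻¹ ^ b * θ 2 ^ c *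
          (u ^ (2 * i) * Real.exp (-(θ 0 ^ 2 * u ^ 2 / 2))) * |ell n (θ 1) u| ^ m *
          |g (xx n (θ 1) (θ 2) u)| := by
          unfold T
          rw [abs_mul, abs_mul, abs_mul, abs_mul, abs_mul, abs_mul, abs_pow (ell _ _ _),
            abs_of_pos (show 0 < θ 0 ^ a by positivity),
            abs_of_pos (show 0 < (θ 1)⁻¹ ^ b by positivity),
            abs_of_pos (show 0 < θ 2 ^ c by positivity),
            abs_of_pos (show 0 < u ^ (2 * i) by positivity),
            abs_of_pos (Real.exp_pos _)]
          ring
      _ ≤ |B.s1| ^ a * B.d0⁻¹ ^ b * 2 ^ c * (Cu * Real.exp (-u)) *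
          (Ce ^ m * (Real.log n ^ r * Lw u ^ r)) * (Cg * (Wp n θ ^ o * (u ^ θ 2) ^ o)) := by
          gcongr
      _ = _ := by ring

lemma Lw_pow_le (ε : ℝ) (hε : 0 < ε) (r : ℕ) : ∃ C : ℝ, 0 < C ∧ ∀ u : ℝ, 1 ≤ u →
    Lw u ^ r ≤ C * u ^ ε := by
  set e := ε / (r + 1) with he
  have he0 : 0 < e := by positivity
  refine ⟨(1 + 1 / e) ^ r, by positivity, fun u hu => ?_⟩
  have hu0 : 0 < u := by linarith
  have h1 : Lw u ≤ (1 + 1 / e) * u ^ e := by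
    unfold Lw
    rw [abs_of_nonneg (Real.log_nonneg hu)]
    have := Real.log_le_rpow_div hu0.le he0
    have h2 := Real.one_le_rpow hu he0.le
    calc _ ≤ u ^ e + u ^ e / e := by linarith
      _ = _ := by ring
  calc Lw u ^ r ≤ ((1 + 1 / e) * u ^ e) ^ r := by
        have := one_le_Lw u
        gcongr
    _ = (1 + 1 / e) ^ r * u ^ (e * r) := by
        rw [mul_pow, ← Real.rpow_natCast (u ^ e), ← Real.rpow_mul hu0.le]
    _ ≤ _ := by
        gcongr
        rw [he, div_mul_eq_mul_div, div_le_iff₀ (by positivity)]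
        nlinarith

lemma Lw_inv (u : ℝ) : Lw u⁻¹ = Lw u := by unfold Lw; rw [Real.log_inv, abs_neg]

lemma Lw_mul_le {u v : ℝ} (hu : 0 < u) (hv : 0 < v) : Lw (u * v) ≤ Lw u * Lw v := by
  unfold Lw
  rw [Real.log_mul hu.ne' hv.ne']
  have := abs_add_le (Real.log u) (Real.log v)
  nlinarith [abs_nonneg (Real.log u), abs_nonneg (Real.log v)]

lemma Lw_pow_small (a0 : ℝ) (ha0 : 0 < a0) (r : ℕ) : ∃ C : ℝ, 0 < C ∧ ∀ α : ℝ, a0 < α → ∀ u : ℝ,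
    0 < u → u ≤ 1 → u ^ α * Lw u ^ r ≤ C := by
  obtain ⟨C, hC0, hC⟩ := Lw_pow_le a0 ha0 r
  refine ⟨C, hC0, fun α hα u hu hu1 => ?_⟩
  have h1 := hC u⁻¹ ((one_le_inv₀ hu).2 hu1)
  rw [Lw_inv, Real.inv_rpow hu.le] at h1
  have h2 : u ^ α ≤ u ^ a0 := Real.rpow_le_rpow_of_exponent_ge hu hu1 hα.le
  have h3 : 0 < u ^ a0 := by positivity
  have := one_le_Lw u
  calc u ^ α * Lw u ^ r ≤ u ^ a0 * (C * (u ^ a0)⁻¹) := by gcongr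
    _ = C := by field_simp

/-- uniform boundedness of the weights -/
lemma weight_bound (a0 : ℝ) (ha0 : 0 < a0) (r : ℕ) : ∃ C : ℝ, 0 < C ∧ ∀ α : ℝ, a0 < α → α < 2 →
    ∀ u : ℝ, 0 < u → u ^ α * Lw u ^ r ≤ C * Real.exp (u / 4) := by
  obtain ⟨C, hC0, hC⟩ := Lw_pow_small a0 ha0 r
  obtain ⟨D, hD0, hD⟩ := Lw_pow_le 1 one_pos r
  refine ⟨C + D * (64 * 6), by positivity, fun α hα hα2 u hu => ?_⟩
  rcases le_total u 1 with h | h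
  · have h1 : 1 ≤ Real.exp (u / 4) := Real.one_le_exp (by positivity)
    have h2 := hC α hα u hu h
    nlinarith [mul_nonneg hD0.le (by norm_num : (0:ℝ) ≤ 64 * 6)]
  · have h1 := Real.pow_div_factorial_le_exp (u / 4) (by positivity) 3
    have h2 : u ^ α ≤ u ^ (2 : ℝ) := Real.rpow_le_rpow_of_exponent_le h hα2.le
    rw [Real.rpow_two] at h2
    have h3 := hD u h
    rw [Real.rpow_one] at h3
    have hL := one_le_Lw u
    have h4 : u ^ 3 ≤ 64 * 6 * Real.exp (u / 4) := by
      norm_num [Nat.factorial] at h1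
      nlinarith
    calc u ^ α * Lw u ^ r ≤ u ^ 2 * (D * u) := by gcongr
      _ = D * u ^ 3 := by ring
      _ ≤ D * (64 * 6 * Real.exp (u / 4)) := by gcongr
      _ ≤ _ := by nlinarith [mul_pos hC0 (Real.exp_pos (u / 4))]

/-- bound used for the oscillatory integral lemma. -/
lemma Cl_bound' (B : Box) {o r : ℕ} {F : Sy} (hF : F ∈ Cl (o + 1) r) : ∃ C : ℝ, 0 ≤ C ∧
    ∀ n : ℕ, 3 ≤ n → ∀ θ ∈ B.Om, ∀ u : ℝ, 0 < u → |F n θ u| ≤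
      C * (Wp n θ ^ (o + 1) * Real.log n ^ r) * (u ^ θ 2 * Lw u ^ r * Real.exp (-(u / 2))) := by
  obtain ⟨C, hC0, hC⟩ := Cl_bound B hF
  obtain ⟨D, hD0, hD⟩ : ∃ D : ℝ, 0 < D ∧ ∀ α : ℝ, B.a0 < α → α < 2 →
    ∀ u : ℝ, 0 < u → (u ^ α) ^ o ≤ D * Real.exp (u / 2) := by
    refine ⟨((2 * o).factorial : ℝ) * 4 ^ o.succ.succ * 4 ^ o, by positivity, fun α hα hα2 u hu => ?_⟩
    have hα0 := B.ha0.trans hα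
    have h1 : (u ^ α) ^ o ≤ (1 + u) ^ (2 * o) := by
      rw [pow_mul]
      gcongr
      calc u ^ α ≤ (1 + u) ^ α := by gcongr; linarith
        _ ≤ (1 + u) ^ (2 : ℝ) := Real.rpow_le_rpow_of_exponent_le (by linarith) hα2.le
        _ = _ := Real.rpow_two _
    have h2 := Real.pow_div_factorial_le_exp ((1 + u) / 2) (by positivity) (2 * o)
    rw [div_le_iff₀ (by positivity), div_pow, div_le_iff₀ (by positivity)] at h2
    have h3 : Real.exp ((1 + u) / 2) ≤ 16 * Real.exp (u / 2) := by
      rw [show (1 + u) / 2 = 1 / 2 + u / 2 by ring, Real.exp_add]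
      gcongr
      calc Real.exp (1 / 2) ≤ Real.exp 1 := by gcongr; norm_num
        _ ≤ 16 := by linarith [Real.exp_one_lt_d9]
    refine h1.trans (h2.trans ?_)
    calc Real.exp ((1 + u) / 2) * ((2 * o).factorial : ℝ) * 2 ^ (2 * o)
        ≤ 16 * Real.exp (u / 2) * ((2 * o).factorial : ℝ) * 2 ^ (2 * o) := by gcongr
      _ = 16 * ((2 * o).factorial : ℝ) * 4 ^ o * 1 * Real.exp (u / 2) := by
          rw [pow_mul]; norm_num; ring
      _ ≤ 16 * ((2 * o).factorial : ℝ) * 4 ^ o * 4 ^ o * Real.exp (u / 2) := by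
          gcongr; exact one_le_pow₀ (by norm_num)
      _ = _ := by rw [pow_succ, pow_succ]; ring
  refine ⟨C * D, by positivity, fun n hn θ hθ u hu => (hC n hn θ hθ u hu).trans ?_⟩
  have hθ1 : 0 < θ 1 := B.hd0.trans hθ.2.1.1
  have hW := Wp_pos (show 1 ≤ n by omega) hθ1
  have hL := one_le_log hn
  have hLw := one_le_Lw u
  have h1 := hD (θ 2) hθ.2.2.1 (hθ.2.2.2.trans B.ha1) u hu
  have h2 : Real.exp (-u) * Real.exp (u / 2) = Real.exp (-(u / 2)) := by
    rw [← Real.exp_add]; ring_nf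
  calc C * (Wp n θ ^ (o + 1) * Real.log n ^ r) * ((u ^ θ 2) ^ (o + 1) * Lw u ^ r * Real.exp (-u))
      = C * (Wp n θ ^ (o + 1) * Real.log n ^ r) * (((u ^ θ 2) ^ o * u ^ θ 2) * Lw u ^ r * Real.exp (-u)) := by
        rw [pow_succ (u ^ θ 2)]
    _ ≤ C * (Wp n θ ^ (o + 1) * Real.log n ^ r) * (((D * Real.exp (u / 2)) * u ^ θ 2) * Lw u ^ r * Real.exp (-u)) := by
        gcongr
    _ = _ := by rw [← h2]; ring


/-! ## Part 3 : the oscillatory integral lemma -/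

lemma ML0 (a0 a1 : ℝ) (ha0 : 0 < a0) (ha1 : a1 < 2) (r : ℕ) : ∃ C : ℝ, 0 < C ∧
    ∀ α : ℝ, a0 < α → α < a1 → ∀ A : ℝ, 0 ≤ A → ∀ K K1 K2 K3 : ℝ → ℝ,
    (∀ s > 0, HasDerivAt K (K1 s / s) s) → (∀ s > 0, HasDerivAt K1 (K2 s / s) s) →
    (∀ s > 0, HasDerivAt K2 (K3 s / s) s) → ContinuousOn K3 (Ioi 0) →
    (∀ s > 0, |K s| ≤ A * (s ^ α * Lw s ^ r)) → (∀ s > 0, |K1 s| ≤ A * (s ^ α * Lw s ^ r)) →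
    (∀ s > 0, |K2 s| ≤ A * (s ^ α * Lw s ^ r)) → (∀ s > 0, |K3 s| ≤ A * (s ^ α * Lw s ^ r)) →
    Tendsto K atTop (𝓝 0) → Tendsto K1 atTop (𝓝 0) → Tendsto K2 atTop (𝓝 0) →
    IntegrableOn K (Ioi 0) →
    |∫ s in Ioi 0, Real.cos s * K s| ≤ C * A := by
  obtain ⟨C1, hC1, hC1'⟩ := Lw_pow_small a0 ha0 r
  set ε := (2 - a1) / 2 with hε
  have hε0 : 0 < ε := by rw [hε]; linarith
  obtain ⟨C2, hC2, hC2'⟩ := Lw_pow_le ε hε0 r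
  refine ⟨C1 + 4 + 6 * C2 / ε, by positivity, ?_⟩
  intro α hα0 hα1 A hA K K1 K2 K3 d0 d1 d2 c3 b0 b1 b2 b3 t0 t1 t2 hintg
  have c0 : ContinuousOn K (Ioi 0) := fun s hs => (d0 s hs).continuousAt.continuousWithinAt
  have c1 : ContinuousOn K1 (Ioi 0) := fun s hs => (d1 s hs).continuousAt.continuousWithinAt
  have c2 : ContinuousOn K2 (Ioi 0) := fun s hs => (d2 s hs).continuousAt.continuousWithinAt
  have hcint : IntegrableOn (fun s => Real.cos s * K s) (Ioi 0) := by
    refine Integrable.mono hintg ((Real.continuous_cos.continuousOn.mul c0).aestronglyMeasurable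
      measurableSet_Ioi) (Eventually.of_forall fun s => ?_)
    rw [norm_mul]
    exact mul_le_of_le_one_left (norm_nonneg _) (Real.abs_cos_le_one s)
  have hsplit : ∫ s in Ioi 0, Real.cos s * K s
      = (∫ s in Ioc 0 1, Real.cos s * K s) + ∫ s in Ioi 1, Real.cos s * K s := by
    rw [← setIntegral_union (Ioc_disjoint_Ioi le_rfl) measurableSet_Ioi
      (hcint.mono_set Ioc_subset_Ioi_self) (hcint.mono_set (Ioi_subset_Ioi zero_le_one)),
      Ioc_union_Ioi_eq_Ioi zero_le_one]
  have hfirst : |∫ s in Ioc 0 1, Real.cos s * K s| ≤ C1 * A := by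
    have := norm_setIntegral_le_of_norm_le_const (μ := volume) (s := Ioc (0:ℝ) 1)
      (f := fun s => Real.cos s * K s) (C := C1 * A) (by simp) (by
        intro s hs
        rw [Real.norm_eq_abs, abs_mul]
        calc |Real.cos s| * |K s| ≤ 1 * (A * C1) := by
              gcongr
              · exact Real.abs_cos_le_one s
              · exact (b0 s hs.1).trans (by gcongr; exact hC1' α hα0 s hs.1 hs.2)
          _ = _ := by ring)
    simpa using this
  set K4 : ℝ → ℝ := fun s => (K3 s - 3 * K2 s + 2 * K1 s) / s ^ 3 with hK4
  set G : ℝ → ℝ := fun s => Real.sin s * K s + Real.cos s * (K1 s / s)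
    - Real.sin s * ((K2 s - K1 s) / s ^ 2) with hG
  have hGd : ∀ s ∈ Ioi (1 : ℝ), HasDerivAt G (Real.cos s * K s - Real.sin s * K4 s) s := by
    intro s hs
    have hs0 : 0 < s := lt_trans one_pos hs
    have e1 := (Real.hasDerivAt_sin s).mul (d0 s hs0)
    have e2 := (Real.hasDerivAt_cos s).mul ((d1 s hs0).div (hasDerivAt_id s) hs0.ne')
    have e3 := (Real.hasDerivAt_sin s).mul (((d2 s hs0).sub (d1 s hs0)).div
      (hasDerivAt_pow 2 s) (by positivity))
    refine ((e1.add e2).sub e3).congr_deriv ?_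
    simp only [hK4, id, Pi.sub_apply, Pi.div_apply]
    field_simp
    norm_num
    ring
  have hK4b : ∀ s ∈ Ioi (1 : ℝ), ‖Real.sin s * K4 s‖ ≤ 6 * A * C2 * s ^ (-1 - ε) := by
    intro s hs
    have hs1 : 1 ≤ s := le_of_lt hs
    have hs0 : 0 < s := lt_trans one_pos hs
    have e1 : |K3 s - 3 * K2 s + 2 * K1 s| ≤ 6 * (A * (s ^ α * Lw s ^ r)) := by
      have h1 := b1 s hs0
      have h2 := b2 s hs0
      have h3 := b3 s hs0
      rw [abs_le] at *
      constructor <;> linarith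
    rw [Real.norm_eq_abs, abs_mul]
    have hL := one_le_Lw s
    calc |Real.sin s| * |K4 s| ≤ 1 * (6 * (A * (s ^ α * (C2 * s ^ ε))) / s ^ 3) := by
          gcongr
          · exact Real.abs_sin_le_one s
          · rw [hK4]; simp only; rw [abs_div, abs_of_pos (show 0 < s ^ 3 by positivity)]
            gcongr
            refine e1.trans ?_
            gcongr
            exact hC2' s hs1
      _ = 6 * A * C2 * s ^ (α + ε - 3) := by
          rw [Real.rpow_sub hs0, Real.rpow_add hs0]
          norm_cast
          ring
      _ ≤ _ := by
          refine mul_le_mul_of_nonneg_left ?_ (by positivity)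
          refine Real.rpow_le_rpow_of_exponent_le hs1 ?_
          rw [hε]; linarith
  have hi4 : IntegrableOn (fun s => 6 * A * C2 * s ^ (-1 - ε)) (Ioi (1:ℝ)) :=
    (integrableOn_Ioi_rpow_of_lt (by linarith) one_pos).const_mul _
  have hsK4 : IntegrableOn (fun s => Real.sin s * K4 s) (Ioi 1) := by
    refine hi4.mono' ?_ ?_
    · refine ContinuousOn.aestronglyMeasurable ?_ measurableSet_Ioi
      have hsub : Ioi (1:ℝ) ⊆ Ioi 0 := Ioi_subset_Ioi zero_le_one
      refine Real.continuous_sin.continuousOn.mul ?_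
      refine ContinuousOn.div ?_ (by fun_prop) ?_
      · exact ((c3.mono hsub).sub ((c2.mono hsub).const_mul 3)).add ((c1.mono hsub).const_mul 2)
      · intro s hs
        have : 0 < s := lt_trans one_pos hs
        positivity
    · exact (ae_restrict_mem measurableSet_Ioi).mono hK4b
  have hcK1 := hcint.mono_set (Ioi_subset_Ioi (zero_le_one (α := ℝ)))
  have hbd : ∀ (f : ℝ → ℝ) (k : ℝ → ℝ), (∀ s, |f s| ≤ 1) → Tendsto k atTop (𝓝 0) →
      Tendsto (fun s => f s * k s) atTop (𝓝 0) := by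
    intro f k hf hk
    rw [tendsto_zero_iff_abs_tendsto_zero] at hk ⊢
    refine squeeze_zero (fun s => abs_nonneg _) (fun s => ?_) hk
    simp only [Function.comp]
    rw [abs_mul]
    exact mul_le_of_le_one_left (abs_nonneg _) (hf s)
  have hGt : Tendsto G atTop (𝓝 0) := by
    have hinv : Tendsto (fun s : ℝ => s⁻¹) atTop (𝓝 0) := tendsto_inv_atTop_zero
    have e1 := hbd _ _ Real.abs_sin_le_one t0
    have e2 : Tendsto (fun s => K1 s / s) atTop (𝓝 0) := by
      simpa [div_eq_mul_inv] using t1.mul hinv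
    have e3 : Tendsto (fun s => (K2 s - K1 s) / s ^ 2) atTop (𝓝 0) := by
      have := (t2.sub t1).mul (hinv.pow 2)
      simpa [div_eq_mul_inv] using this
    have := (e1.add (hbd _ _ Real.abs_cos_le_one e2)).sub (hbd _ _ Real.abs_sin_le_one e3)
    simpa [hG] using this
  have hGc : ContinuousWithinAt G (Ici 1) 1 := by
    have h01 : (0:ℝ) < 1 := one_pos
    have k0 := (d0 1 h01).continuousAt
    have k1 := (d1 1 h01).continuousAt
    have k2 := (d2 1 h01).continuousAt
    have : ContinuousAt G 1 := by
      refine ((Real.continuous_sin.continuousAt.mul k0).add (Real.continuous_cos.continuousAt.mul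
        (k1.div continuousAt_id one_ne_zero))).sub (Real.continuous_sin.continuousAt.mul
        ((k2.sub k1).div (continuousAt_id.pow 2) (by simp)))
    exact this.continuousWithinAt
  have hFTC := integral_Ioi_of_hasDerivAt_of_tendsto hGc hGd (hcK1.sub hsK4) hGt
  rw [integral_sub hcK1 hsK4] at hFTC
  have hI4 : |∫ s in Ioi 1, Real.sin s * K4 s| ≤ 6 * C2 / ε * A := by
    calc |∫ s in Ioi 1, Real.sin s * K4 s| ≤ ∫ s in Ioi 1, 6 * A * C2 * s ^ (-1 - ε) :=
          norm_integral_le_of_norm_le hi4 ((ae_restrict_mem measurableSet_Ioi).mono hK4b)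
      _ = _ := by
          rw [integral_const_mul, integral_Ioi_rpow_of_lt (by linarith) one_pos]
          rw [Real.one_rpow, show -1 - ε + 1 = -ε by ring]
          field_simp
  have hG1 : |G 1| ≤ 4 * A := by
    have hw : (1:ℝ) ^ α * Lw 1 ^ r = 1 := by simp [Lw]
    have h0 := b0 1 one_pos
    have h1 := b1 1 one_pos
    have h2 := b2 1 one_pos
    rw [hw, mul_one] at h0 h1 h2
    have hs := Real.abs_sin_le_one 1
    have hc := Real.abs_cos_le_one 1
    simp only [hG, div_one, one_pow]
    calc |Real.sin 1 * K 1 + Real.cos 1 * K1 1 - Real.sin 1 * (K2 1 - K1 1)|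
        ≤ |Real.sin 1| * |K 1| + |Real.cos 1| * |K1 1| + |Real.sin 1| * (|K2 1| + |K1 1|) := by
          refine (abs_sub _ _).trans (add_le_add ((abs_add_le _ _).trans ?_) ?_)
          · rw [abs_mul, abs_mul]
          · rw [abs_mul]; gcongr; exact abs_sub _ _
      _ ≤ 1 * A + 1 * A + 1 * (A + A) := by gcongr
      _ = _ := by ring
  have hsecond : |∫ s in Ioi 1, Real.cos s * K s| ≤ 4 * A + 6 * C2 / ε * A := by
    have : ∫ s in Ioi 1, Real.cos s * K s = -G 1 + ∫ s in Ioi 1, Real.sin s * K4 s := by linarith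
    rw [this]
    refine (abs_add_le _ _).trans (add_le_add ?_ hI4)
    rwa [abs_neg]
  rw [hsplit]
  refine (abs_add_le _ _).trans ((add_le_add hfirst hsecond).trans (le_of_eq (by ring)))


/-- the model tail -/
def Tt (r : ℕ) (α Y : ℝ) : ℝ := (1 + |Y|) ^ (-(1 + α)) * (1 + Real.log (1 + |Y|)) ^ r

lemma exp_half_integrable (k : ℝ) (hk : 0 < k) :
    IntegrableOn (fun u : ℝ => Real.exp (-(u / k))) (Ioi 0) := by
  have := integrableOn_exp_mul_Ioi (a := -(1 / k)) (by simpa using hk) 0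
  refine this.congr_fun (fun u _ => ?_) measurableSet_Ioi
  ring_nf

lemma exp_half_integral : ∫ u in Ioi (0:ℝ), Real.exp (-(u / 4)) = 4 := by
  have := integral_exp_mul_Ioi (a := -(1 / 4)) (by norm_num) 0
  norm_num at this
  refine Eq.trans ?_ this
  refine setIntegral_congr_fun measurableSet_Ioi (fun u _ => ?_)
  ring_nf

lemma ML (a0 a1 : ℝ) (ha0 : 0 < a0) (ha1 : a1 < 2) (r : ℕ) : ∃ C : ℝ, 0 < C ∧
    ∀ α : ℝ, a0 < α → α < a1 → ∀ A : ℝ, 0 ≤ A → ∀ K K1 K2 K3 : ℝ → ℝ,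
    (∀ s > 0, HasDerivAt K (K1 s / s) s) → (∀ s > 0, HasDerivAt K1 (K2 s / s) s) →
    (∀ s > 0, HasDerivAt K2 (K3 s / s) s) → ContinuousOn K3 (Ioi 0) →
    (∀ s > 0, |K s| ≤ A * (s ^ α * Lw s ^ r * Real.exp (-(s / 2)))) →
    (∀ s > 0, |K1 s| ≤ A * (s ^ α * Lw s ^ r * Real.exp (-(s / 2)))) →
    (∀ s > 0, |K2 s| ≤ A * (s ^ α * Lw s ^ r * Real.exp (-(s / 2)))) →
    (∀ s > 0, |K3 s| ≤ A * (s ^ α * Lw s ^ r * Real.exp (-(s / 2)))) → ∀ Y : ℝ,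
    |∫ s in Ioi 0, Real.cos (Y * s) * K s| ≤ C * A * Tt r α Y := by
  obtain ⟨C0, hC0, hML⟩ := ML0 a0 a1 ha0 ha1 r
  obtain ⟨Cw, hCw, hwb⟩ := weight_bound a0 ha0 r
  refine ⟨8 * C0 + 32 * Cw, by positivity, ?_⟩
  intro α hα0 hα1 A hA K K1 K2 K3 d0 d1 d2 c3 b0 b1 b2 b3 Y
  have hα2 : α < 2 := hα1.trans ha1
  have hαp : 0 < α := ha0.trans hα0
  -- exponential bound
  have hexp : ∀ k : ℝ → ℝ, (∀ s > 0, |k s| ≤ A * (s ^ α * Lw s ^ r * Real.exp (-(s / 2)))) →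
      ∀ s > 0, |k s| ≤ A * Cw * Real.exp (-(s / 4)) := by
    intro k hk s hs
    refine (hk s hs).trans ?_
    have h1 := hwb α hα0 hα2 s hs
    calc A * (s ^ α * Lw s ^ r * Real.exp (-(s / 2)))
        ≤ A * (Cw * Real.exp (s / 4) * Real.exp (-(s / 2))) := by gcongr
      _ = _ := by
        rw [mul_assoc Cw, ← Real.exp_add, mul_assoc]; ring_nf
  have hsimple : ∀ k : ℝ → ℝ, (∀ s > 0, |k s| ≤ A * (s ^ α * Lw s ^ r * Real.exp (-(s / 2)))) →
      ∀ s > 0, |k s| ≤ A * (s ^ α * Lw s ^ r) := by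
    intro k hk s hs
    refine (hk s hs).trans ?_
    have hL := one_le_Lw s
    exact mul_le_mul_of_nonneg_left (mul_le_of_le_one_right (by positivity)
      (Real.exp_le_one_iff.2 (by linarith [hs]))) hA
  have htend : ∀ k : ℝ → ℝ, (∀ s > 0, |k s| ≤ A * (s ^ α * Lw s ^ r * Real.exp (-(s / 2)))) →
      Tendsto k atTop (𝓝 0) := by
    intro k hk
    rw [tendsto_zero_iff_abs_tendsto_zero]
    have h1 : Tendsto (fun s : ℝ => A * Cw * Real.exp (-(s / 4))) atTop (𝓝 0) := by
      have := (Real.tendsto_exp_neg_atTop_nhds_zero.comp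
        (tendsto_id.atTop_div_const (show (0:ℝ) < 4 by norm_num))).const_mul (A * Cw)
      simpa using this
    refine squeeze_zero' (Eventually.of_forall fun s => abs_nonneg _) ?_ h1
    filter_upwards [eventually_gt_atTop 0] with s hs using hexp k hk s hs
  have c0 : ContinuousOn K (Ioi 0) := fun s hs => (d0 s hs).continuousAt.continuousWithinAt
  have hKint : IntegrableOn K (Ioi 0) := by
    refine Integrable.mono' ((exp_half_integrable 4 (by norm_num)).const_mul (A * Cw))
      (c0.aestronglyMeasurable measurableSet_Ioi)
      ((ae_restrict_mem measurableSet_Ioi).mono fun s hs => hexp K b0 s hs)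
  have hY0 := abs_nonneg Y
  have hcosabs : ∫ s in Ioi 0, Real.cos (Y * s) * K s = ∫ s in Ioi 0, Real.cos (|Y| * s) * K s := by
    rcases abs_choice Y with h | h <;> rw [h]
    simp
  have hTt0 : 0 < Tt r α Y := by
    unfold Tt
    have := Real.log_nonneg (show 1 ≤ 1 + |Y| by linarith)
    positivity
  rw [hcosabs]
  rcases le_total |Y| 1 with hY | hY
  · have h1 : |∫ s in Ioi 0, Real.cos (|Y| * s) * K s| ≤ A * Cw * 4 := by
      rw [← exp_half_integral, ← integral_const_mul, ← Real.norm_eq_abs]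
      refine norm_integral_le_of_norm_le
        ((exp_half_integrable 4 (by norm_num)).const_mul (A * Cw))
        ((ae_restrict_mem measurableSet_Ioi).mono fun s hs => ?_)
      rw [norm_mul]
      exact (mul_le_of_le_one_left (norm_nonneg _) (Real.abs_cos_le_one _)).trans (hexp K b0 s hs)
    have h2 : 1 / 8 ≤ Tt r α Y := by
      unfold Tt
      have hl := Real.log_nonneg (show 1 ≤ 1 + |Y| by linarith)
      have e1 : (1:ℝ) ≤ (1 + Real.log (1 + |Y|)) ^ r := one_le_pow₀ (by linarith)
      have e2 : (1 / 8 : ℝ) ≤ (1 + |Y|) ^ (-(1 + α)) := by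
        rw [Real.rpow_neg (by positivity), one_div]
        gcongr
        calc (1 + |Y|) ^ (1 + α) ≤ (2:ℝ) ^ (1 + α) := by gcongr; linarith
          _ ≤ (2:ℝ) ^ (3:ℝ) := by gcongr <;> linarith
          _ = 8 := by norm_num
      calc (1 / 8 : ℝ) = 1 / 8 * 1 := by ring
        _ ≤ _ := by gcongr
    have h3 : 0 ≤ A * Cw := by positivity
    calc _ ≤ A * Cw * 4 := h1
      _ = 32 * Cw * A * (1 / 8) := by ring
      _ ≤ (8 * C0 + 32 * Cw) * A * Tt r α Y := by gcongr; linarith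
  · set y := |Y| with hy
    have hyp : 0 < y := by linarith
    have hsc : ∀ s > 0, HasDerivAt (fun s : ℝ => s / y) (1 / y) s := fun s _ =>
      (hasDerivAt_id s).div_const y
    have hder : ∀ k k' : ℝ → ℝ, (∀ s > 0, HasDerivAt k (k' s / s) s) →
        ∀ s > 0, HasDerivAt (fun s => k (s / y)) (k' (s / y) / s) s := by
      intro k k' hk s hs
      refine ((hk (s / y) (by positivity)).comp s (hsc s hs)).congr_deriv ?_
      have : (0:ℝ) < s := hs
      field_simp
    have hbb : ∀ k : ℝ → ℝ, (∀ s > 0, |k s| ≤ A * (s ^ α * Lw s ^ r)) →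
        ∀ s > 0, |k (s / y)| ≤ (A * (y ^ (-α) * Lw y ^ r)) * (s ^ α * Lw s ^ r) := by
      intro k hk s hs
      have hs' : (0:ℝ) < s := hs
      refine (hk (s / y) (by positivity)).trans ?_
      have h1 : Lw (s / y) ≤ Lw s * Lw y := by
        rw [div_eq_mul_inv, ← Lw_inv y]
        exact Lw_mul_le hs (by positivity)
      have h2 := one_le_Lw (s / y)
      calc A * ((s / y) ^ α * Lw (s / y) ^ r) ≤ A * ((s / y) ^ α * (Lw s * Lw y) ^ r) := by gcongr
        _ = _ := by
          rw [Real.div_rpow hs'.le hyp.le, Real.rpow_neg hyp.le, mul_pow]; ring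
    have htt : ∀ k : ℝ → ℝ, Tendsto k atTop (𝓝 0) → Tendsto (fun s => k (s / y)) atTop (𝓝 0) :=
      fun k hk => hk.comp (tendsto_id.atTop_div_const hyp)
    have hcov := integral_comp_mul_left_Ioi (fun s => Real.cos s * K (s / y)) 0 hyp
    have e1 : ∫ s in Ioi 0, Real.cos (y * s) * K s
        = y⁻¹ * ∫ s in Ioi 0, Real.cos s * K (s / y) := by
      rw [mul_zero, smul_eq_mul] at hcov
      rw [← hcov]
      refine setIntegral_congr_fun measurableSet_Ioi (fun s _ => ?_)
      rw [mul_div_cancel_left₀ _ hyp.ne']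
    have hintg' : IntegrableOn (fun s => K (s / y)) (Ioi 0) := by
      have := (integrableOn_Ioi_comp_mul_left_iff K 0 (inv_pos.2 hyp)).2 (by simpa using hKint)
      refine this.congr_fun (fun s _ => ?_) measurableSet_Ioi
      ring_nf
    have hLy := one_le_Lw y
    have key := hML α hα0 hα1 (A * (y ^ (-α) * Lw y ^ r)) (by positivity)
      (fun s => K (s / y)) (fun s => K1 (s / y)) (fun s => K2 (s / y)) (fun s => K3 (s / y))
      (hder K K1 d0) (hder K1 K2 d1) (hder K2 K3 d2)
      (c3.comp (by fun_prop) (fun s (hs : 0 < s) => by show 0 < s / y; positivity))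
      (hbb K (hsimple K b0)) (hbb K1 (hsimple K1 b1)) (hbb K2 (hsimple K2 b2))
      (hbb K3 (hsimple K3 b3)) (htt _ (htend K b0)) (htt _ (htend K1 b1)) (htt _ (htend K2 b2))
      hintg'
    rw [e1, abs_mul, abs_of_pos (inv_pos.2 hyp)]
    have hcmp : y⁻¹ * (y ^ (-α) * Lw y ^ r) ≤ 8 * Tt r α Y := by
      unfold Tt
      rw [← hy]
      have f1 : Lw y ≤ 1 + Real.log (1 + y) := by
        unfold Lw
        rw [abs_of_nonneg (Real.log_nonneg hY)]
        gcongr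
        linarith
      have f2 : y⁻¹ * y ^ (-α) ≤ 8 * (1 + y) ^ (-(1 + α)) := by
        have g1 : y⁻¹ * y ^ (-α) = y ^ (-(1 + α)) := by
          rw [← Real.rpow_neg_one, ← Real.rpow_add hyp]; ring_nf
        rw [g1, Real.rpow_neg hyp.le, Real.rpow_neg (by positivity), ← div_eq_mul_inv,
          inv_eq_one_div, div_le_div_iff₀ (by positivity) (by positivity), one_mul]
        calc (1 + y) ^ (1 + α) ≤ (2 * y) ^ (1 + α) := by gcongr; linarith
          _ = 2 ^ (1 + α) * y ^ (1 + α) := Real.mul_rpow (by norm_num) hyp.le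
          _ ≤ 2 ^ (3:ℝ) * y ^ (1 + α) := by gcongr <;> linarith
          _ = _ := by norm_num
      calc y⁻¹ * (y ^ (-α) * Lw y ^ r) = (y⁻¹ * y ^ (-α)) * Lw y ^ r := by ring
        _ ≤ (8 * (1 + y) ^ (-(1 + α))) * (1 + Real.log (1 + y)) ^ r := by gcongr
        _ = _ := by ring
    calc y⁻¹ * |∫ s in Ioi 0, Real.cos s * K (s / y)|
        ≤ y⁻¹ * (C0 * (A * (y ^ (-α) * Lw y ^ r))) := by gcongr
      _ = C0 * A * (y⁻¹ * (y ^ (-α) * Lw y ^ r)) := by ring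
      _ ≤ C0 * A * (8 * Tt r α Y) := by gcongr
      _ = (8 * C0) * A * Tt r α Y := by ring
      _ ≤ _ := by gcongr; linarith


lemma Wp_upper (B : Box) : ∃ C : ℝ, 0 < C ∧ ∀ n : ℕ, 1 ≤ n → ∀ θ ∈ B.Om,
    Wp n θ ≤ C * (n : ℝ) ^ (B.a1 / 2 - 1) := by
  refine ⟨(1 + |B.d1|) ^ 2, by positivity, fun n hn θ hθ => ?_⟩
  obtain ⟨-, ⟨h1, h2⟩, h3, h4⟩ := hθ
  have hn' : (1 : ℝ) ≤ n := by exact_mod_cast hn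
  have hd := B.hd0
  have ha := B.ha0
  have ha1 := B.ha1
  have hθ1 : 0 < θ 1 := by linarith
  unfold Wp
  have e1 : (n : ℝ) ^ (θ 2 / 2 - 1) ≤ (n : ℝ) ^ (B.a1 / 2 - 1) :=
    Real.rpow_le_rpow_of_exponent_le hn' (by linarith)
  have e2 : θ 1 ^ θ 2 ≤ (1 + |B.d1|) ^ 2 := by
    calc θ 1 ^ θ 2 ≤ (1 + |B.d1|) ^ θ 2 := by
          refine Real.rpow_le_rpow hθ1.le ?_ (by linarith)
          linarith [le_abs_self B.d1]
      _ ≤ (1 + |B.d1|) ^ (2 : ℝ) :=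
          Real.rpow_le_rpow_of_exponent_le (by linarith [abs_nonneg B.d1]) (by linarith)
      _ = _ := by norm_cast
  rw [mul_comm]
  gcongr

lemma Wp_bdd (B : Box) : ∃ C : ℝ, 0 < C ∧ ∀ n : ℕ, 1 ≤ n → ∀ θ ∈ B.Om, Wp n θ ≤ C := by
  obtain ⟨C, hC, h⟩ := Wp_upper B
  refine ⟨C, hC, fun n hn θ hθ => (h n hn θ hθ).trans ?_⟩
  have hn' : (1 : ℝ) ≤ n := by exact_mod_cast hn
  refine mul_le_of_le_one_right hC.le (Real.rpow_le_one_of_one_le_of_nonpos hn' ?_)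
  linarith [B.ha1]

lemma Wp_lower (B : Box) : ∃ c : ℝ, 0 < c ∧ ∀ n : ℕ, 1 ≤ n → ∀ θ ∈ B.Om,
    c * (n : ℝ)⁻¹ ≤ Wp n θ := by
  have hd := B.hd0
  have hm : 0 < min B.d0 1 := lt_min hd one_pos
  refine ⟨(min B.d0 1) ^ 2, by positivity, fun n hn θ hθ => ?_⟩
  obtain ⟨-, ⟨h1, h2⟩, h3, h4⟩ := hθ
  have hn' : (1 : ℝ) ≤ n := by exact_mod_cast hn
  have ha := B.ha0
  have ha1 := B.ha1
  have hθ1 : 0 < θ 1 := by linarith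
  unfold Wp
  have e1 : (n : ℝ)⁻¹ ≤ (n : ℝ) ^ (θ 2 / 2 - 1) := by
    rw [← Real.rpow_neg_one]
    exact Real.rpow_le_rpow_of_exponent_le hn' (by linarith)
  have e2 : (min B.d0 1) ^ 2 ≤ θ 1 ^ θ 2 := by
    calc (min B.d0 1) ^ 2 = (min B.d0 1) ^ (2:ℝ) := by norm_cast
      _ ≤ (min B.d0 1) ^ θ 2 :=
          Real.rpow_le_rpow_of_exponent_ge hm (min_le_right _ _) (by linarith)
      _ ≤ _ := Real.rpow_le_rpow hm.le ((min_le_left _ _).trans h1.le) (by linarith)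
  rw [mul_comm]
  gcongr

def Q (n : ℕ) (Y : ℝ) (F : Sy) (θ : Fin 3 → ℝ) : ℝ := ∫ u in Ioi 0, Real.cos (Y * u) * F n θ u

lemma Om_pos {B : Box} {θ : Fin 3 → ℝ} (hθ : θ ∈ B.Om) : 0 < θ 0 ∧ 0 < θ 1 ∧ 0 < θ 2 ∧ θ 2 < 2 := by
  obtain ⟨⟨h1, h2⟩, ⟨h3, h4⟩, h5, h6⟩ := hθ
  exact ⟨B.hs0.trans h1, B.hd0.trans h3, B.ha0.trans h5, h6.trans B.ha1⟩

lemma Tt_pos (r : ℕ) (α Y : ℝ) : 0 < Tt r α Y := by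
  unfold Tt
  have := Real.log_nonneg (show 1 ≤ 1 + |Y| by linarith [abs_nonneg Y])
  positivity

lemma Cl_cont {o r : ℕ} {F : Sy} (hF : F ∈ Cl o r) {n : ℕ} (hn : 1 ≤ n) {θ : Fin 3 → ℝ}
    (h1 : 0 < θ 1) : ContinuousOn (F n θ) (Ioi 0) := by
  obtain ⟨F', -, h⟩ := Cl_deriv_u hF
  exact fun u hu => (h n hn θ h1 u hu).continuousAt.continuousWithinAt

lemma Q_bound (B : Box) {o r : ℕ} {F : Sy} (hF : F ∈ Cl (o + 1) r) : ∃ C : ℝ, 0 < C ∧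
    ∀ n : ℕ, 3 ≤ n → ∀ θ ∈ B.Om, ∀ Y : ℝ,
    |Q n Y F θ| ≤ C * (Wp n θ ^ (o + 1) * Real.log n ^ r) * Tt r (θ 2) Y := by
  obtain ⟨F1, hF1, r1⟩ := Cl_deriv_u hF
  obtain ⟨F2, hF2, r2⟩ := Cl_deriv_u hF1
  obtain ⟨F3, hF3, r3⟩ := Cl_deriv_u hF2
  obtain ⟨C0, hC0, b0⟩ := Cl_bound' B hF
  obtain ⟨C1, hC1, b1⟩ := Cl_bound' B hF1
  obtain ⟨C2, hC2, b2⟩ := Cl_bound' B hF2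
  obtain ⟨C3, hC3, b3⟩ := Cl_bound' B hF3
  obtain ⟨C, hC, hML⟩ := ML B.a0 B.a1 B.ha0 B.ha1 r
  refine ⟨C * (C0 + C1 + C2 + C3 + 1), by positivity, fun n hn θ hθ Y => ?_⟩
  obtain ⟨p0, p1, p2, p3⟩ := Om_pos hθ
  have hn1 : 1 ≤ n := by omega
  have hlog := one_le_log hn
  have hW := Wp_pos hn1 p1
  have hP : 0 < Wp n θ ^ (o + 1) * Real.log n ^ r := by positivity
  have up : ∀ (D : ℝ), D ≤ C0 + C1 + C2 + C3 + 1 → ∀ s > 0, ∀ x : ℝ,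
      x ≤ D * (Wp n θ ^ (o + 1) * Real.log n ^ r) * (s ^ θ 2 * Lw s ^ r * Real.exp (-(s / 2))) →
      x ≤ ((C0 + C1 + C2 + C3 + 1) * (Wp n θ ^ (o + 1) * Real.log n ^ r))
        * (s ^ θ 2 * Lw s ^ r * Real.exp (-(s / 2))) := by
    intro D hD s hs x hx
    have := one_le_Lw s
    have hs' : (0:ℝ) < s := hs
    refine hx.trans ?_
    gcongr
  have := hML (θ 2) hθ.2.2.1 hθ.2.2.2
    ((C0 + C1 + C2 + C3 + 1) * (Wp n θ ^ (o + 1) * Real.log n ^ r)) (by positivity)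
    (F n θ) (F1 n θ) (F2 n θ) (F3 n θ) (r1 n hn1 θ p1) (r2 n hn1 θ p1) (r3 n hn1 θ p1)
    (Cl_cont hF3 hn1 p1)
    (fun s hs => up C0 (by linarith) s hs _ (b0 n hn θ hθ s hs))
    (fun s hs => up C1 (by linarith) s hs _ (b1 n hn θ hθ s hs))
    (fun s hs => up C2 (by linarith) s hs _ (b2 n hn θ hθ s hs))
    (fun s hs => up C3 (by linarith) s hs _ (b3 n hn θ hθ s hs)) Y
  refine this.trans (le_of_eq ?_)
  ring

/-- membership in a class for which integrals are fine. -/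
def Nice (F : Sy) : Prop := (∃ r, F ∈ Cl 1 r) ∨ F ∈ Cl 0 0

lemma Cls.nice {flag : Bool} {r : ℕ} {F : Sy} (h : Cls flag r F) : Nice F := by
  cases flag with
  | true => exact Or.inl ⟨r, by simpa [Cls] using h⟩
  | false => exact Or.inr (Pu_le (by simpa [Cls] using h))

lemma Nice.cont {F : Sy} (hF : Nice F) {n : ℕ} (hn : 1 ≤ n) {θ : Fin 3 → ℝ}
    (h1 : 0 < θ 1) : ContinuousOn (F n θ) (Ioi 0) := by
  rcases hF with ⟨r, h⟩ | h
  · exact Cl_cont h hn h1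
  · exact Cl_cont h hn h1

lemma Nice.dom (B : Box) {F : Sy} (hF : Nice F) {n : ℕ} (hn : 3 ≤ n) : ∃ D : ℝ, 0 ≤ D ∧
    ∀ θ ∈ B.Om, ∀ u : ℝ, 0 < u → |F n θ u| ≤ D * Real.exp (-(u / 4)) := by
  have hn1 : 1 ≤ n := by omega
  have hlog := one_le_log hn
  rcases hF with ⟨r, h⟩ | h
  · obtain ⟨C, hC, hb⟩ := Cl_bound' (o := 0) B h
    obtain ⟨D, hD, hw⟩ := weight_bound B.a0 B.ha0 r
    obtain ⟨E, hE, hWp⟩ := Wp_bdd B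
    refine ⟨C * (E * Real.log n ^ r) * D, by positivity, fun θ hθ u hu => ?_⟩
    obtain ⟨p0, p1, p2, p3⟩ := Om_pos hθ
    refine (hb n hn θ hθ u hu).trans ?_
    have h1 := hw (θ 2) hθ.2.2.1 p3 u hu
    have h2 := hWp n hn1 θ hθ
    have h3 := Wp_pos hn1 p1
    have h4 := one_le_Lw u
    calc C * (Wp n θ ^ (0 + 1) * Real.log n ^ r) * (u ^ θ 2 * Lw u ^ r * Real.exp (-(u / 2)))
        ≤ C * (E * Real.log n ^ r) * (D * Real.exp (u / 4) * Real.exp (-(u / 2))) := by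
          rw [zero_add, pow_one]; gcongr
      _ = _ := by
          rw [mul_assoc D, ← Real.exp_add, mul_assoc (C * _) D]
          congr 3; ring
  · obtain ⟨C, hC, hb⟩ := Cl_bound B h
    refine ⟨C, hC, fun θ hθ u hu => (hb n hn θ hθ u hu).trans ?_⟩
    simp only [pow_zero, mul_one, one_mul]
    gcongr
    linarith

lemma Nice.integrable (B : Box) {F : Sy} (hF : Nice F) {n : ℕ} (hn : 3 ≤ n) {θ : Fin 3 → ℝ}
    (hθ : θ ∈ B.Om) (Y : ℝ) : IntegrableOn (fun u => Real.cos (Y * u) * F n θ u) (Ioi 0) := by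
  obtain ⟨D, hD, hb⟩ := hF.dom B hn
  refine Integrable.mono' ((exp_half_integrable 4 (by norm_num)).const_mul D)
    ((ContinuousOn.mul (by fun_prop)
      (hF.cont (by omega) (Om_pos hθ).2.1)).aestronglyMeasurable measurableSet_Ioi)
    ((ae_restrict_mem measurableSet_Ioi).mono fun u hu => ?_)
  rw [norm_mul]
  exact (mul_le_of_le_one_left (norm_nonneg _) (Real.abs_cos_le_one _)).trans (hb θ hθ u hu)

lemma Om_update (B : Box) {θ : Fin 3 → ℝ} (hθ : θ ∈ B.Om) (c : Fin 3) :
    ∀ᶠ t in 𝓝 (θ c), Function.update θ c t ∈ B.Om := by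
  have ho : IsOpen B.Om := by
    unfold Box.Om
    have h : ∀ i : Fin 3, Continuous fun θ : Fin 3 → ℝ => θ i := fun i => continuous_apply i
    refine ((isOpen_lt continuous_const (h 0)).inter (isOpen_lt (h 0) continuous_const)).inter
      (((isOpen_lt continuous_const (h 1)).inter (isOpen_lt (h 1) continuous_const)).inter
      ((isOpen_lt continuous_const (h 2)).inter (isOpen_lt (h 2) continuous_const)))
  have hc : Continuous fun t : ℝ => Function.update θ c t := continuous_const.update c continuous_id
  have := hc.tendsto (θ c)
  refine this.eventually_mem ?_
  rw [Function.update_eq_self]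
  exact ho.mem_nhds hθ

lemma Q_deriv (B : Box) {F F' : Sy} (hF : Nice F) (hF' : Nice F') {c : Fin 3}
    (hR : RelP c F F') {n : ℕ} (hn : 3 ≤ n) {θ : Fin 3 → ℝ} (hθ : θ ∈ B.Om) (Y : ℝ) :
    HasDerivAt (fun t => Q n Y F (Function.update θ c t)) (Q n Y F' θ) (θ c) := by
  obtain ⟨D, hD, hb⟩ := hF'.dom B hn
  have hn1 : 1 ≤ n := by omega
  have hs := Om_update B hθ c
  have key := hasDerivAt_integral_of_dominated_loc_of_deriv_le (μ := volume.restrict (Ioi 0))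
    (F := fun t u => Real.cos (Y * u) * F n (Function.update θ c t) u)
    (F' := fun t u => Real.cos (Y * u) * F' n (Function.update θ c t) u)
    (bound := fun u => D * Real.exp (-(u / 4))) (x₀ := θ c) hs ?_ ?_ ?_ ?_ ?_ ?_
  · have := key.2
    simp only [Function.update_eq_self] at this
    exact this
  · filter_upwards [hs] with t ht
    exact (hF.integrable B hn ht Y).aestronglyMeasurable
  · simp only [Function.update_eq_self]
    exact hF.integrable B hn hθ Y
  · simp only [Function.update_eq_self]
    exact (hF'.integrable B hn hθ Y).aestronglyMeasurable
  · refine (ae_restrict_mem measurableSet_Ioi).mono fun u hu t ht => ?_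
    rw [norm_mul]
    exact (mul_le_of_le_one_left (norm_nonneg _) (Real.abs_cos_le_one _)).trans (hb _ ht u hu)
  · exact (exp_half_integrable 4 (by norm_num)).const_mul D
  · refine (ae_restrict_mem measurableSet_Ioi).mono fun u hu t ht => ?_
    refine HasDerivAt.const_mul _ ?_
    have := hR n hn1 (Function.update θ c t) (Om_pos ht).2.1 u hu
    simpa using this


lemma gaussFT (b : ℝ) (hb : 0 < b) (Y : ℝ) :
    ∫ x : ℝ, Real.cos (Y * x) * Real.exp (-b * x ^ 2)
      = Real.sqrt (Real.pi / b) * Real.exp (-Y ^ 2 / (4 * b)) := by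
  have h := fourierIntegral_gaussian (b := (b : ℂ)) (by simpa using hb) (Y : ℂ)
  have hintg : Integrable fun x : ℝ =>
      Complex.exp (Complex.I * Y * x) * Complex.exp (-(b:ℂ) * (x:ℂ) ^ 2) := by
    have h1 := integrable_cexp_neg_mul_sq (b := (b : ℂ)) (by simpa using hb)
    refine h1.norm.mono' (by fun_prop) (Eventually.of_forall fun x => ?_)
    rw [norm_mul, Complex.norm_exp]
    simp
  have h2 := congrArg Complex.re h
  have h3 := integral_re (𝕜 := ℂ) hintg
  simp only [RCLike.re_eq_complex_re] at h3
  rw [← h3] at h2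
  have e1 : ∀ x : ℝ, (Complex.exp (Complex.I * Y * x) * Complex.exp (-(b:ℂ) * (x:ℂ) ^ 2)).re
      = Real.cos (Y * x) * Real.exp (-b * x ^ 2) := by
    intro x
    rw [show Complex.I * (Y:ℂ) * (x:ℂ) = ((Y * x : ℝ) : ℂ) * Complex.I by push_cast; ring,
      show -(b:ℂ) * (x:ℂ) ^ 2 = ((-b * x ^ 2 : ℝ) : ℂ) by push_cast; ring, ← Complex.ofReal_exp,
      Complex.re_mul_ofReal, Complex.exp_ofReal_mul_I_re]
  simp only [e1] at h2
  rw [h2, show ((Real.pi : ℂ) / (b : ℂ)) = ((Real.pi / b : ℝ) : ℂ) by push_cast; ring,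
    show ((1:ℂ) / 2) = ((1 / 2 : ℝ) : ℂ) by push_cast; ring,
    ← Complex.ofReal_cpow (by positivity),
    show (-(Y:ℂ) ^ 2 / (4 * (b:ℂ))) = ((-Y ^ 2 / (4 * b) : ℝ) : ℂ) by push_cast; ring,
    ← Complex.ofReal_exp, ← Complex.ofReal_mul, Complex.ofReal_re, Real.sqrt_eq_rpow]

lemma gaussFT_half (s : ℝ) (hs : 0 < s) (Y : ℝ) :
    ∫ x in Ioi (0:ℝ), Real.cos (Y * x) * Real.exp (-(s ^ 2 * x ^ 2 / 2))
      = Real.pi * (gauss (Y / s) / s) := by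
  have h := gaussFT (s ^ 2 / 2) (by positivity) Y
  have h2 := integral_comp_abs (f := fun x => Real.cos (Y * x) * Real.exp (-(s ^ 2 / 2) * x ^ 2))
  have e : ∀ x : ℝ, Real.cos (Y * |x|) * Real.exp (-(s ^ 2 / 2) * |x| ^ 2)
      = Real.cos (Y * x) * Real.exp (-(s ^ 2 / 2) * x ^ 2) := by
    intro x
    rw [sq_abs]
    rcases abs_choice x with h | h <;> rw [h]
    simp
  simp only [e] at h2
  rw [h] at h2
  have e3 : ∀ x : ℝ, Real.exp (-(s ^ 2 * x ^ 2 / 2)) = Real.exp (-(s ^ 2 / 2) * x ^ 2) := by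
    intro x; congr 1; ring
  simp only [e3]
  have e4 : Real.sqrt (Real.pi / (s ^ 2 / 2)) = Real.sqrt (2 * Real.pi) / s := by
    rw [show Real.pi / (s ^ 2 / 2) = (2 * Real.pi) / s ^ 2 by field_simp,
      Real.sqrt_div (by positivity), Real.sqrt_sq hs.le]
  rw [e4] at h2
  unfold gauss
  have e5 : Real.exp (-Y ^ 2 / (4 * (s ^ 2 / 2))) = Real.exp (-((Y / s) ^ 2) / 2) := by
    congr 1; field_simp; ring
  rw [e5] at h2
  have hp : 0 < Real.sqrt (2 * Real.pi) := by positivity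
  have hsq : Real.sqrt (2 * Real.pi) * Real.sqrt (2 * Real.pi) = 2 * Real.pi :=
    Real.mul_self_sqrt (by positivity)
  have e6 : ∫ x in Ioi (0:ℝ), Real.cos (Y * x) * Real.exp (-(s ^ 2 / 2) * x ^ 2)
      = (Real.sqrt (2 * Real.pi) / s * Real.exp (-((Y / s) ^ 2) / 2)) / 2 := by linarith
  rw [e6]
  field_simp
  rw [sq, hsq]

lemma gm_int (s : ℝ) (hs : 0 < s) (k : ℕ) (f : ℝ → ℝ) (hf : Continuous f) (hb : ∀ x, |f x| ≤ 1) :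
    IntegrableOn (fun u : ℝ => u ^ k * f u * Real.exp (-(s ^ 2 * u ^ 2 / 2))) (Ioi 0) := by
  have h := (integrable_rpow_mul_exp_neg_mul_sq (b := s ^ 2 / 2) (by positivity)
    (s := (k : ℝ)) (by have : (0:ℝ) ≤ k := by positivity
                       linarith)).norm.integrableOn (s := Ioi (0:ℝ))
  refine h.mono' (by fun_prop) (Eventually.of_forall fun u => ?_)
  rw [norm_mul, norm_mul, norm_mul, Real.rpow_natCast,
    show -(s ^ 2 * u ^ 2 / 2) = -(s ^ 2 / 2) * u ^ 2 by ring]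
  refine mul_le_mul_of_nonneg_right ?_ (norm_nonneg _)
  exact mul_le_of_le_one_right (norm_nonneg _) (hb u)

lemma gm_tend (s : ℝ) (hs : 0 < s) (k : ℕ) (f : ℝ → ℝ) (hb : ∀ x, |f x| ≤ 1) :
    Tendsto (fun u : ℝ => u ^ k * f u * Real.exp (-(s ^ 2 * u ^ 2 / 2))) atTop (𝓝 0) := by
  have h := rpow_mul_exp_neg_mul_sq_isLittleO_exp_neg (b := s ^ 2 / 2) (by positivity) (k : ℝ)
  have h2 : Tendsto (fun x : ℝ => Real.exp (-(1 / 2) * x)) atTop (𝓝 0) := by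
    refine Real.tendsto_exp_atBot.comp ?_
    exact tendsto_id.const_mul_atTop_of_neg (by norm_num)
  have h3 := h.trans_tendsto h2
  refine squeeze_zero_norm' ?_ h3
  filter_upwards [eventually_gt_atTop 0] with u hu
  rw [norm_mul, norm_mul, Real.rpow_natCast, Real.norm_of_nonneg (Real.exp_pos _).le,
    show -(s ^ 2 * u ^ 2 / 2) = -(s ^ 2 / 2) * u ^ 2 by ring]
  refine mul_le_mul_of_nonneg_right ?_ (Real.exp_pos _).le
  rw [norm_pow, Real.norm_of_nonneg hu.le]
  exact mul_le_of_le_one_right (by positivity) (hb u)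

def gmC (s Y : ℝ) (k : ℕ) : ℝ :=
  ∫ u in Ioi (0:ℝ), u ^ k * Real.cos (Y * u) * Real.exp (-(s ^ 2 * u ^ 2 / 2))
def gmS (s Y : ℝ) (k : ℕ) : ℝ :=
  ∫ u in Ioi (0:ℝ), u ^ k * Real.sin (Y * u) * Real.exp (-(s ^ 2 * u ^ 2 / 2))

lemma exp_der (s u : ℝ) : HasDerivAt (fun u : ℝ => Real.exp (-(s ^ 2 * u ^ 2 / 2)))
    (Real.exp (-(s ^ 2 * u ^ 2 / 2)) * (-(s ^ 2 * u))) u := by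
  have := ((((hasDerivAt_pow 2 u).const_mul (s ^ 2)).div_const 2).neg).exp
  refine this.congr_deriv ?_
  simp only [Pi.neg_apply]
  push_cast; ring

lemma gm_relC (s : ℝ) (hs : 0 < s) (Y : ℝ) (k : ℕ) :
    s ^ 2 * gmC s Y (k + 2) = (k + 1) * gmC s Y k - Y * gmS s Y (k + 1) := by
  have hc : ∀ x, |Real.cos (Y * x)| ≤ 1 := fun x => Real.abs_cos_le_one _
  have hs' : ∀ x, |Real.sin (Y * x)| ≤ 1 := fun x => Real.abs_sin_le_one _
  have i1 := gm_int s hs k (f := fun x => Real.cos (Y * x)) (by fun_prop) hc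
  have i2 := gm_int s hs (k + 2) (f := fun x => Real.cos (Y * x)) (by fun_prop) hc
  have i3 := gm_int s hs (k + 1) (f := fun x => Real.sin (Y * x)) (by fun_prop) hs'
  have key := integral_Ioi_of_hasDerivAt_of_tendsto'
    (f := fun u => u ^ (k + 1) * Real.cos (Y * u) * Real.exp (-(s ^ 2 * u ^ 2 / 2)))
    (f' := fun u => ((k + 1 : ℝ) * (u ^ k * Real.cos (Y * u) * Real.exp (-(s ^ 2 * u ^ 2 / 2)))
      - Y * (u ^ (k + 1) * Real.sin (Y * u) * Real.exp (-(s ^ 2 * u ^ 2 / 2))))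
      - s ^ 2 * (u ^ (k + 2) * Real.cos (Y * u) * Real.exp (-(s ^ 2 * u ^ 2 / 2))))
    (a := 0) (m := 0) ?_ (Integrable.sub' ((i1.const_mul (k + 1 : ℝ)).sub' (i3.const_mul Y)) (i2.const_mul (s ^ 2)))
    (gm_tend s hs (k + 1) _ hc)
  · have e1 := integral_sub ((i1.const_mul (k + 1 : ℝ)).sub (i3.const_mul Y)) (i2.const_mul (s ^ 2))
    have e2 := integral_sub (i1.const_mul (k + 1 : ℝ)) (i3.const_mul Y)
    simp only [Pi.sub_apply] at e1
    rw [e1, e2, integral_const_mul, integral_const_mul, integral_const_mul] at key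
    simp at key
    unfold gmC gmS
    linarith
  · intro u _
    have hd : HasDerivAt (fun u : ℝ => Y * u) Y u := by simpa using (hasDerivAt_id u).const_mul Y
    refine (((hasDerivAt_pow (k + 1) u).mul hd.cos).mul (exp_der s u)).congr_deriv ?_
    simp only [Nat.add_sub_cancel, Pi.mul_apply]
    push_cast; ring

lemma gm_relS (s : ℝ) (hs : 0 < s) (Y : ℝ) (k : ℕ) :
    s ^ 2 * gmS s Y (k + 2) = (k + 1) * gmS s Y k + Y * gmC s Y (k + 1) := by
  have hc : ∀ x, |Real.cos (Y * x)| ≤ 1 := fun x => Real.abs_cos_le_one _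
  have hs' : ∀ x, |Real.sin (Y * x)| ≤ 1 := fun x => Real.abs_sin_le_one _
  have i1 := gm_int s hs k (f := fun x => Real.sin (Y * x)) (by fun_prop) hs'
  have i2 := gm_int s hs (k + 2) (f := fun x => Real.sin (Y * x)) (by fun_prop) hs'
  have i3 := gm_int s hs (k + 1) (f := fun x => Real.cos (Y * x)) (by fun_prop) hc
  have key := integral_Ioi_of_hasDerivAt_of_tendsto'
    (f := fun u => u ^ (k + 1) * Real.sin (Y * u) * Real.exp (-(s ^ 2 * u ^ 2 / 2)))
    (f' := fun u => ((k + 1 : ℝ) * (u ^ k * Real.sin (Y * u) * Real.exp (-(s ^ 2 * u ^ 2 / 2)))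
      + Y * (u ^ (k + 1) * Real.cos (Y * u) * Real.exp (-(s ^ 2 * u ^ 2 / 2))))
      - s ^ 2 * (u ^ (k + 2) * Real.sin (Y * u) * Real.exp (-(s ^ 2 * u ^ 2 / 2))))
    (a := 0) (m := 0) ?_ (Integrable.sub' ((i1.const_mul (k + 1 : ℝ)).fun_add (i3.const_mul Y)) (i2.const_mul (s ^ 2)))
    (gm_tend s hs (k + 1) _ hs')
  · have e1 := integral_sub ((i1.const_mul (k + 1 : ℝ)).add (i3.const_mul Y)) (i2.const_mul (s ^ 2))
    have e2 := integral_add (i1.const_mul (k + 1 : ℝ)) (i3.const_mul Y)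
    simp only [Pi.add_apply] at e1
    rw [e1, e2, integral_const_mul, integral_const_mul, integral_const_mul] at key
    simp at key
    unfold gmC gmS
    linarith
  · intro u _
    have hd : HasDerivAt (fun u : ℝ => Y * u) Y u := by simpa using (hasDerivAt_id u).const_mul Y
    refine (((hasDerivAt_pow (k + 1) u).mul hd.sin).mul (exp_der s u)).congr_deriv ?_
    simp only [Nat.add_sub_cancel, Pi.mul_apply]
    push_cast; ring

lemma gm_relS1 (s : ℝ) (hs : 0 < s) (Y : ℝ) : s ^ 2 * gmS s Y 1 = Y * gmC s Y 0 := by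
  have hc : ∀ x, |Real.cos (Y * x)| ≤ 1 := fun x => Real.abs_cos_le_one _
  have hs' : ∀ x, |Real.sin (Y * x)| ≤ 1 := fun x => Real.abs_sin_le_one _
  have i1 := gm_int s hs 0 (f := fun x => Real.cos (Y * x)) (by fun_prop) hc
  have i2 := gm_int s hs 1 (f := fun x => Real.sin (Y * x)) (by fun_prop) hs'
  have key := integral_Ioi_of_hasDerivAt_of_tendsto'
    (f := fun u => u ^ 0 * Real.sin (Y * u) * Real.exp (-(s ^ 2 * u ^ 2 / 2)))
    (f' := fun u => (Y * (u ^ 0 * Real.cos (Y * u) * Real.exp (-(s ^ 2 * u ^ 2 / 2))))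
      - s ^ 2 * (u ^ 1 * Real.sin (Y * u) * Real.exp (-(s ^ 2 * u ^ 2 / 2))))
    (a := 0) (m := 0) ?_ ((i1.const_mul Y).sub' (i2.const_mul (s ^ 2)))
    (gm_tend s hs 0 _ hs')
  · have e1 := integral_sub (i1.const_mul Y) (i2.const_mul (s ^ 2))
    rw [e1, integral_const_mul, integral_const_mul] at key
    simp only [mul_zero, Real.sin_zero, zero_mul, sub_zero] at key
    unfold gmC gmS
    linarith
  · intro u _
    have hd : HasDerivAt (fun u : ℝ => Y * u) Y u := by simpa using (hasDerivAt_id u).const_mul Y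
    refine (((hasDerivAt_pow 0 u).mul hd.sin).mul (exp_der s u)).congr_deriv ?_
    simp only [Nat.cast_zero, zero_mul, zero_add, Pi.mul_apply]
    ring

lemma gm_bound (s0 : ℝ) (hs0 : 0 < s0) (i : ℕ) : ∃ C : ℝ, 0 < C ∧ ∀ s : ℝ, s0 < s → ∀ Y : ℝ,
    |gmC s Y (2 * i)| ≤ C * (1 + |Y|) ^ (2 * i) * gauss (Y / s) ∧
    |gmS s Y (2 * i + 1)| ≤ C * (1 + |Y|) ^ (2 * i + 1) * gauss (Y / s) := by
  have hg : ∀ y, 0 < gauss y := fun y => by unfold gauss; positivity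
  have stepS : ∀ (i : ℕ) (C : ℝ) (s : ℝ), s0 < s → ∀ x, |s ^ 2 * x| ≤ C → |x| ≤ C / s0 ^ 2 := by
    intro i C s hs x hx
    rw [abs_mul, abs_of_pos (by have := hs0.trans hs; positivity)] at hx
    rw [le_div_iff₀ (by positivity), mul_comm]
    exact le_trans (by gcongr) hx
  induction i with
  | zero =>
    have hC0 : ∀ s : ℝ, s0 < s → ∀ Y : ℝ, |gmC s Y 0| ≤ Real.pi / s0 * gauss (Y / s) := by
      intro s hs Y
      have h := gaussFT_half s (hs0.trans hs) Y
      unfold gmC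
      simp only [pow_zero, one_mul]
      rw [h]
      have h1 := hg (Y / s)
      have h2 := hs0.trans hs
      rw [abs_of_pos (by positivity)]
      rw [show Real.pi * (gauss (Y / s) / s) = Real.pi / s * gauss (Y / s) by ring]
      gcongr
    refine ⟨Real.pi / s0 + Real.pi / s0 / s0 ^ 2, by positivity, fun s hs Y => ⟨?_, ?_⟩⟩
    · have := hg (Y / s)
      simp only [mul_zero, pow_zero, mul_one]
      refine (hC0 s hs Y).trans ?_
      gcongr
      have : 0 < Real.pi / s0 / s0 ^ 2 := by positivity
      linarith
    · have h1 := hg (Y / s)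
      have h2 : |s ^ 2 * gmS s Y 1| ≤ |Y| * (Real.pi / s0 * gauss (Y / s)) := by
        rw [gm_relS1 s (hs0.trans hs), abs_mul]
        gcongr
        exact hC0 s hs Y
      have h3 := stepS 0 _ s hs _ h2
      simp only [mul_zero, zero_add, pow_one]
      refine h3.trans ?_
      have h4 : |Y| * (Real.pi / s0 * gauss (Y / s)) / s0 ^ 2
        = (Real.pi / s0 / s0 ^ 2) * |Y| * gauss (Y / s) := by ring
      rw [h4]
      have : 0 < Real.pi / s0 := by positivity
      gcongr <;> linarith
  | succ i ih =>
    obtain ⟨C, hC, h⟩ := ih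
    set A := ((2 * i + 1 : ℝ) * C + C) / s0 ^ 2 with hA
    have hA0 : 0 < A := by positivity
    set D := ((2 * i + 2 : ℝ) * C + A) / s0 ^ 2 with hD
    have hD0 : 0 < D := by positivity
    have hCb : ∀ s : ℝ, s0 < s → ∀ Y : ℝ,
        |gmC s Y (2 * (i + 1))| ≤ A * (1 + |Y|) ^ (2 * (i + 1)) * gauss (Y / s) := by
      intro s hs Y
      have g1 := hg (Y / s)
      obtain ⟨b1, b2⟩ := h s hs Y
      have r := gm_relC s (hs0.trans hs) Y (2 * i)
      have hY := abs_nonneg Y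
      have h2 : |s ^ 2 * gmC s Y (2 * i + 2)| ≤
          ((2 * i + 1 : ℝ) * C + C) * (1 + |Y|) ^ (2 * (i + 1)) * gauss (Y / s) := by
        rw [r]
        refine (abs_sub _ _).trans ?_
        rw [abs_mul, abs_mul, abs_of_pos (by positivity)]
        have e1 : (1 + |Y|) ^ (2 * i) ≤ (1 + |Y|) ^ (2 * (i + 1)) :=
          pow_le_pow_right₀ (by linarith) (by omega)
        push_cast
        calc (2 * (i:ℝ) + 1) * |gmC s Y (2 * i)| + |Y| * |gmS s Y (2 * i + 1)|
            ≤ (2 * (i:ℝ) + 1) * (C * (1 + |Y|) ^ (2 * (i + 1)) * gauss (Y / s))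
              + (1 + |Y|) * (C * (1 + |Y|) ^ (2 * i + 1) * gauss (Y / s)) := by
              gcongr
              · exact b1.trans (by gcongr)
              · linarith
          _ = _ := by ring
      have h3 := stepS 0 _ s hs _ h2
      refine h3.trans (le_of_eq ?_)
      rw [hA]; ring
    refine ⟨A + D, by positivity, fun s hs Y => ⟨?_, ?_⟩⟩
    · refine (hCb s hs Y).trans ?_
      have := hg (Y / s)
      gcongr
      linarith
    · have g1 := hg (Y / s)
      obtain ⟨b1, b2⟩ := h s hs Y
      have b3 := hCb s hs Y
      have r := gm_relS s (hs0.trans hs) Y (2 * i + 1)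
      have hY := abs_nonneg Y
      have h2 : |s ^ 2 * gmS s Y (2 * i + 1 + 2)| ≤
          ((2 * i + 2 : ℝ) * C + A) * (1 + |Y|) ^ (2 * (i + 1) + 1) * gauss (Y / s) := by
        rw [r]
        refine (abs_add_le _ _).trans ?_
        rw [abs_mul, abs_mul, abs_of_pos (by positivity)]
        have e1 : (1 + |Y|) ^ (2 * i + 1) ≤ (1 + |Y|) ^ (2 * (i + 1) + 1) :=
          pow_le_pow_right₀ (by linarith) (by omega)
        push_cast
        calc (2 * (i:ℝ) + 1 + 1) * |gmS s Y (2 * i + 1)| + |Y| * |gmC s Y (2 * i + 1 + 1)|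
            ≤ (2 * (i:ℝ) + 1 + 1) * (C * (1 + |Y|) ^ (2 * (i + 1) + 1) * gauss (Y / s))
              + (1 + |Y|) * (A * (1 + |Y|) ^ (2 * (i + 1)) * gauss (Y / s)) := by
              gcongr
              · exact b2.trans (by gcongr)
              · linarith
              · exact b3
          _ = _ := by ring
      have h3 := stepS 0 _ s hs _ h2
      refine h3.trans ?_
      have : ((2 * i + 2 : ℝ) * C + A) * (1 + |Y|) ^ (2 * (i + 1) + 1) * gauss (Y / s) / s0 ^ 2
        = D * (1 + |Y|) ^ (2 * (i + 1) + 1) * gauss (Y / s) := by rw [hD]; ring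
      rw [this]
      gcongr
      linarith


def kker (α z : ℝ) : ℝ := (1 - Real.cos z) * z ^ (-1 - α)

lemma kker_nonneg (α : ℝ) {z : ℝ} (hz : 0 < z) : 0 ≤ kker α z :=
  mul_nonneg (by linarith [Real.cos_le_one z]) (Real.rpow_nonneg hz.le _)

lemma kker_le1 (α : ℝ) {z : ℝ} (hz : 0 < z) : kker α z ≤ z ^ (1 - α) := by
  unfold kker
  have h1 := Real.one_sub_sq_div_two_le_cos (x := z)
  have h2 : z ^ (1 - α) = z ^ 2 * z ^ (-1 - α) := by
    rw [← Real.rpow_natCast, ← Real.rpow_add hz]; congr 1; push_cast; ring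
  rw [h2]
  gcongr
  nlinarith [sq_nonneg z]

lemma kker_le2 (α : ℝ) {z : ℝ} (hz : 0 < z) : kker α z ≤ 2 * z ^ (-1 - α) := by
  unfold kker
  gcongr
  linarith [Real.neg_one_le_cos z]

lemma kker_meas (α : ℝ) : Measurable (kker α) := by
  unfold kker
  fun_prop

lemma kker_int1 {α : ℝ} (hα2 : α < 2) : IntegrableOn (fun z : ℝ => z ^ (1 - α)) (Ioc 0 1) := by
  have := intervalIntegral.intervalIntegrable_rpow' (a := 0) (b := 1) (r := 1 - α) (by linarith)
  rwa [intervalIntegrable_iff_integrableOn_Ioc_of_le zero_le_one] at this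

lemma kker_int2 {α : ℝ} (hα : 0 < α) : IntegrableOn (fun z : ℝ => 2 * z ^ (-1 - α)) (Ioi 1) :=
  (integrableOn_Ioi_rpow_of_lt (by linarith) one_pos).const_mul 2

lemma kker_intA {α : ℝ} (hα2 : α < 2) : IntegrableOn (kker α) (Ioc 0 1) := by
  refine (kker_int1 hα2).mono' (kker_meas α).aestronglyMeasurable
    ((ae_restrict_mem measurableSet_Ioc).mono fun z hz => ?_)
  rw [Real.norm_of_nonneg (kker_nonneg α hz.1)]
  exact kker_le1 α hz.1

lemma kker_intB {α : ℝ} (hα : 0 < α) : IntegrableOn (kker α) (Ioi 1) := by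
  refine (kker_int2 hα).mono' (kker_meas α).aestronglyMeasurable
    ((ae_restrict_mem measurableSet_Ioi).mono fun z hz => ?_)
  have hz' : (0:ℝ) < z := lt_trans one_pos hz
  rw [Real.norm_of_nonneg (kker_nonneg α hz')]
  exact kker_le2 α hz'

lemma kker_int {α : ℝ} (hα : 0 < α) (hα2 : α < 2) : IntegrableOn (kker α) (Ioi 0) := by
  rw [← Ioc_union_Ioi_eq_Ioi (zero_le_one' ℝ)]
  exact (kker_intA hα2).union (kker_intB hα)

def kal (α : ℝ) : ℝ := ∫ z in Ioi 0, kker α z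

lemma kal_nonneg (α : ℝ) : 0 ≤ kal α :=
  setIntegral_nonneg measurableSet_Ioi fun _ hz => kker_nonneg α hz

lemma kal_le {α : ℝ} (hα : 0 < α) (hα2 : α < 2) : kal α ≤ 1 / (2 - α) + 2 / α := by
  unfold kal
  have hdisj : Disjoint (Ioc (0:ℝ) 1) (Ioi 1) :=
    Set.disjoint_left.2 fun x hx hx' => absurd hx.2 (not_le.2 hx')
  rw [← Ioc_union_Ioi_eq_Ioi (zero_le_one' ℝ), setIntegral_union hdisj measurableSet_Ioi
    (kker_intA hα2) (kker_intB hα)]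
  refine add_le_add ?_ ?_
  · have h1 : ∫ z in Ioc (0:ℝ) 1, z ^ (1 - α) = 1 / (2 - α) := by
      rw [← intervalIntegral.integral_of_le zero_le_one, integral_rpow (Or.inl (by linarith))]
      rw [Real.one_rpow, Real.zero_rpow (by linarith)]
      congr 1 <;> ring
    rw [← h1]
    exact setIntegral_mono_on (kker_intA hα2) (kker_int1 hα2) measurableSet_Ioc
      fun z hz => kker_le1 α hz.1
  · have h1 : ∫ z in Ioi (1:ℝ), 2 * z ^ (-1 - α) = 2 / α := by
      rw [integral_const_mul, integral_Ioi_rpow_of_lt (by linarith) one_pos, Real.one_rpow]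
      rw [show -1 - α + 1 = -α by ring, neg_div_neg_eq]; ring
    rw [← h1]
    exact setIntegral_mono_on (kker_intB hα) (kker_int2 hα) measurableSet_Ioi
      fun z hz => kker_le2 α (lt_trans one_pos hz)

lemma kker_scale {α u : ℝ} (hu : 0 < u) {z : ℝ} (hz : 0 < z) :
    (1 - Real.cos (u * z)) * z ^ (-1 - α) = u ^ (1 + α) * kker α (u * z) := by
  unfold kker
  rw [Real.mul_rpow hu.le hz.le]
  have : u ^ (1 + α) * u ^ (-1 - α) = 1 := by
    rw [← Real.rpow_add hu]; simp
  linear_combination (-(1 - Real.cos (u * z)) * z ^ (-1 - α)) * this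

lemma kker_scale_int {α u : ℝ} (hα : 0 < α) (hα2 : α < 2) (hu : 0 < u) :
    IntegrableOn (fun z => (1 - Real.cos (u * z)) * z ^ (-1 - α)) (Ioi 0) := by
  have h := (integrableOn_Ioi_comp_mul_left_iff (kker α) 0 hu).2 (by simpa using kker_int hα hα2)
  have h2 : IntegrableOn (fun x => u ^ (1 + α) * kker α (u * x)) (Ioi 0) := h.const_mul _
  exact h2.congr_fun (fun z hz => (kker_scale hu hz).symm) measurableSet_Ioi

lemma kker_scale_integral {α u : ℝ} (hu : 0 < u) :
    ∫ z in Ioi 0, (1 - Real.cos (u * z)) * z ^ (-1 - α) = u ^ α * kal α := by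
  rw [setIntegral_congr_fun measurableSet_Ioi (fun z hz => kker_scale hu hz), integral_const_mul,
    integral_comp_mul_left_Ioi (kker α) 0 hu, mul_zero, smul_eq_mul, ← mul_assoc]
  congr 1
  rw [Real.rpow_add hu, Real.rpow_one]
  field_simp

def G1 (α y : ℝ) : ℝ := ∫ u in Ioi 0, Real.cos (y * u) * u ^ α * Real.exp (-(u ^ 2 / 2))

def DD (y z : ℝ) : ℝ := (gauss (y - z) + gauss (y + z)) / 2 - gauss y

lemma inner_u (y z : ℝ) : ∫ u in Ioi 0, Real.cos (y * u) * Real.exp (-(u ^ 2 / 2))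
    * (1 - Real.cos (u * z)) = Real.pi * (-DD y z) := by
  have hc : ∀ Y : ℝ, ∀ x, |Real.cos (Y * x)| ≤ 1 := fun Y x => Real.abs_cos_le_one _
  have i : ∀ Y : ℝ, IntegrableOn (fun u : ℝ => Real.cos (Y * u) * Real.exp (-(u ^ 2 / 2))) (Ioi 0) := by
    intro Y
    simpa using gm_int 1 one_pos 0 (f := fun x => Real.cos (Y * x)) (by fun_prop) (hc Y)
  have v : ∀ Y : ℝ, ∫ u in Ioi 0, Real.cos (Y * u) * Real.exp (-(u ^ 2 / 2)) = Real.pi * gauss Y := by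
    intro Y
    simpa using gaussFT_half 1 one_pos Y
  have e : ∀ u : ℝ, Real.cos (y * u) * Real.exp (-(u ^ 2 / 2)) * (1 - Real.cos (u * z))
      = Real.cos (y * u) * Real.exp (-(u ^ 2 / 2))
        - (1 / 2) * (Real.cos ((y - z) * u) * Real.exp (-(u ^ 2 / 2))
          + Real.cos ((y + z) * u) * Real.exp (-(u ^ 2 / 2))) := by
    intro u
    rw [sub_mul, add_mul, Real.cos_sub, Real.cos_add, mul_comm u z]
    ring
  simp only [e]
  rw [integral_sub (i y) (((i (y - z)).fun_add (i (y + z))).const_mul _), integral_const_mul,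
    integral_add (i _) (i _), v, v, v]
  unfold DD
  ring

lemma fubini_int {α : ℝ} (hα : 0 < α) (hα2 : α < 2) (y : ℝ) :
    Integrable (Function.uncurry fun u z : ℝ => Real.cos (y * u) * Real.exp (-(u ^ 2 / 2))
      * ((1 - Real.cos (u * z)) * z ^ (-1 - α)))
      ((volume.restrict (Ioi 0)).prod (volume.restrict (Ioi 0))) := by
  have hm : AEStronglyMeasurable (Function.uncurry fun u z : ℝ =>
      Real.cos (y * u) * Real.exp (-(u ^ 2 / 2)) * ((1 - Real.cos (u * z)) * z ^ (-1 - α)))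
      ((volume.restrict (Ioi 0)).prod (volume.restrict (Ioi 0))) := by
    refine Measurable.aestronglyMeasurable ?_
    unfold Function.uncurry
    fun_prop
  rw [integrable_prod_iff hm]
  constructor
  · refine (ae_restrict_mem measurableSet_Ioi).mono fun u hu => ?_
    exact (kker_scale_int hα hα2 hu).const_mul (Real.cos (y * u) * Real.exp (-(u ^ 2 / 2)))
  · have h1 : IntegrableOn (fun u : ℝ => |Real.cos (y * u)| * (u ^ α * Real.exp (-(u ^ 2 / 2))) * kal α)
        (Ioi 0) := by
      have h2 := integrableOn_rpow_mul_exp_neg_mul_sq (b := 1 / 2) (by norm_num) (s := α) (by linarith)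
      refine Integrable.mul_const ?_ _
      refine h2.norm.mono' (by fun_prop) (Eventually.of_forall fun u => ?_)
      rw [norm_mul, norm_abs_eq_norm]
      refine (mul_le_of_le_one_left (norm_nonneg _) (Real.abs_cos_le_one _)).trans (le_of_eq ?_)
      congr 3; ring
    refine h1.congr_fun (fun u hu => ?_) measurableSet_Ioi
    have e : ∀ z ∈ Ioi (0:ℝ), ‖Function.uncurry (fun u z : ℝ => Real.cos (y * u) *
        Real.exp (-(u ^ 2 / 2)) * ((1 - Real.cos (u * z)) * z ^ (-1 - α))) (u, z)‖
        = (|Real.cos (y * u)| * Real.exp (-(u ^ 2 / 2))) * ((1 - Real.cos (u * z)) * z ^ (-1 - α)) := by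
      intro z hz
      show ‖Real.cos (y * u) * Real.exp (-(u ^ 2 / 2)) * ((1 - Real.cos (u * z)) * z ^ (-1 - α))‖ = _
      have h3 : 0 ≤ (1 - Real.cos (u * z)) * z ^ (-1 - α) :=
        mul_nonneg (by linarith [Real.cos_le_one (u * z)]) (Real.rpow_nonneg (le_of_lt hz) _)
      rw [norm_mul, norm_mul, Real.norm_of_nonneg h3, Real.norm_of_nonneg (Real.exp_nonneg _),
        Real.norm_eq_abs]
    rw [setIntegral_congr_fun measurableSet_Ioi e, integral_const_mul, kker_scale_integral hu]
    ring

lemma G1_eq {α : ℝ} (hα : 0 < α) (hα2 : α < 2) (y : ℝ) :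
    IntegrableOn (fun z => z ^ (-1 - α) * DD y z) (Ioi 0) ∧
    kal α * (-G1 α y) = Real.pi * ∫ z in Ioi 0, z ^ (-1 - α) * DD y z := by
  have hf := fubini_int hα hα2 y
  have e2 : ∀ z : ℝ, ∫ u in Ioi 0, Real.cos (y * u) * Real.exp (-(u ^ 2 / 2))
      * ((1 - Real.cos (u * z)) * z ^ (-1 - α)) = -Real.pi * (z ^ (-1 - α) * DD y z) := by
    intro z
    simp only [← mul_assoc]
    rw [integral_mul_const, inner_u]; ring
  have hi := hf.integral_prod_right
  have hs := integral_integral_swap hf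
  simp only [Function.uncurry] at hi
  simp only [e2] at hs hi
  constructor
  · have := hi.const_mul (-Real.pi)⁻¹
    refine this.congr (Eventually.of_forall fun z => ?_)
    have := Real.pi_pos
    field_simp
  · rw [integral_const_mul] at hs
    have e1 : ∫ u in Ioi 0, ∫ z in Ioi 0, Real.cos (y * u) * Real.exp (-(u ^ 2 / 2))
      * ((1 - Real.cos (u * z)) * z ^ (-1 - α)) = G1 α y * kal α := by
      unfold G1
      rw [← integral_mul_const]
      refine setIntegral_congr_fun measurableSet_Ioi fun u hu => ?_
      rw [integral_const_mul, kker_scale_integral hu]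
      ring
    rw [e1] at hs
    linarith


lemma one_add_sq_le_cosh (x : ℝ) : 1 + x ^ 2 / 2 ≤ Real.cosh x := by
  have h := Real.cosh_two_mul (x / 2)
  have h2 := Real.cosh_sq (x / 2)
  have h3 : (x / 2) ^ 2 ≤ Real.sinh (x / 2) ^ 2 := by
    rw [sq_le_sq]
    rw [Real.abs_sinh]
    exact Real.self_le_sinh_iff.2 (abs_nonneg _)
  rw [show 2 * (x / 2) = x by ring] at h
  nlinarith

lemma gauss_pos (y : ℝ) : 0 < gauss y := by
  unfold gauss; positivity

lemma gauss_anti {x y : ℝ} (h : |x| ≤ |y|) : gauss y ≤ gauss x := by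
  unfold gauss
  have := sq_le_sq.2 h
  gcongr

lemma DD_nonneg {y z : ℝ} (hy : 2 ≤ y) (hz0 : 0 < z) (hz1 : z ≤ 1) : 0 ≤ DD y z := by
  have e : DD y z = gauss y * (Real.exp (-(z ^ 2 / 2)) * Real.cosh (y * z) - 1) := by
    unfold DD gauss
    rw [Real.cosh_eq, show -((y - z) ^ 2) / 2 = -(y ^ 2) / 2 + -(z ^ 2 / 2) + y * z by ring,
      show -((y + z) ^ 2) / 2 = -(y ^ 2) / 2 + -(z ^ 2 / 2) + -(y * z) by ring]
    simp only [Real.exp_add]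
    ring
  rw [e]
  refine mul_nonneg (gauss_pos y).le ?_
  have h1 := one_add_sq_le_cosh (y * z)
  have h2 := Real.add_one_le_exp (-(z ^ 2 / 2))
  have h3 : 1 + 2 * z ^ 2 ≤ Real.cosh (y * z) := by
    have : (2 * z) ^ 2 ≤ (y * z) ^ 2 := by gcongr
    nlinarith
  have h4 : z ^ 2 ≤ 1 := by nlinarith
  have h5 : (1 - z ^ 2 / 2) * (1 + 2 * z ^ 2) ≤ Real.exp (-(z ^ 2 / 2)) * Real.cosh (y * z) := by
    apply mul_le_mul (by linarith) h3 (by positivity) (Real.exp_nonneg _)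
  nlinarith [sq_nonneg z]

lemma DD_int_lower {α y : ℝ} (hα : 0 < α) (hα2 : α < 2) (hy : 2 ≤ y) :
    gauss 1 / 2 * (y + 1) ^ (-1 - α) - gauss y / α ≤ ∫ z in Ioi 0, z ^ (-1 - α) * DD y z := by
  have hI := (G1_eq hα hα2 y).1
  have hdisj : Disjoint (Ioc (0:ℝ) 1) (Ioi 1) :=
    Set.disjoint_left.2 fun x hx hx' => absurd hx.2 (not_le.2 hx')
  have hs1 : Ioc (0:ℝ) 1 ⊆ Ioi 0 := fun x hx => hx.1
  have hs2 : Ioi (1:ℝ) ⊆ Ioi 0 := Ioi_subset_Ioi zero_le_one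
  rw [← Ioc_union_Ioi_eq_Ioi (zero_le_one' ℝ), setIntegral_union hdisj measurableSet_Ioi
    (hI.mono_set hs1) (hI.mono_set hs2)]
  have h1 : 0 ≤ ∫ z in Ioc (0:ℝ) 1, z ^ (-1 - α) * DD y z :=
    setIntegral_nonneg measurableSet_Ioc fun z hz =>
      mul_nonneg (Real.rpow_nonneg hz.1.le _) (DD_nonneg hy hz.1 hz.2)
  have hJ : IntegrableOn (fun z : ℝ => gauss y * z ^ (-1 - α)) (Ioi 1) :=
    (integrableOn_Ioi_rpow_of_lt (by linarith) one_pos).const_mul _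
  have h2 : ∫ z in Ioi (1:ℝ), gauss y * z ^ (-1 - α) = gauss y / α := by
    rw [integral_const_mul, integral_Ioi_rpow_of_lt (by linarith) one_pos, Real.one_rpow]
    rw [show -1 - α + 1 = -α by ring, neg_div_neg_eq]; ring
  have hS : IntegrableOn (fun z : ℝ => z ^ (-1 - α) * DD y z + gauss y * z ^ (-1 - α)) (Ioi 1) :=
    (hI.mono_set hs2).fun_add hJ
  have h3 : ∫ z in Ioi (1:ℝ), (z ^ (-1 - α) * DD y z + gauss y * z ^ (-1 - α))
      = (∫ z in Ioi (1:ℝ), z ^ (-1 - α) * DD y z) + gauss y / α := by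
    rw [integral_add (hI.mono_set hs2) hJ, h2]
  have e : ∀ z : ℝ, z ^ (-1 - α) * DD y z + gauss y * z ^ (-1 - α)
      = z ^ (-1 - α) * ((gauss (y - z) + gauss (y + z)) / 2) := by
    intro z; unfold DD; ring
  have hsub : Icc y (y + 1) ⊆ Ioi 1 := fun x hx => lt_of_lt_of_le (by linarith) hx.1
  have h4 : ∫ z in Icc y (y + 1), (z ^ (-1 - α) * DD y z + gauss y * z ^ (-1 - α)) ≤
      ∫ z in Ioi (1:ℝ), (z ^ (-1 - α) * DD y z + gauss y * z ^ (-1 - α)) := by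
    refine setIntegral_mono_set hS ?_ (Eventually.of_forall fun x hx => hsub hx)
    refine (ae_restrict_mem measurableSet_Ioi).mono fun z hz => ?_
    show 0 ≤ z ^ (-1 - α) * DD y z + gauss y * z ^ (-1 - α)
    rw [e]
    have := gauss_pos (y - z)
    have := gauss_pos (y + z)
    exact mul_nonneg (Real.rpow_nonneg (le_of_lt (lt_trans one_pos hz)) _) (by linarith)
  have h5 : ∫ z in Icc y (y + 1), gauss 1 / 2 * (y + 1) ^ (-1 - α) ≤
      ∫ z in Icc y (y + 1), (z ^ (-1 - α) * DD y z + gauss y * z ^ (-1 - α)) := by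
    refine setIntegral_mono_on (integrableOn_const measure_Icc_lt_top.ne) (hS.mono_set hsub) measurableSet_Icc fun z hz => ?_
    rw [e]
    have h6 : gauss 1 ≤ gauss (y - z) := gauss_anti (by
      rw [abs_one, abs_le]; constructor <;> linarith [hz.1, hz.2])
    have h7 := gauss_pos (y + z)
    have hz0 : 0 < z := by linarith [hz.1]
    have h8 : (y + 1) ^ (-1 - α) ≤ z ^ (-1 - α) :=
      Real.rpow_le_rpow_of_nonpos hz0 hz.2 (by linarith)
    have h9 := gauss_pos 1
    rw [mul_comm]
    exact mul_le_mul h8 (by linarith) (by linarith) (Real.rpow_nonneg hz0.le _)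
  have h6 : ∫ z in Icc y (y + 1), gauss 1 / 2 * (y + 1) ^ (-1 - α) =
      gauss 1 / 2 * (y + 1) ^ (-1 - α) := by
    simp
  linarith

lemma gauss_small (a ε : ℝ) (hε : 0 < ε) (ha : 0 < a) :
    ∃ R ≥ (2:ℝ), ∀ y ≥ R, gauss y / a ≤ ε * ((y + 1) ^ 3)⁻¹ := by
  have h := (Real.tendsto_pow_mul_exp_neg_atTop_nhds_zero 3).comp (tendsto_atTop_add_const_right atTop (1:ℝ) tendsto_id)
  have hp : 0 < ε * a * Real.exp (-1) := by positivity
  obtain ⟨R, hR⟩ := eventually_atTop.1 (h.eventually (gt_mem_nhds hp))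
  refine ⟨max R 2, le_max_right _ _, fun y hy => ?_⟩
  have h1 := hR y (le_trans (le_max_left _ _) hy)
  have h2 : 2 ≤ y := le_trans (le_max_right _ _) hy
  simp only [Function.comp, id] at h1
  have h3 : gauss y ≤ Real.exp (-y) := by
    unfold gauss
    have : (Real.sqrt (2 * Real.pi))⁻¹ ≤ 1 := by
      apply inv_le_one_of_one_le₀
      rw [Real.one_le_sqrt]; nlinarith [Real.pi_gt_three]
    calc _ ≤ 1 * Real.exp (-(y ^ 2) / 2) := by gcongr
      _ = Real.exp (-(y ^ 2) / 2) := one_mul _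
      _ ≤ _ := by gcongr; nlinarith
  rw [show -(y + 1) = -y + -1 by ring, Real.exp_add, ← mul_assoc] at h1
  have h4 := lt_of_mul_lt_mul_right h1 (Real.exp_nonneg _)
  rw [← div_eq_mul_inv, div_le_div_iff₀ ha (by positivity)]
  calc gauss y * (y + 1) ^ 3 ≤ Real.exp (-y) * (y + 1) ^ 3 := by gcongr
    _ ≤ ε * a := by linarith

lemma G1_lower {a0 a1 : ℝ} (ha0 : 0 < a0) (ha1 : a1 < 2) :
    ∃ c > (0:ℝ), ∃ R ≥ (2:ℝ), ∀ α, a0 < α → α < a1 → ∀ y ≥ R,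
      c * (y + 1) ^ (-1 - α) ≤ -G1 α y := by
  have hg := gauss_pos 1
  obtain ⟨R, hR2, hR⟩ := gauss_small a0 (gauss 1 / 4) (by positivity) ha0
  have hK : 0 < 1 / (2 - a1) + 2 / a0 := by
    have : 0 < 2 - a1 := by linarith
    positivity
  refine ⟨Real.pi * (gauss 1 / 4) / (1 / (2 - a1) + 2 / a0), by positivity, R, hR2, ?_⟩
  intro α h0 h1 y hy
  have hα : 0 < α := by linarith
  have hα2 : α < 2 := by linarith
  have e := (G1_eq hα hα2 y).2
  have l := DD_int_lower hα hα2 (hR2.trans hy)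
  have hy1 : 0 < y + 1 := by linarith
  have g1 : gauss y / α ≤ gauss 1 / 4 * (y + 1) ^ (-1 - α) := by
    calc gauss y / α ≤ gauss y / a0 := by
          have := gauss_pos y
          gcongr
      _ ≤ _ := hR y hy
      _ ≤ _ := by
        gcongr
        rw [← Real.rpow_natCast, ← Real.rpow_neg hy1.le]
        apply Real.rpow_le_rpow_of_exponent_le (by linarith)
        push_cast; linarith
  have k : kal α ≤ 1 / (2 - a1) + 2 / a0 := by
    refine (kal_le hα hα2).trans ?_
    have : 0 < 2 - a1 := by linarith
    gcongr
  set K := 1 / (2 - a1) + 2 / a0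
  have hpi := Real.pi_pos
  have hX : Real.pi * (gauss 1 / 4 * (y + 1) ^ (-1 - α)) ≤ kal α * (-G1 α y) := by
    rw [e]; gcongr; linarith
  have hX0 : 0 < Real.pi * (gauss 1 / 4 * (y + 1) ^ (-1 - α)) := by positivity
  have hG : 0 < -G1 α y := by
    by_contra hcon
    have := mul_nonpos_of_nonneg_of_nonpos (kal_nonneg α) (not_lt.1 hcon)
    linarith
  have : Real.pi * (gauss 1 / 4 * (y + 1) ^ (-1 - α)) ≤ K * (-G1 α y) :=
    hX.trans (by gcongr)
  rw [div_mul_eq_mul_div, div_le_iff₀ hK]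
  linarith

def Gs (s α Y : ℝ) : ℝ := ∫ u in Ioi 0, Real.cos (Y * u) * u ^ α * Real.exp (-(s ^ 2 * u ^ 2 / 2))

lemma Gs_eq {s α Y : ℝ} (hs : 0 < s) : Gs s α Y = s ^ (-1 - α) * G1 α (|Y| / s) := by
  have h := integral_comp_mul_left_Ioi (fun u : ℝ => Real.cos ((|Y| / s) * u) * u ^ α * Real.exp (-(u ^ 2 / 2))) 0 hs
  rw [mul_zero, smul_eq_mul] at h
  have h2 : Gs s α Y = s ^ (-α) * ∫ u in Ioi 0, Real.cos ((|Y| / s) * (s * u)) * (s * u) ^ α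
      * Real.exp (-((s * u) ^ 2 / 2)) := by
    unfold Gs
    rw [← integral_const_mul]
    refine setIntegral_congr_fun measurableSet_Ioi fun u hu => ?_
    have hu' : (0:ℝ) < u := hu
    have e1 : Real.cos ((|Y| / s) * (s * u)) = Real.cos (Y * u) := by
      rw [← Real.cos_abs (Y * u), abs_mul, abs_of_pos hu']
      congr 1; field_simp
    have e2 : s ^ (-α) * s ^ α = 1 := by rw [← Real.rpow_add hs]; simp
    rw [e1, Real.mul_rpow hs.le hu'.le, mul_pow]
    linear_combination (-Real.cos (Y * u) * u ^ α * Real.exp (-(s ^ 2 * u ^ 2 / 2))) * e2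
  rw [h2, h, ← mul_assoc]
  congr 1
  rw [Real.rpow_sub hs, Real.rpow_neg hs.le, Real.rpow_neg hs.le, Real.rpow_one]
  field_simp

lemma Gs_lower (B : Box) : ∃ c > (0:ℝ), ∃ R ≥ (1:ℝ), ∀ s α, B.s0 < s → s < B.s1 → B.a0 < α → α < B.a1 →
    ∀ Y, R ≤ |Y| → c * Tt 0 α Y ≤ -Gs s α Y := by
  obtain ⟨c, hc, R, hR, h⟩ := G1_lower B.ha0 B.ha1
  have hs0 := B.hs0
  refine ⟨c * (max 1 (B.s1 + 1)) ^ (-3 : ℝ), by positivity, max 1 (R * B.s1), le_max_left _ _, ?_⟩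
  intro s α h0 h1 h2 h3 Y hY
  have hs : 0 < s := by linarith
  have hYR : R ≤ |Y| / s := by
    rw [le_div_iff₀ hs]
    refine le_trans ?_ ((le_max_right _ _).trans hY)
    gcongr
  have := h α h2 h3 (|Y| / s) hYR
  rw [Gs_eq hs]
  have hY1 : 1 ≤ |Y| := (le_max_left _ _).trans hY
  have ha : -1 - α ≤ 0 := by linarith [B.ha0]
  have hm1 : 1 ≤ max 1 (B.s1 + 1) := le_max_left _ _
  have e : s ^ (-1 - α) * (|Y| / s + 1) ^ (-1 - α) = (|Y| + s) ^ (-1 - α) := by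
    rw [← Real.mul_rpow hs.le (by positivity)]; congr 1; field_simp
  calc c * (max 1 (B.s1 + 1)) ^ (-3 : ℝ) * Tt 0 α Y
      ≤ c * (max 1 (B.s1 + 1)) ^ (-1 - α) * Tt 0 α Y := by
        have := (Tt_pos 0 α Y).le
        gcongr
        linarith [B.ha1]
    _ = c * ((max 1 (B.s1 + 1)) * (1 + |Y|)) ^ (-1 - α) := by
        rw [Real.mul_rpow (by positivity) (by positivity)]
        unfold Tt
        rw [show -1 - α = -(1 + α) by ring]; ring
    _ ≤ c * (|Y| + s) ^ (-1 - α) := by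
        refine mul_le_mul_of_nonneg_left ?_ hc.le
        apply Real.rpow_le_rpow_of_nonpos (by positivity) ?_ ha
        nlinarith [le_max_right 1 (B.s1 + 1)]
    _ = s ^ (-1 - α) * (c * (|Y| / s + 1) ^ (-1 - α)) := by rw [← e]; ring
    _ ≤ s ^ (-1 - α) * -G1 α (|Y| / s) := by gcongr
    _ = _ := by ring


def E0 : Sy := T 0 0 0 0 0 (fun x => Real.exp (-x))
def g1 : ℝ → ℝ := fun x => Real.exp (-x) - 1
def g2 : ℝ → ℝ := fun x => Real.exp (-x) - 1 + x

lemma g1_good : g1 ∈ Good 1 := by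
  have := good1_mem 1 0
  unfold g1
  simpa using this

lemma g1_cl (a i : ℕ) : T a 0 0 i 0 g1 ∈ Cl 1 0 := T_mem_Cl a 0 0 i le_rfl g1_good
lemma g2_cl : T 0 0 0 0 0 g2 ∈ Cl 2 0 := T_mem_Cl 0 0 0 0 le_rfl good2_mem

lemma Q_decomp1 (B : Box) {n : ℕ} (hn : 3 ≤ n) {θ : Fin 3 → ℝ} (hθ : θ ∈ B.Om) (Y : ℝ) (a i : ℕ) :
    Q n Y (T a 0 0 i 0 (fun x => Real.exp (-x))) θ =
      θ 0 ^ a * gmC (θ 0) Y (2 * i) + Q n Y (T a 0 0 i 0 g1) θ := by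
  have h2 := Nice.integrable B (F := T a 0 0 i 0 g1) (Or.inl ⟨0, g1_cl a i⟩) hn hθ Y
  have h1 := (gm_int (θ 0) (Om_pos hθ).1 (2 * i) (fun u => Real.cos (Y * u)) (by fun_prop)
    (fun x => Real.abs_cos_le_one _)).const_mul (θ 0 ^ a)
  unfold Q gmC
  rw [← integral_const_mul, ← integral_add h1 h2]
  congr 1
  funext u
  unfold T g1
  simp only [pow_zero]
  ring

lemma Q_decomp2 (B : Box) {n : ℕ} (hn : 3 ≤ n) {θ : Fin 3 → ℝ} (hθ : θ ∈ B.Om) (Y : ℝ) :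
    Q n Y E0 θ = gmC (θ 0) Y 0 - Wp n θ * Gs (θ 0) (θ 2) Y + Q n Y (T 0 0 0 0 0 g2) θ := by
  have hp := Om_pos hθ
  have hn1 : 1 ≤ n := by omega
  have hW : Wp n θ ≠ 0 := (Wp_pos hn1 hp.2.1).ne'
  have hE : IntegrableOn (fun u => Real.cos (Y * u) * E0 n θ u) (Ioi 0) :=
    Nice.integrable B (Or.inr (T_mem_Cl 0 0 0 0 le_rfl exp_good0)) hn hθ Y
  have h1 := gm_int (θ 0) (Om_pos hθ).1 0 (fun u => Real.cos (Y * u)) (by fun_prop)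
    (fun x => Real.abs_cos_le_one _)
  have hG : IntegrableOn (fun u : ℝ => Real.cos (Y * u) * u ^ θ 2 *
      Real.exp (-(θ 0 ^ 2 * u ^ 2 / 2))) (Ioi 0) := by
    have h2 := integrableOn_rpow_mul_exp_neg_mul_sq (b := θ 0 ^ 2 / 2)
      (by have := hp.1; positivity) (s := θ 2) (by linarith [hp.2.2.1])
    refine h2.norm.mono' (by fun_prop) (Eventually.of_forall fun u => ?_)
    rw [mul_assoc, norm_mul]
    refine (mul_le_of_le_one_left (norm_nonneg _) (Real.abs_cos_le_one _)).trans (le_of_eq ?_)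
    congr 3; ring
  have e : ∀ u ∈ Ioi (0:ℝ), Real.cos (Y * u) * E0 n θ u
      = u ^ 0 * Real.cos (Y * u) * Real.exp (-(θ 0 ^ 2 * u ^ 2 / 2))
        - Wp n θ * (Real.cos (Y * u) * u ^ θ 2 * Real.exp (-(θ 0 ^ 2 * u ^ 2 / 2)))
        + Real.cos (Y * u) * T 0 0 0 0 0 g2 n θ u := by
    intro u hu
    have hu' : 0 < u := hu
    unfold E0 T g2
    have := xx_eq (n := n) (θ := θ) (u := u) hn1 hp.2.1 hu'
    simp only [pow_zero, mul_zero]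
    rw [this]
    ring
  have h2 : IntegrableOn (fun u => Real.cos (Y * u) * T 0 0 0 0 0 g2 n θ u) (Ioi 0) := by
    have h3 : IntegrableOn (fun u => Real.cos (Y * u) * E0 n θ u -
        (u ^ 0 * Real.cos (Y * u) * Real.exp (-(θ 0 ^ 2 * u ^ 2 / 2))
        - Wp n θ * (Real.cos (Y * u) * u ^ θ 2 * Real.exp (-(θ 0 ^ 2 * u ^ 2 / 2))))) (Ioi 0) :=
      Integrable.sub' hE (Integrable.sub' h1 (hG.const_mul _))
    refine h3.congr_fun (fun u hu => ?_) measurableSet_Ioi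
    have := e u hu
    linarith
  have h4 : IntegrableOn (fun u : ℝ => u ^ 0 * Real.cos (Y * u) * Real.exp (-(θ 0 ^ 2 * u ^ 2 / 2))
        - Wp n θ * (Real.cos (Y * u) * u ^ θ 2 * Real.exp (-(θ 0 ^ 2 * u ^ 2 / 2)))) (Ioi 0) :=
      Integrable.sub' h1 (hG.const_mul _)
  unfold Gs gmC Q
  rw [← integral_const_mul, setIntegral_congr_fun measurableSet_Ioi e,
    integral_add h4 h2, integral_sub h1 (hG.const_mul _)]

lemma gmC_zero {s : ℝ} (hs : 0 < s) (Y : ℝ) : gmC s Y 0 = Real.pi * (gauss (Y / s) / s) := by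
  rw [← gaussFT_half s hs Y]
  simp [gmC]

lemma Wp_small (B : Box) (ε : ℝ) (hε : 0 < ε) : ∃ N ≥ 3, ∀ n ≥ N, ∀ θ ∈ B.Om, Wp n θ ≤ ε := by
  obtain ⟨C, hC, h⟩ := Wp_upper B
  have ht := (tendsto_rpow_neg_atTop (y := 1 - B.a1 / 2) (by linarith [B.ha1])).comp
    (tendsto_natCast_atTop_atTop (R := ℝ))
  have ht2 := ht.const_mul C
  rw [mul_zero] at ht2
  obtain ⟨N, hN⟩ := eventually_atTop.1 (ht2.eventually (gt_mem_nhds hε))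
  refine ⟨max N 3, le_max_right _ _, fun n hn θ hθ => ?_⟩
  have h1 := hN n ((le_max_left _ _).trans hn)
  have h3 : 3 ≤ n := (le_max_right _ _).trans hn
  refine (h n (by omega) θ hθ).trans ?_
  simp only [Function.comp] at h1
  rw [show B.a1 / 2 - 1 = -(1 - B.a1 / 2) by ring]
  exact h1.le

lemma Tt0_le_one {α Y : ℝ} (hα : 0 < α) : Tt 0 α Y ≤ 1 := by
  unfold Tt
  rw [pow_zero, mul_one]
  exact Real.rpow_le_one_of_one_le_of_nonpos (by linarith [abs_nonneg Y]) (by linarith)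

/-- the comparison function -/
def Den (n : ℕ) (Y : ℝ) (θ : Fin 3 → ℝ) : ℝ := gauss (Y / θ 0) + Wp n θ * Tt 0 (θ 2) Y

lemma Q_lower (B : Box) : ∃ c > (0:ℝ), ∃ N ≥ 3, ∀ n ≥ N, ∀ θ ∈ B.Om, ∀ Y,
    c * Den n Y θ ≤ Q n Y E0 θ := by
  obtain ⟨c1, hc1, R, hR, hG⟩ := Gs_lower B
  obtain ⟨C1, hC1, b1⟩ := Q_bound (o := 0) B (g1_cl 0 0)
  obtain ⟨C2, hC2, b2⟩ := Q_bound (o := 1) B g2_cl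
  set S := |B.s1| + 1 with hS
  have hS0 : 0 < S := by positivity
  set g0 := gauss (R / B.s0) with hg0
  have hg0p : 0 < g0 := gauss_pos _
  have hpi := Real.pi_pos
  obtain ⟨N, hN3, hN⟩ := Wp_small B (min (c1 / (2 * C2)) (min (Real.pi * g0 / (2 * S * C1)) g0))
    (by positivity)
  refine ⟨min (Real.pi / (4 * S)) (c1 / 2), by positivity, N, hN3, ?_⟩
  intro n hn θ hθ Y
  have hn3 : 3 ≤ n := hN3.trans hn
  have hp := Om_pos hθ
  have hWp := Wp_pos (n := n) (θ := θ) (by omega) hp.2.1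
  have hW := hN n hn θ hθ
  have hW1 : Wp n θ ≤ c1 / (2 * C2) := hW.trans (min_le_left _ _)
  have hW2 : Wp n θ ≤ Real.pi * g0 / (2 * S * C1) := hW.trans ((min_le_right _ _).trans (min_le_left _ _))
  have hW3 : Wp n θ ≤ g0 := hW.trans ((min_le_right _ _).trans (min_le_right _ _))
  have hT := Tt_pos 0 (θ 2) Y
  have hg := gauss_pos (Y / θ 0)
  have hsS : θ 0 ≤ S := by
    have := hθ.1.2
    have := le_abs_self B.s1
    linarith
  have hgm : Real.pi / S * gauss (Y / θ 0) ≤ gmC (θ 0) Y 0 := by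
    rw [gmC_zero hp.1, div_mul_eq_mul_div, mul_div_assoc]
    have := hp.1
    gcongr
  have hpS : 0 < Real.pi / S := by positivity
  have hm1 : min (Real.pi / (4 * S)) (c1 / 2) ≤ Real.pi / S / 4 := (min_le_left _ _).trans (le_of_eq (by
    field_simp))
  have hm2 := min_le_right (Real.pi / (4 * S)) (c1 / 2)
  set m := min (Real.pi / (4 * S)) (c1 / 2) with hm
  unfold Den
  rcases le_total R |Y| with hY | hY
  · have h1 := hG (θ 0) (θ 2) hθ.1.1 hθ.1.2 hθ.2.2.1 hθ.2.2.2 Y hY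
    have h2 := b2 n hn3 θ hθ Y
    rw [Q_decomp2 B hn3 hθ]
    rw [pow_zero, mul_one, abs_le] at h2
    have h3 : C2 * Wp n θ ≤ c1 / 2 := by
      rw [le_div_iff₀ (by positivity)] at hW1; linarith
    have h4 : C2 * Wp n θ ^ (1 + 1) * Tt 0 (θ 2) Y ≤ c1 / 2 * (Wp n θ * Tt 0 (θ 2) Y) := by
      calc _ = (C2 * Wp n θ) * (Wp n θ * Tt 0 (θ 2) Y) := by ring
        _ ≤ _ := by gcongr
    have h5 : Wp n θ * (c1 * Tt 0 (θ 2) Y) ≤ Wp n θ * -Gs (θ 0) (θ 2) Y := by gcongr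
    have h6 : m * gauss (Y / θ 0) ≤ Real.pi / S * gauss (Y / θ 0) := by gcongr; linarith
    have h7 : m * (Wp n θ * Tt 0 (θ 2) Y) ≤ c1 / 2 * (Wp n θ * Tt 0 (θ 2) Y) := by gcongr
    have h8 := (neg_le_neg h4).trans h2.1
    clear h2 h4
    linarith
  · have h2 := b1 n hn3 θ hθ Y
    have hE := Q_decomp1 B hn3 hθ Y 0 0
    rw [pow_zero, one_mul, mul_zero] at hE
    have hE' : Q n Y E0 θ = gmC (θ 0) Y 0 + Q n Y (T 0 0 0 0 0 g1) θ := hE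
    rw [hE']
    rw [pow_zero, mul_one, abs_le] at h2
    have hgg : g0 ≤ gauss (Y / θ 0) := by
      apply gauss_anti
      rw [abs_div, abs_of_pos hp.1, abs_of_nonneg (div_nonneg (by linarith) B.hs0.le)]
      have := B.hs0
      have := hθ.1.1
      gcongr
    have hT1 := Tt0_le_one (Y := Y) hp.2.2.1
    have hWT : Wp n θ * Tt 0 (θ 2) Y ≤ Wp n θ := mul_le_of_le_one_right hWp.le hT1
    have h3 : C1 * Wp n θ ≤ Real.pi / S * g0 / 2 := by
      rw [le_div_iff₀ (by positivity)] at hW2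
      rw [div_mul_eq_mul_div, div_div, le_div_iff₀ (by positivity)]
      linarith
    have h4 : C1 * Wp n θ ^ (0 + 1) * Tt 0 (θ 2) Y ≤ Real.pi / S * g0 / 2 := by
      calc _ = C1 * (Wp n θ * Tt 0 (θ 2) Y) := by ring
        _ ≤ C1 * Wp n θ := by gcongr
        _ ≤ _ := h3
    have h5 : Real.pi / S * g0 / 2 ≤ Real.pi / S * gauss (Y / θ 0) / 2 := by gcongr
    have h6 : m * (gauss (Y / θ 0) + Wp n θ * Tt 0 (θ 2) Y) ≤ Real.pi / S / 4 * (2 * gauss (Y / θ 0)) := by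
      gcongr
      linarith
    have h8 := (neg_le_neg h4).trans h2.1
    clear h2 h4
    linarith

lemma poly_gauss (b : ℝ) (hb : 0 < b) (k : ℕ) : ∃ C > (0:ℝ), ∀ t ≥ (0:ℝ),
    (1 + t) ^ k * Real.exp (-(b * t ^ 2)) ≤ C := by
  refine ⟨k.factorial * Real.exp (1 + 1 / (4 * b)), by positivity, fun t ht => ?_⟩
  have h := Real.pow_div_factorial_le_exp (1 + t) (by linarith) k
  rw [div_le_iff₀ (by positivity)] at h
  have h2 : Real.exp (-(b * t ^ 2)) ≤ Real.exp (-(1 + t)) * Real.exp (1 + 1 / (4 * b)) := by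
    rw [← Real.exp_add]
    apply Real.exp_le_exp.2
    have : b * t ^ 2 - t + 1 / (4 * b) = b * (t - 1 / (2 * b)) ^ 2 := by field_simp; ring
    have h3 : 0 ≤ b * (t - 1 / (2 * b)) ^ 2 := by positivity
    linarith
  calc _ ≤ (Real.exp (1 + t) * k.factorial) * (Real.exp (-(1 + t)) * Real.exp (1 + 1 / (4 * b))) := by
        gcongr
    _ = (Real.exp (1 + t) * Real.exp (-(1 + t))) * (k.factorial * Real.exp (1 + 1 / (4 * b))) := by ring
    _ = _ := by rw [← Real.exp_add]; simp

lemma gauss_le (y : ℝ) : gauss y ≤ Real.exp (-(y ^ 2) / 2) := by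
  unfold gauss
  apply mul_le_of_le_one_left (Real.exp_nonneg _)
  apply inv_le_one_of_one_le₀
  rw [Real.one_le_sqrt]; nlinarith [Real.pi_gt_three]

lemma gm_Den (B : Box) (i : ℕ) : ∃ C > (0:ℝ), ∀ n : ℕ, n ≥ 3 → ∀ θ ∈ B.Om, ∀ Y : ℝ,
    (1 + |Y|) ^ (2 * i) * gauss (Y / θ 0) ≤ C * Real.log n ^ i * Den n Y θ := by
  set S := |B.s1| + 1 with hS
  have hS0 : 0 < S := by positivity
  obtain ⟨c, hc, hW⟩ := Wp_lower B
  obtain ⟨D, hD, hpg⟩ := poly_gauss (1 / (4 * S ^ 2)) (by positivity) (2 * i + 3)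
  refine ⟨(2 * (1 + 4 * S ^ 2)) ^ i + D / c, by positivity, fun n hn θ hθ Y => ?_⟩
  have hp := Om_pos hθ
  have hl := one_le_log hn
  have hn1 : 1 ≤ n := by omega
  have hn0 : (0:ℝ) < n := by exact_mod_cast hn1
  have hWp := Wp_pos (n := n) (θ := θ) hn1 hp.2.1
  have hT := Tt_pos 0 (θ 2) Y
  have hg := gauss_pos (Y / θ 0)
  have hY := abs_nonneg Y
  have hsS : θ 0 ≤ S := by
    have := hθ.1.2
    have := le_abs_self B.s1
    linarith
  unfold Den
  rcases le_total (Y ^ 2) (4 * S ^ 2 * Real.log n) with h | h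
  · have h1 : (1 + |Y|) ^ 2 ≤ 2 * (1 + 4 * S ^ 2) * Real.log n := by
      have : |Y| ^ 2 = Y ^ 2 := sq_abs Y
      nlinarith [sq_nonneg (1 - |Y|)]
    calc (1 + |Y|) ^ (2 * i) * gauss (Y / θ 0)
        = ((1 + |Y|) ^ 2) ^ i * gauss (Y / θ 0) := by rw [pow_mul]
      _ ≤ (2 * (1 + 4 * S ^ 2) * Real.log n) ^ i * gauss (Y / θ 0) := by gcongr
      _ = ((2 * (1 + 4 * S ^ 2)) ^ i + 0) * Real.log n ^ i * (gauss (Y / θ 0) + 0) := by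
        rw [mul_pow]; ring
      _ ≤ _ := by
        gcongr <;> positivity
  · have h1 : gauss (Y / θ 0) ≤ Real.exp (-(1 / (4 * S ^ 2) * |Y| ^ 2)) * (n:ℝ)⁻¹ := by
      refine (gauss_le _).trans ?_
      rw [← Real.exp_log hn0, ← Real.exp_neg, ← Real.exp_add, sq_abs]
      apply Real.exp_le_exp.2
      have e1 : Real.log n ≤ 1 / (4 * S ^ 2) * Y ^ 2 := by
        rw [one_div_mul_eq_div, le_div_iff₀ (by positivity)]; linarith
      have e2 : Y ^ 2 / S ^ 2 ≤ (Y / θ 0) ^ 2 := by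
        rw [div_pow]
        have := hp.1
        gcongr
      have e3 : Y ^ 2 / S ^ 2 = 4 * (1 / (4 * S ^ 2) * Y ^ 2) := by field_simp
      linarith
    have h2 := hpg |Y| hY
    have h3 := hW n hn1 θ hθ
    have h4 : ((1 + |Y|) ^ 3)⁻¹ ≤ Tt 0 (θ 2) Y := by
      unfold Tt
      rw [pow_zero, mul_one, ← Real.rpow_natCast, ← Real.rpow_neg (by positivity)]
      apply Real.rpow_le_rpow_of_exponent_le (by linarith)
      push_cast; linarith
    have h5 : (n:ℝ)⁻¹ ≤ Wp n θ / c := by rw [le_div_iff₀ hc]; linarith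
    calc (1 + |Y|) ^ (2 * i) * gauss (Y / θ 0)
        ≤ (1 + |Y|) ^ (2 * i) * (Real.exp (-(1 / (4 * S ^ 2) * |Y| ^ 2)) * (n:ℝ)⁻¹) := by gcongr
      _ = ((1 + |Y|) ^ (2 * i + 3) * Real.exp (-(1 / (4 * S ^ 2) * |Y| ^ 2))) *
          (((1 + |Y|) ^ 3)⁻¹ * (n:ℝ)⁻¹) := by
          rw [pow_add]; field_simp
      _ ≤ D * (Tt 0 (θ 2) Y * (Wp n θ / c)) := by gcongr
      _ = (0 + D / c) * 1 * (0 + Wp n θ * Tt 0 (θ 2) Y) := by ring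
      _ ≤ _ := by
        gcongr
        · positivity
        · exact one_le_pow₀ hl

lemma Den_pos {B : Box} {n : ℕ} (hn : 1 ≤ n) {θ : Fin 3 → ℝ} (hθ : θ ∈ B.Om) (Y : ℝ) : 0 < Den n Y θ := by
  have := Wp_pos (n := n) (θ := θ) hn (Om_pos hθ).2.1
  have := gauss_pos (Y / θ 0)
  have := Tt_pos 0 (θ 2) Y
  unfold Den
  positivity

lemma Pu_bound (B : Box) {F : Sy} (hF : F ∈ Pu) : ∃ C > (0:ℝ), ∃ p : ℕ, ∀ n : ℕ, n ≥ 3 → ∀ θ ∈ B.Om, ∀ Y : ℝ,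
    |Q n Y F θ| ≤ C * Real.log n ^ p * Den n Y θ := by
  unfold Pu at hF
  induction hF using Submodule.span_induction with
  | mem F hF =>
    obtain ⟨a, i, rfl⟩ := hF
    obtain ⟨C, hC, h⟩ := gm_Den B i
    obtain ⟨C', hC', h'⟩ := gm_bound B.s0 B.hs0 i
    obtain ⟨C1, hC1, b1⟩ := Q_bound (o := 0) B (g1_cl a i)
    refine ⟨(|B.s1| + 1) ^ a * (C' * C) + C1, by positivity, i, fun n hn θ hθ Y => ?_⟩
    have hp := Om_pos hθ
    have hl := one_le_log hn
    have hD := Den_pos (n := n) (by omega) hθ Y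
    have hWp := Wp_pos (n := n) (θ := θ) (by omega) hp.2.1
    have hT := Tt_pos 0 (θ 2) Y
    have hg := gauss_pos (Y / θ 0)
    have hsS : θ 0 ≤ |B.s1| + 1 := by
      have := hθ.1.2
      have := le_abs_self B.s1
      linarith
    rw [Q_decomp1 B hn hθ]
    refine (abs_add_le _ _).trans ?_
    rw [add_mul, add_mul]
    refine add_le_add ?_ ?_
    · rw [abs_mul, abs_of_nonneg (by have := hp.1; positivity), mul_assoc, mul_assoc]
      have h1 := (h' (θ 0) hθ.1.1 Y).1
      have h2 := h n hn θ hθ Y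
      have := hp.1
      gcongr
      refine h1.trans ?_
      rw [mul_assoc, mul_assoc]
      have : C' * ((1 + |Y|) ^ (2 * i) * gauss (Y / θ 0)) ≤ C' * (C * Real.log n ^ i * Den n Y θ) :=
        mul_le_mul_of_nonneg_left h2 hC'.le
      linarith
    · refine (b1 n hn θ hθ Y).trans ?_
      rw [pow_zero, mul_one, zero_add, pow_one, mul_assoc, mul_assoc]
      refine mul_le_mul_of_nonneg_left ?_ hC1.le
      have h1 : Wp n θ * Tt 0 (θ 2) Y ≤ Den n Y θ := by unfold Den; linarith
      refine h1.trans (le_mul_of_one_le_left hD.le (one_le_pow₀ hl))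
  | zero =>
    refine ⟨1, one_pos, 0, fun n hn θ hθ Y => ?_⟩
    have hD := Den_pos (n := n) (by omega) hθ Y
    simp [Q, hD.le]
  | add F G hF hG ihF ihG =>
    obtain ⟨C, hC, p, h⟩ := ihF
    obtain ⟨C', hC', p', h'⟩ := ihG
    refine ⟨C + C', by positivity, max p p', fun n hn θ hθ Y => ?_⟩
    have hD := Den_pos (n := n) (by omega) hθ Y
    have hl := one_le_log hn
    have i1 := Nice.integrable B (F := F) (Or.inr (Pu_le hF)) hn hθ Y
    have i2 := Nice.integrable B (F := G) (Or.inr (Pu_le hG)) hn hθ Y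
    have e : Q n Y (F + G) θ = Q n Y F θ + Q n Y G θ := by
      unfold Q
      rw [← integral_add i1 i2]
      congr 1; funext u
      simp only [Pi.add_apply]; ring
    rw [e, add_mul, add_mul]
    refine (abs_add_le _ _).trans (add_le_add ((h n hn θ hθ Y).trans ?_) ((h' n hn θ hθ Y).trans ?_))
    · gcongr
      exact le_max_left _ _
    · gcongr
      exact le_max_right _ _
  | smul k F hF ihF =>
    obtain ⟨C, hC, p, h⟩ := ihF
    refine ⟨(|k| + 1) * C, by positivity, p, fun n hn θ hθ Y => ?_⟩
    have hD := Den_pos (n := n) (by omega) hθ Y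
    have hl := one_le_log hn
    have e : Q n Y (k • F) θ = k * Q n Y F θ := by
      unfold Q
      rw [← integral_const_mul]
      congr 1; funext u
      simp only [Pi.smul_apply, smul_eq_mul]; ring
    rw [e, abs_mul, mul_assoc, mul_assoc]
    have := h n hn θ hθ Y
    rw [mul_assoc] at this
    gcongr
    linarith


lemma gauss_cont : Continuous gauss := by unfold gauss; fun_prop

lemma gauss_integrable : Integrable gauss := by
  have h := integrable_exp_neg_mul_sq (b := 1 / 2) (by norm_num)
  have h2 := h.const_mul (Real.sqrt (2 * Real.pi))⁻¹
  refine h2.congr (Eventually.of_forall fun x => ?_)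
  unfold gauss
  show (Real.sqrt (2 * Real.pi))⁻¹ * Real.exp (-(1 / 2) * x ^ 2) = _
  congr 2; ring

lemma gauss_even (x : ℝ) : gauss (-x) = gauss x := by unfold gauss; simp

lemma gauss_cos (v : ℝ) : ∫ t, gauss t * Real.cos (v * t) = Real.exp (-(v ^ 2 / 2)) := by
  have h := gaussFT (1 / 2) (by norm_num) v
  have e : ∀ t, gauss t * Real.cos (v * t) = (Real.sqrt (2 * Real.pi))⁻¹ *
      (Real.cos (v * t) * Real.exp (-(1 / 2) * t ^ 2)) := by
    intro t; unfold gauss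
    rw [show -(t ^ 2) / 2 = -(1 / 2) * t ^ 2 by ring]; ring
  simp only [e]
  rw [integral_const_mul, h, show Real.pi / (1 / 2) = 2 * Real.pi by ring, ← mul_assoc,
    inv_mul_cancel₀ (by positivity), one_mul]
  congr 1; ring

lemma gauss_mul_integrable (f : ℝ → ℝ) (hf : Continuous f) (hb : ∀ x, |f x| ≤ 1) :
    Integrable fun t => gauss t * f t := by
  refine gauss_integrable.mono' ((gauss_cont.mul hf).aestronglyMeasurable)
    (Eventually.of_forall fun t => ?_)
  rw [norm_mul, Real.norm_of_nonneg (gauss_pos t).le]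
  exact mul_le_of_le_one_right (gauss_pos t).le (hb t)

lemma gauss_cos_shift (x v : ℝ) : ∫ t, gauss t * Real.cos ((x - t) * v) =
    Real.cos (x * v) * Real.exp (-(v ^ 2 / 2)) := by
  have e : ∀ t, gauss t * Real.cos ((x - t) * v) = Real.cos (x * v) * (gauss t * Real.cos (v * t))
      + Real.sin (x * v) * (gauss t * Real.sin (v * t)) := by
    intro t
    rw [sub_mul, Real.cos_sub, mul_comm t v]; ring
  have hs : ∫ t, gauss t * Real.sin (v * t) = 0 := by
    have h := integral_neg_eq_self (fun t => gauss t * Real.sin (v * t)) volume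
    simp only [gauss_even, mul_neg, Real.sin_neg] at h
    rw [integral_neg] at h
    linarith
  simp only [e]
  rw [integral_add ((gauss_mul_integrable _ (by fun_prop) fun t => Real.abs_cos_le_one _).const_mul _)
    ((gauss_mul_integrable _ (by fun_prop) fun t => Real.abs_sin_le_one _).const_mul _),
    integral_const_mul, integral_const_mul, hs, gauss_cos]
  ring

lemma gauss_inner {w : ℝ} (hw : 0 < w) (x u : ℝ) : ∫ z, gauss (x - w * z) * Real.cos (z * u)
    = w⁻¹ * (Real.cos (x * (u / w)) * Real.exp (-((u / w) ^ 2 / 2))) := by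
  have h := Measure.integral_comp_mul_left (fun s => gauss (x - s) * Real.cos (s * (u / w))) w
  have h2 := integral_sub_left_eq_self (fun t => gauss t * Real.cos ((x - t) * (u / w))) volume x
  simp only [sub_sub_cancel] at h2
  rw [h2, gauss_cos_shift, abs_of_pos (by positivity), smul_eq_mul] at h
  rw [← h]
  congr 1; funext z
  congr 2; field_simp

lemma exp_abs_integrable {α : ℝ} (hα : 0 < α) : Integrable fun u : ℝ => Real.exp (-(|u| ^ α)) := by
  have h := integrableOn_rpow_mul_exp_neg_rpow (p := α) (s := 0) (by norm_num) hα
  have h1 : IntegrableOn (fun u : ℝ => Real.exp (-(|u| ^ α))) (Ioi 0) := by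
    refine h.congr_fun (fun u hu => ?_) measurableSet_Ioi
    have hu' : (0:ℝ) < u := hu
    simp [abs_of_pos hu']
  have h2 : IntegrableOn (fun u : ℝ => Real.exp (-(|u| ^ α))) (Iic 0) := by
    have h3 := (integrableOn_Ici_iff_integrableOn_Ioi).2 h1
    have h4 := (Measure.measurePreserving_neg (volume : Measure ℝ)).integrableOn_comp_preimage
      (Homeomorph.neg ℝ).measurableEmbedding (f := fun u : ℝ => Real.exp (-(|u| ^ α))) (s := Ici 0)
    have h5 := h4.2 h3
    simpa [Function.comp_def] using h5
  rw [← integrableOn_univ, ← Iic_union_Ioi (a := (0:ℝ))]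
  exact h2.union h1

lemma fFun_eq {α w : ℝ} (hα : 0 < α) (hw : 0 < w) (x : ℝ) :
    fFun α x w = (Real.pi)⁻¹ * (w⁻¹ * ∫ u in Ioi (0:ℝ), Real.cos (x * (u / w)) *
      Real.exp (-((u / w) ^ 2 / 2)) * Real.exp (-(u ^ α))) := by
  have hgi : Integrable fun z => gauss (x - w * z) := by
    have h1 : Integrable fun s => gauss (x - s) := gauss_integrable.comp_sub_left x
    exact h1.comp_mul_left' hw.ne'
  have hprod : Integrable (Function.uncurry fun z u : ℝ => gauss (x - w * z) *
      (Real.cos (z * u) * Real.exp (-(|u| ^ α)))) (volume.prod volume) := by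
    have h := hgi.mul_prod (exp_abs_integrable hα)
    refine h.norm.mono' ?_ (Eventually.of_forall fun p => ?_)
    · refine Measurable.aestronglyMeasurable ?_
      have := gauss_cont.measurable
      unfold Function.uncurry
      fun_prop
    · simp only [Function.uncurry, norm_mul]
      refine mul_le_mul_of_nonneg_left ?_ (norm_nonneg _)
      exact mul_le_of_le_one_left (norm_nonneg _) (Real.abs_cos_le_one _)
  have hs := integral_integral_swap hprod
  unfold fFun stableDensity
  have e1 : ∀ z, gauss (x - w * z) * ((2 * Real.pi)⁻¹ * ∫ u : ℝ, Real.cos (z * u) * Real.exp (-(|u| ^ α)))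
      = (2 * Real.pi)⁻¹ * ∫ u : ℝ, gauss (x - w * z) * (Real.cos (z * u) * Real.exp (-(|u| ^ α))) := by
    intro z
    rw [integral_const_mul]; ring
  simp only [e1]
  rw [integral_const_mul, hs]
  have e2 : ∀ u : ℝ, ∫ z, gauss (x - w * z) * (Real.cos (z * u) * Real.exp (-(|u| ^ α)))
      = w⁻¹ * (Real.cos (x * (|u| / w)) * Real.exp (-((|u| / w) ^ 2 / 2)) * Real.exp (-(|u| ^ α))) := by
    intro u
    simp only [← mul_assoc]
    rw [integral_mul_const, gauss_inner hw]
    have e3 : Real.cos (x * (|u| / w)) = Real.cos (x * (u / w)) := by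
      rcases abs_choice u with h | h <;> rw [h]
      rw [neg_div, mul_neg, Real.cos_neg]
    rw [e3, div_pow, div_pow, sq_abs]
    ring
  simp only [e2]
  rw [integral_const_mul, integral_comp_abs (f := fun u => Real.cos (x * (u / w)) *
      Real.exp (-((u / w) ^ 2 / 2)) * Real.exp (-(u ^ α)))]
  have := Real.pi_pos
  field_simp

lemma pdens_eq (B : Box) {n : ℕ} (hn : 1 ≤ n) {θ : Fin 3 → ℝ} (hθ : θ ∈ B.Om) (y : ℝ) :
    pdens n θ y = (Real.sqrt n / Real.pi) * Q n (Real.sqrt n * y) E0 θ := by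
  obtain ⟨h0, h1, h2, -⟩ := Om_pos hθ
  have hn0 : (0:ℝ) < n := by exact_mod_cast hn
  have hw : 0 < wn n (θ 0) (θ 1) (θ 2) := by unfold wn; positivity
  unfold pdens
  rw [fFun_eq h2 hw]
  set w := wn n (θ 0) (θ 1) (θ 2) with hwdef
  have hws : 0 < w * θ 0 := by positivity
  have h := integral_comp_mul_left_Ioi (fun u => Real.cos (Real.sqrt n * y / θ 0 * (u / w)) *
      Real.exp (-((u / w) ^ 2 / 2)) * Real.exp (-(u ^ θ 2))) 0 hws
  rw [mul_zero, smul_eq_mul] at h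
  have h' : Q n (Real.sqrt n * y) E0 θ = ∫ v in Ioi (0:ℝ), Real.cos (Real.sqrt n * y / θ 0 * (w * θ 0 * v / w)) *
      Real.exp (-((w * θ 0 * v / w) ^ 2 / 2)) * Real.exp (-((w * θ 0 * v) ^ θ 2)) := by
    unfold Q
    refine setIntegral_congr_fun measurableSet_Ioi fun v hv => ?_
    have hv' : (0:ℝ) < v := hv
    have e1 : Real.sqrt n * y / θ 0 * (w * θ 0 * v / w) = Real.sqrt n * y * v := by field_simp
    have e2 : w * θ 0 * v / w = θ 0 * v := by field_simp
    have e3 : (w * θ 0 * v) ^ θ 2 = xx n (θ 1) (θ 2) v := by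
      rw [xx_eq hn h1 hv', Real.mul_rpow hws.le hv'.le]
      congr 1
      have : w * θ 0 = (n : ℝ) ^ ((1 : ℝ) / 2 - 1 / θ 2) * θ 1 := by
        rw [hwdef]; unfold wn; field_simp
      rw [this, Real.mul_rpow (by positivity) h1.le, ← Real.rpow_mul hn0.le]
      unfold Wp
      congr 2
      field_simp
    rw [e1, e2, e3]
    unfold E0 T
    simp only [pow_zero, mul_zero, one_mul]
    rw [mul_pow]; ring
  rw [h', h]
  field_simp


lemma E0_cls : Cls false 0 E0 := by
  simpa [Cls, E0] using T_mem_Pu 0 0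

def LL (Y : ℝ) : ℝ := 1 + Real.log (1 + |Y|)

lemma one_le_LL (Y : ℝ) : 1 ≤ LL Y := by
  unfold LL
  linarith [Real.log_nonneg (show 1 ≤ 1 + |Y| by linarith [abs_nonneg Y])]

lemma Tt_eq (r : ℕ) (α Y : ℝ) : Tt r α Y = Tt 0 α Y * LL Y ^ r := by
  unfold Tt LL; ring

def mu (n : ℕ) (Y : ℝ) (θ : Fin 3 → ℝ) : ℝ := Wp n θ * Tt 0 (θ 2) Y / Den n Y θ

def MM (flag : Bool) (r : ℕ) (n : ℕ) (Y : ℝ) (θ : Fin 3 → ℝ) : ℝ :=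
  if flag then mu n Y θ * LL Y ^ r else 1

lemma mu_pos {B : Box} {n : ℕ} (hn : 1 ≤ n) {θ : Fin 3 → ℝ} (hθ : θ ∈ B.Om) (Y : ℝ) :
    0 < mu n Y θ := by
  have := Wp_pos (n := n) (θ := θ) hn (Om_pos hθ).2.1
  have := Den_pos hn hθ Y
  have := Tt_pos 0 (θ 2) Y
  unfold mu; positivity

lemma mu_le {B : Box} {n : ℕ} (hn : 1 ≤ n) {θ : Fin 3 → ℝ} (hθ : θ ∈ B.Om) (Y : ℝ) :
    mu n Y θ ≤ 1 := by
  have := Den_pos hn hθ Y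
  have := gauss_pos (Y / θ 0)
  unfold mu
  rw [div_le_one (by assumption)]
  unfold Den; linarith

lemma MM_pos {B : Box} {n : ℕ} (hn : 1 ≤ n) {θ : Fin 3 → ℝ} (hθ : θ ∈ B.Om) (Y : ℝ) (f : Bool) (r : ℕ) :
    0 < MM f r n Y θ := by
  have := mu_pos hn hθ Y
  have := one_le_LL Y
  unfold MM
  split_ifs <;> positivity

lemma MM_mul {B : Box} {n : ℕ} (hn : 1 ≤ n) {θ : Fin 3 → ℝ} (hθ : θ ∈ B.Om) (Y : ℝ) (f f' : Bool)
    (r r' : ℕ) : MM f r n Y θ * MM f' r' n Y θ ≤ MM (f || f') (r + r') n Y θ := by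
  have h0 := mu_pos hn hθ Y
  have h1 := mu_le hn hθ Y
  have hL := one_le_LL Y
  have hp := one_le_pow₀ hL (n := r)
  have hp' := one_le_pow₀ hL (n := r')
  unfold MM
  cases f <;> cases f' <;> simp [pow_add]
  · gcongr
    exact le_mul_of_one_le_left (by positivity) hp
  · gcongr
    exact le_mul_of_one_le_right (by positivity) hp'
  · calc _ = (mu n Y θ * mu n Y θ) * (LL Y ^ r * LL Y ^ r') := by ring
      _ ≤ (1 * mu n Y θ) * (LL Y ^ r * LL Y ^ r') := by gcongr
      _ = _ := by ring

def Bd (B : Box) (f : Bool) (r : ℕ) (R : ℕ → ℝ → (Fin 3 → ℝ) → ℝ) : Prop :=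
  ∃ C > (0:ℝ), ∃ p N : ℕ, 3 ≤ N ∧ ∀ n ≥ N, ∀ θ ∈ B.Om, ∀ Y : ℝ,
    |R n Y θ| ≤ C * Real.log n ^ p * MM f r n Y θ

lemma Bd.mul {B : Box} {f f' : Bool} {r r' : ℕ} {R R' : ℕ → ℝ → (Fin 3 → ℝ) → ℝ}
    (h : Bd B f r R) (h' : Bd B f' r' R') :
    Bd B (f || f') (r + r') (fun n Y θ => R n Y θ * R' n Y θ) := by
  obtain ⟨C, hC, p, N, hN, h⟩ := h
  obtain ⟨C', hC', p', N', hN', h'⟩ := h'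
  refine ⟨C * C', by positivity, p + p', max N N', le_max_of_le_left hN, fun n hn θ hθ Y => ?_⟩
  have hn1 : N ≤ n := (le_max_left _ _).trans hn
  have hn2 : N' ≤ n := (le_max_right _ _).trans hn
  have h1 := h n hn1 θ hθ Y
  have h2 := h' n hn2 θ hθ Y
  have hl := one_le_log (hN.trans hn1)
  have hm := MM_mul (n := n) (by omega) hθ Y f f' r r'
  have hm1 := MM_pos (n := n) (by omega) hθ Y f r
  rw [abs_mul]
  calc _ ≤ (C * Real.log n ^ p * MM f r n Y θ) * (C' * Real.log n ^ p' * MM f' r' n Y θ) := by gcongr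
    _ = C * C' * Real.log n ^ (p + p') * (MM f r n Y θ * MM f' r' n Y θ) := by rw [pow_add]; ring
    _ ≤ _ := by gcongr

lemma Bd.sub {B : Box} {f : Bool} {r : ℕ} {R R' : ℕ → ℝ → (Fin 3 → ℝ) → ℝ}
    (h : Bd B f r R) (h' : Bd B f r R') :
    Bd B f r (fun n Y θ => R n Y θ - R' n Y θ) := by
  obtain ⟨C, hC, p, N, hN, h⟩ := h
  obtain ⟨C', hC', p', N', hN', h'⟩ := h'
  refine ⟨C + C', by positivity, max p p', max N N', le_max_of_le_left hN, fun n hn θ hθ Y => ?_⟩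
  have hn1 : N ≤ n := (le_max_left _ _).trans hn
  have hn2 : N' ≤ n := (le_max_right _ _).trans hn
  have h1 := h n hn1 θ hθ Y
  have h2 := h' n hn2 θ hθ Y
  have hl := one_le_log (hN.trans hn1)
  have hm1 := MM_pos (n := n) (by omega) hθ Y f r
  refine (abs_sub _ _).trans ?_
  rw [add_mul, add_mul]
  refine add_le_add (h1.trans ?_) (h2.trans ?_)
  · gcongr
    exact le_max_left _ _
  · gcongr
    exact le_max_right _ _

def Rt (F : Sy) (n : ℕ) (Y : ℝ) (θ : Fin 3 → ℝ) : ℝ := Q n Y F θ / Q n Y E0 θ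

lemma Rt_bd (B : Box) {f : Bool} {r : ℕ} {F : Sy} (h : Cls f r F) : Bd B f r (Rt F) := by
  obtain ⟨c, hc, N, hN, hlow⟩ := Q_lower B
  cases f with
  | false =>
    obtain ⟨C, hC, p, hb⟩ := Pu_bound B (by simpa [Cls] using h : F ∈ Pu)
    refine ⟨C / c, by positivity, p, N, hN, fun n hn θ hθ Y => ?_⟩
    have hn3 : 3 ≤ n := hN.trans hn
    have hD := Den_pos (n := n) (by omega) hθ Y
    have hl := hlow n hn θ hθ Y
    have hq : 0 < Q n Y E0 θ := lt_of_lt_of_le (by positivity) hl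
    have hlg := one_le_log hn3
    simp only [MM, Rt, mul_one]
    rw [abs_div, abs_of_pos hq, div_le_iff₀ hq]
    refine (hb n hn3 θ hθ Y).trans ?_
    calc C * Real.log n ^ p * Den n Y θ = C / c * Real.log n ^ p * (c * Den n Y θ) := by field_simp
      _ ≤ _ := by
        simp only [Bool.false_eq_true, if_false, mul_one]
        gcongr
  | true =>
    obtain ⟨C, hC, hb⟩ := Q_bound (o := 0) B (by simpa [Cls] using h : F ∈ Cl 1 r)
    refine ⟨C / c, by positivity, r, N, hN, fun n hn θ hθ Y => ?_⟩
    have hn3 : 3 ≤ n := hN.trans hn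
    have hD := Den_pos (n := n) (by omega) hθ Y
    have hl := hlow n hn θ hθ Y
    have hq : 0 < Q n Y E0 θ := lt_of_lt_of_le (by positivity) hl
    have hlg := one_le_log hn3
    have hmu := mu_pos (n := n) (by omega) hθ Y
    have hL := one_le_LL Y
    simp only [MM, Rt, if_true]
    rw [abs_div, abs_of_pos hq, div_le_iff₀ hq]
    refine (hb n hn3 θ hθ Y).trans ?_
    rw [Tt_eq]
    calc C * (Wp n θ ^ (0 + 1) * Real.log n ^ r) * (Tt 0 (θ 2) Y * LL Y ^ r)
        = C / c * Real.log n ^ r * (mu n Y θ * LL Y ^ r) * (c * Den n Y θ) := by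
          unfold mu; field_simp; ring
      _ ≤ _ := by gcongr

lemma Rt_deriv (B : Box) {f f' : Bool} {r r' : ℕ} {F F' E' : Sy} (hF : Cls f r F) (hF' : Cls f' r' F')
    {g : Bool} {q : ℕ} (hE' : Cls g q E') {j : Fin 3} (hR : RelP j F F') (hE : RelP j E0 E')
    {n : ℕ} (hn : 3 ≤ n) {θ : Fin 3 → ℝ} (hθ : θ ∈ B.Om) (Y : ℝ) (hq : Q n Y E0 θ ≠ 0) :
    HasDerivAt (fun t => Rt F n Y (Function.update θ j t))
      (Rt F' n Y θ - Rt F n Y θ * Rt E' n Y θ) (θ j) := by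
  have h1 := Q_deriv B hF.nice hF'.nice hR hn hθ Y
  have h2 := Q_deriv B E0_cls.nice hE'.nice hE hn hθ Y
  have h3 := h1.div h2 (by simpa using hq)
  refine h3.congr_deriv ?_
  simp only [Function.update_eq_self]
  unfold Rt
  field_simp

lemma pderiv_eq (B : Box) {G H : (Fin 3 → ℝ) → ℝ} (hGH : ∀ θ ∈ B.Om, G θ = H θ) {θ : Fin 3 → ℝ}
    (hθ : θ ∈ B.Om) {j : Fin 3} {d : ℝ} (hd : HasDerivAt (fun t => H (Function.update θ j t)) d (θ j)) :
    pderiv j G θ = d := by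
  unfold pderiv
  rw [← hd.deriv]
  apply Filter.EventuallyEq.deriv_eq
  exact (Om_update B hθ j).mono fun t ht => hGH _ ht

lemma third (B : Box) (a b c : Fin 3) : ∃ D3 : ℕ → ℝ → (Fin 3 → ℝ) → ℝ,
    Bd B (decide (c ≠ 0) || decide (b ≠ 0) || decide (a ≠ 0)) 3 D3 ∧ ∃ N : ℕ, ∀ n ≥ N, ∀ θ ∈ B.Om, ∀ y : ℝ,
      pderiv a (fun θ' => pderiv b (fun θ'' =>
            pderiv c (fun θ''' => Real.log (pdens n θ''' y)) θ'') θ') θ = D3 n (Real.sqrt n * y) θ := by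
  obtain ⟨Ea, ka, ra⟩ := Cls_step E0_cls a
  obtain ⟨Eb, kb, rb⟩ := Cls_step E0_cls b
  obtain ⟨Ec, kc, rc⟩ := Cls_step E0_cls c
  obtain ⟨Ecb, kcb, rcb⟩ := Cls_step kc b
  obtain ⟨Eca, kca, rca⟩ := Cls_step kc a
  obtain ⟨Eba, kba, rba⟩ := Cls_step kb a
  obtain ⟨Ecba, kcba, rcba⟩ := Cls_step kcb a
  simp only [Bool.false_or, zero_add, Nat.reduceAdd] at ka kb kc kcb kca kba kcba
  refine ⟨fun n Y θ => (Rt Ecba n Y θ - Rt Ecb n Y θ * Rt Ea n Y θ) -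
    ((Rt Eca n Y θ - Rt Ec n Y θ * Rt Ea n Y θ) * Rt Eb n Y θ -
      (0 - Rt Ec n Y θ * (Rt Eba n Y θ - Rt Eb n Y θ * Rt Ea n Y θ))), ?_, ?_⟩
  · have ba := Rt_bd B ka
    have bb := Rt_bd B kb
    have bc := Rt_bd B kc
    have bcb := Rt_bd B kcb
    have bca := Rt_bd B kca
    have bba := Rt_bd B kba
    have bcba := Rt_bd B kcba
    have t1 := bcb.mul ba
    have t2 := (bca.sub (bc.mul ba)).mul bb
    have t3 := bc.mul (bba.sub (bb.mul ba))
    rw [Bool.or_assoc, Bool.or_comm (decide (a ≠ 0)), ← Bool.or_assoc] at t2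
    rw [← Bool.or_assoc] at t3
    have t0 := t3.sub t3
    simp only [sub_self] at t0
    exact (bcba.sub t1).sub (t2.sub (t0.sub t3))
  · obtain ⟨cl, hcl, N, hN, hlow⟩ := Q_lower B
    refine ⟨N, fun n hn θ hθ y => ?_⟩
    have hn3 : 3 ≤ n := hN.trans hn
    have hn0 : (0:ℝ) < n := by exact_mod_cast (by omega : 0 < n)
    set Y := Real.sqrt n * y with hY
    have hq : ∀ θ ∈ B.Om, Q n Y E0 θ ≠ 0 := fun θ hθ => by
      have hD := Den_pos (n := n) (by omega) hθ Y
      exact (lt_of_lt_of_le (by positivity) (hlow n hn θ hθ Y)).ne'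
    have hlog : ∀ θ ∈ B.Om, Real.log (pdens n θ y) = Real.log (Real.sqrt n / Real.pi) + Real.log (Q n Y E0 θ) := by
      intro θ hθ
      rw [pdens_eq B (by omega) hθ, Real.log_mul (by positivity) (hq θ hθ)]
    have s1 : ∀ θ ∈ B.Om, pderiv c (fun θ''' => Real.log (pdens n θ''' y)) θ = Rt Ec n Y θ := by
      intro θ hθ
      refine pderiv_eq B hlog hθ ?_
      have h := Q_deriv B E0_cls.nice kc.nice rc hn3 hθ Y
      have h2 := (h.log (by simpa using hq θ hθ)).const_add (Real.log (Real.sqrt n / Real.pi))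
      simpa [Rt] using h2
    have s2 : ∀ θ ∈ B.Om, pderiv b (fun θ'' =>
            pderiv c (fun θ''' => Real.log (pdens n θ''' y)) θ'') θ =
          Rt Ecb n Y θ - Rt Ec n Y θ * Rt Eb n Y θ := by
      intro θ hθ
      exact pderiv_eq B s1 hθ (Rt_deriv B kc kcb kb rcb rb hn3 hθ Y (hq θ hθ))
    refine pderiv_eq B s2 hθ ?_
    have d1 := Rt_deriv B kcb kcba ka rcba ra hn3 hθ Y (hq θ hθ)
    have d2 := Rt_deriv B kc kca ka rca ra hn3 hθ Y (hq θ hθ)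
    have d3 := Rt_deriv B kb kba ka rba ra hn3 hθ Y (hq θ hθ)
    refine (d1.sub (d2.mul d3)).congr_deriv ?_
    simp only [Function.update_eq_self]
    ring


lemma ratio_le {W w s m M g T3 T0 P3 P0 C3 C0 : ℝ} (hW : W = w * s) (hw : 0 < w) (hm : 0 < m)
    (hms : m ≤ s) (hsM : s ≤ M) (hg : 0 < g) (hT3 : 0 < T3) (hT0 : 0 < T0) (hP3 : 0 < P3)
    (hP0 : 0 < P0) (hC3 : 0 < C3) (hC0 : 0 < C0) (h3 : T3 ≤ C3 * P3) (h0 : P0 ≤ C0 * T0) :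
    W * T3 / (g + W * T0) ≤ M * C3 * (1 + C0 / m) * (w * P3 / (g + w * P0)) := by
  have hs : 0 < s := by linarith
  have hM : 0 < M := by linarith
  have hWp : 0 < W := by rw [hW]; positivity
  have a1 : W * T3 ≤ M * C3 * (w * P3) := by
    calc W * T3 ≤ (w * M) * (C3 * P3) := by
          rw [hW]; gcongr
      _ = _ := by ring
  have a2 : g + w * P0 ≤ (1 + C0 / m) * (g + W * T0) := by
    have : w * P0 ≤ C0 / m * (W * T0) := by
      calc w * P0 ≤ w * (C0 * T0) := by gcongr
        _ = C0 / m * ((w * m) * T0) := by field_simp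
        _ ≤ C0 / m * (W * T0) := by rw [hW]; gcongr
    have h4 : 0 ≤ C0 / m * g := by positivity
    have h5 : 0 ≤ W * T0 := by positivity
    nlinarith
  rw [← mul_div_assoc, div_le_div_iff₀ (by positivity) (by positivity)]
  calc W * T3 * (g + w * P0) ≤ (M * C3 * (w * P3)) * ((1 + C0 / m) * (g + W * T0)) := by
        gcongr
    _ = _ := by ring

lemma psi3_le (B : Box) {ψ : ℝ → ℕ → ℝ → ℝ} (hψ : IsPsiFamily ψ) :
    ∃ C > (0:ℝ), ∀ θ ∈ B.Om, ∀ x : ℝ, Tt 3 (θ 2) (θ 0 * x) ≤ C * ψ (θ 2) 3 x := by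
  obtain ⟨c, hc, C1, hcC⟩ := hψ.unifBound (Icc B.a0 B.a1)
    (fun a ha => ⟨lt_of_lt_of_le B.ha0 ha.1, lt_of_le_of_lt ha.2 B.ha1⟩) isCompact_Icc 3
  set S : ℝ := |B.s1| + 1 with hS
  have hS1 : 1 ≤ S := by have := abs_nonneg B.s1; linarith
  set m : ℝ := min B.s0 1 with hm
  have hm0 : 0 < m := lt_min B.hs0 one_pos
  have hm1 : m ≤ 1 := min_le_right _ _
  set A : ℝ := (1 + Real.log (1 + 3 * S)) ^ 3 with hA
  have hlA : 0 < Real.log (1 + 3 * S) := Real.log_pos (by linarith)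
  have hA0 : 0 < A := by positivity
  have hlS : 0 < Real.log (1 + S) := Real.log_pos (by linarith)
  set c' : ℝ := min 1 c with hc'
  have hc'0 : 0 < c' := lt_min one_pos hc
  set D : ℝ := m ^ (-3:ℝ) * (2 + Real.log (1 + S)) ^ 3 with hD
  have hD0 : 0 < D := by positivity
  refine ⟨A / c' + D, by positivity, fun θ hθ x => ?_⟩
  obtain ⟨p0, -, p2, p3⟩ := Om_pos hθ
  have hα : θ 2 ∈ Ioo (0:ℝ) 2 := ⟨p2, p3⟩
  have hαK : θ 2 ∈ Icc B.a0 B.a1 := ⟨hθ.2.2.1.le, hθ.2.2.2.le⟩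
  have hσS : θ 0 ≤ S := by have := hθ.1.2; have := le_abs_self B.s1; linarith
  have hσm : m ≤ θ 0 := (min_le_left _ _).trans hθ.1.1.le
  have hψp := hψ.pos _ hα 3 x
  have hY : |θ 0 * x| = θ 0 * |x| := by rw [abs_mul, abs_of_pos p0]
  have hx0 := abs_nonneg x
  unfold Tt
  rw [hY]
  rcases le_total |x| 3 with hx | hx
  · have hψl : c' ≤ ψ (θ 2) 3 x := by
      rcases le_total |x| 1 with h | h
      · rw [hψ.eq_one _ hα 3 x h]; exact min_le_left _ _
      · exact (min_le_right _ _).trans (hcC _ hαK x h hx).1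
    have b1 : (1 + θ 0 * |x|) ^ (-(1 + θ 2)) ≤ 1 :=
      Real.rpow_le_one_of_one_le_of_nonpos (by nlinarith) (by linarith)
    have b2 : Real.log (1 + θ 0 * |x|) ≤ Real.log (1 + 3 * S) :=
      Real.log_le_log (by positivity) (by nlinarith)
    have b3 : 0 ≤ Real.log (1 + θ 0 * |x|) := Real.log_nonneg (by nlinarith)
    calc _ ≤ 1 * (1 + Real.log (1 + 3 * S)) ^ 3 := by gcongr
      _ = A / c' * c' := by rw [hA]; field_simp
      _ ≤ A / c' * ψ (θ 2) 3 x := by gcongr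
      _ ≤ _ := by gcongr; linarith
  · have hxp : 0 < |x| := by linarith
    rw [hψ.eq_tail _ hα 3 x hx] at *
    have hl : 1 ≤ Real.log |x| := by
      rw [Real.le_log_iff_exp_le hxp]
      linarith [Real.exp_one_lt_d9]
    have b1 : (1 + θ 0 * |x|) ^ (-(1 + θ 2)) ≤ m ^ (-3:ℝ) * |x| ^ (-(1 + θ 2)) := by
      calc _ ≤ (m * |x|) ^ (-(1 + θ 2)) :=
            Real.rpow_le_rpow_of_nonpos (by positivity) (by nlinarith) (by linarith)
        _ = m ^ (-(1 + θ 2)) * |x| ^ (-(1 + θ 2)) := Real.mul_rpow hm0.le hx0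
        _ ≤ _ := by
          gcongr ?_ * _
          exact Real.rpow_le_rpow_of_exponent_ge hm0 hm1 (by linarith)
    have b2 : Real.log (1 + θ 0 * |x|) ≤ Real.log (1 + S) + Real.log |x| := by
      rw [← Real.log_mul (by positivity) (by positivity)]
      exact Real.log_le_log (by positivity) (by nlinarith)
    have b3 : 0 ≤ Real.log (1 + θ 0 * |x|) := Real.log_nonneg (by nlinarith)
    have b4 : 1 + Real.log (1 + θ 0 * |x|) ≤ (2 + Real.log (1 + S)) * Real.log |x| := by
      nlinarith
    calc _ ≤ (m ^ (-3:ℝ) * |x| ^ (-(1 + θ 2))) * ((2 + Real.log (1 + S)) * Real.log |x|) ^ 3 := by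
          gcongr
      _ = D * (Real.log |x| ^ 3 / |x| ^ (θ 2 + 1)) := by
          rw [Real.rpow_neg hx0, add_comm 1 (θ 2), hD]; field_simp
      _ ≤ _ := by
          gcongr
          have : 0 < A / c' := by positivity
          linarith

lemma psi0_le (B : Box) {ψ : ℝ → ℕ → ℝ → ℝ} (hψ : IsPsiFamily ψ) :
    ∃ C > (0:ℝ), ∀ θ ∈ B.Om, ∀ x : ℝ, ψ (θ 2) 0 x ≤ C * Tt 0 (θ 2) (θ 0 * x) := by
  obtain ⟨c, hc, C1, hcC⟩ := hψ.unifBound (Icc B.a0 B.a1)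
    (fun a ha => ⟨lt_of_lt_of_le B.ha0 ha.1, lt_of_le_of_lt ha.2 B.ha1⟩) isCompact_Icc 0
  set S : ℝ := |B.s1| + 1 with hS
  have hS1 : 1 ≤ S := by have := abs_nonneg B.s1; linarith
  set A : ℝ := max 1 C1 with hA
  have hA0 : 0 < A := lt_of_lt_of_le one_pos (le_max_left _ _)
  refine ⟨A * (1 + 3 * S) ^ (3:ℝ) + (1 + S) ^ (3:ℝ), by positivity, fun θ hθ x => ?_⟩
  obtain ⟨p0, -, p2, p3⟩ := Om_pos hθ
  have hα : θ 2 ∈ Ioo (0:ℝ) 2 := ⟨p2, p3⟩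
  have hαK : θ 2 ∈ Icc B.a0 B.a1 := ⟨hθ.2.2.1.le, hθ.2.2.2.le⟩
  have hσS : θ 0 ≤ S := by have := hθ.1.2; have := le_abs_self B.s1; linarith
  have hY : |θ 0 * x| = θ 0 * |x| := by rw [abs_mul, abs_of_pos p0]
  have hx0 := abs_nonneg x
  unfold Tt
  rw [hY, pow_zero, mul_one, Real.rpow_neg (by positivity), ← div_eq_mul_inv,
    le_div_iff₀ (by positivity)]
  rcases le_total |x| 3 with hx | hx
  · have hψl : ψ (θ 2) 0 x ≤ A := by
      rcases le_total |x| 1 with h | h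
      · rw [hψ.eq_one _ hα 0 x h]; exact le_max_left _ _
      · exact (hcC _ hαK x h hx).2.trans (le_max_right _ _)
    have b1 : (1 + θ 0 * |x|) ^ (1 + θ 2) ≤ (1 + 3 * S) ^ (3:ℝ) := by
      calc _ ≤ (1 + 3 * S) ^ (1 + θ 2) :=
            Real.rpow_le_rpow (by positivity) (by nlinarith) (by linarith)
        _ ≤ _ := Real.rpow_le_rpow_of_exponent_le (by linarith) (by linarith)
    have : 0 < (1 + S) ^ (3:ℝ) := by positivity
    calc _ ≤ A * (1 + 3 * S) ^ (3:ℝ) := by gcongr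
      _ ≤ _ := by linarith
  · have hxp : 0 < |x| := by linarith
    rw [hψ.eq_tail _ hα 0 x hx, pow_zero]
    have b1 : (1 + θ 0 * |x|) ^ (1 + θ 2) ≤ (1 + S) ^ (3:ℝ) * |x| ^ (θ 2 + 1) := by
      calc _ ≤ ((1 + S) * |x|) ^ (1 + θ 2) :=
            Real.rpow_le_rpow (by positivity) (by nlinarith) (by linarith)
        _ = (1 + S) ^ (1 + θ 2) * |x| ^ (θ 2 + 1) := by
            rw [Real.mul_rpow (by positivity) hx0, add_comm (θ 2) 1]
        _ ≤ _ := by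
            gcongr ?_ * _
            exact Real.rpow_le_rpow_of_exponent_le (by linarith) (by linarith)
    have : 0 < A * (1 + 3 * S) ^ (3:ℝ) := by positivity
    calc _ ≤ 1 / |x| ^ (θ 2 + 1) * ((1 + S) ^ (3:ℝ) * |x| ^ (θ 2 + 1)) := by gcongr
      _ = (1 + S) ^ (3:ℝ) := by field_simp
      _ ≤ _ := by linarith

lemma Wp_wn {n : ℕ} (hn : 1 ≤ n) {θ : Fin 3 → ℝ} (h0 : 0 < θ 0) (h1 : 0 < θ 1) (h2 : 0 < θ 2) :
    Wp n θ = wn n (θ 0) (θ 1) (θ 2) ^ θ 2 * θ 0 ^ θ 2 := by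
  have hn0 : (0:ℝ) < n := by exact_mod_cast hn
  have hw : 0 < wn n (θ 0) (θ 1) (θ 2) := by unfold wn; positivity
  rw [← Real.mul_rpow hw.le h0.le]
  have : wn n (θ 0) (θ 1) (θ 2) * θ 0 = (n : ℝ) ^ ((1 : ℝ) / 2 - 1 / θ 2) * θ 1 := by
    unfold wn; field_simp
  rw [this, Real.mul_rpow (by positivity) h1.le, ← Real.rpow_mul hn0.le]
  unfold Wp
  congr 2
  field_simp

lemma mu_le_psi (B : Box) {ψ : ℝ → ℕ → ℝ → ℝ} (hψ : IsPsiFamily ψ) :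
    ∃ C > (0:ℝ), ∀ n : ℕ, 1 ≤ n → ∀ θ ∈ B.Om, ∀ y : ℝ,
      mu n (Real.sqrt n * y) θ * LL (Real.sqrt n * y) ^ 3 ≤
        C * (wn n (θ 0) (θ 1) (θ 2) ^ (θ 2) * ψ (θ 2) 3 (Real.sqrt n * y / θ 0) /
            (gauss (Real.sqrt n * y / θ 0)
              + wn n (θ 0) (θ 1) (θ 2) ^ (θ 2) * ψ (θ 2) 0 (Real.sqrt n * y / θ 0))) := by
  obtain ⟨C3, hC3, h3⟩ := psi3_le B hψ
  obtain ⟨C0, hC0, h0⟩ := psi0_le B hψ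
  set S : ℝ := |B.s1| + 1 with hS
  have hS1 : 1 ≤ S := by have := abs_nonneg B.s1; linarith
  set m : ℝ := min B.s0 1 with hm
  have hm0 : 0 < m := lt_min B.hs0 one_pos
  have hm1 : m ≤ 1 := min_le_right _ _
  refine ⟨S ^ (2:ℝ) * C3 * (1 + C0 / m ^ (2:ℝ)), by positivity, fun n hn θ hθ y => ?_⟩
  obtain ⟨p0, p1, p2, p3⟩ := Om_pos hθ
  have hα : θ 2 ∈ Ioo (0:ℝ) 2 := ⟨p2, p3⟩
  have hσS : θ 0 ≤ S := by have := hθ.1.2; have := le_abs_self B.s1; linarith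
  have hσm : m ≤ θ 0 := (min_le_left _ _).trans hθ.1.1.le
  have hn0 : (0:ℝ) < n := by exact_mod_cast hn
  have hw : 0 < wn n (θ 0) (θ 1) (θ 2) := by unfold wn; positivity
  set Y := Real.sqrt n * y with hYd
  have hYx : θ 0 * (Y / θ 0) = Y := by field_simp
  have e3 := h3 θ hθ (Y / θ 0)
  have e0 := h0 θ hθ (Y / θ 0)
  rw [hYx] at e3 e0
  have key := ratio_le (g := gauss (Y / θ 0)) (Wp_wn hn p0 p1 p2) (Real.rpow_pos_of_pos hw _)
    (show 0 < m ^ (2:ℝ) by positivity)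
    (show m ^ (2:ℝ) ≤ θ 0 ^ θ 2 from
      (Real.rpow_le_rpow_of_exponent_ge hm0 hm1 p3.le).trans
        (Real.rpow_le_rpow hm0.le hσm p2.le))
    (show θ 0 ^ θ 2 ≤ S ^ (2:ℝ) from
      (Real.rpow_le_rpow p0.le hσS p2.le).trans
        (Real.rpow_le_rpow_of_exponent_le hS1 p3.le))
    (gauss_pos _) (Tt_pos 3 (θ 2) Y) (Tt_pos 0 (θ 2) Y) (hψ.pos _ hα 3 _) (hψ.pos _ hα 0 _)
    hC3 hC0 e3 e0
  refine le_trans (le_of_eq ?_) key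
  rw [Tt_eq 3]
  unfold mu Den
  ring

lemma box_exists {V : Set (Fin 3 → ℝ)} (hV : IsCompact V) (hne : V.Nonempty)
    (hVsub : V ⊆ {θ : Fin 3 → ℝ | 0 < θ 0 ∧ 0 < θ 1 ∧ θ 2 ∈ Set.Ioo (0 : ℝ) 2}) :
    ∃ B : Box, V ⊆ B.Om := by
  have hc : ∀ j : Fin 3, ContinuousOn (fun θ : Fin 3 → ℝ => θ j) V :=
    fun j => (continuous_apply j).continuousOn
  obtain ⟨u0, hu0, hm0⟩ := hV.exists_isMinOn hne (hc 0)
  obtain ⟨u1, hu1, hm1⟩ := hV.exists_isMinOn hne (hc 1)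
  obtain ⟨u2, hu2, hm2⟩ := hV.exists_isMinOn hne (hc 2)
  obtain ⟨v0, hv0, hM0⟩ := hV.exists_isMaxOn hne (hc 0)
  obtain ⟨v1, hv1, hM1⟩ := hV.exists_isMaxOn hne (hc 1)
  obtain ⟨v2, hv2, hM2⟩ := hV.exists_isMaxOn hne (hc 2)
  have k0 := (hVsub hu0).1
  have k1 := (hVsub hu1).2.1
  have k2 := (hVsub hu2).2.2.1
  have k3 := (hVsub hv2).2.2.2
  refine ⟨⟨u0 0 / 2, v0 0 + 1, u1 1 / 2, v1 1 + 1, u2 2 / 2, (v2 2 + 2) / 2,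
    by linarith, by linarith, by linarith, by linarith⟩, fun θ hθ => ?_⟩
  have a0 : u0 0 ≤ θ 0 := hm0 hθ
  have a1 : u1 1 ≤ θ 1 := hm1 hθ
  have a2 : u2 2 ≤ θ 2 := hm2 hθ
  have b0 : θ 0 ≤ v0 0 := hM0 hθ
  have b1 : θ 1 ≤ v1 1 := hM1 hθ
  have b2 : θ 2 ≤ v2 2 := hM2 hθ
  refine ⟨⟨?_, ?_⟩, ⟨?_, ?_⟩, ⟨?_, ?_⟩⟩ <;> simp only <;> linarith

/-- finitely many bounds can be made uniform -/
lemma unif_of_finite {ι X : Type} [Fintype ι] [Nonempty ι] (G M : ι → ℕ → X → ℝ)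
    (hM : ∀ t n x, 1 ≤ n → 0 < M t n x)
    (H : ∀ t, ∃ C > (0:ℝ), ∃ P N : ℕ, 3 ≤ N ∧ ∀ n ≥ N, ∀ x, G t n x ≤ C * Real.log n ^ P * M t n x) :
    ∃ C > (0:ℝ), ∃ P N : ℕ, 3 ≤ N ∧ ∀ n ≥ N, ∀ x, ∀ t, G t n x ≤ C * Real.log n ^ P * M t n x := by
  choose C hC P N hN h using H
  refine ⟨∑ t, C t, Finset.sum_pos (fun t _ => hC t) Finset.univ_nonempty, ∑ t, P t, ∑ t, N t,
    (hN (Classical.arbitrary ι)).trans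
      (Finset.single_le_sum (f := N) (fun _ _ => Nat.zero_le _) (Finset.mem_univ _)),
    fun n hn x t => ?_⟩
  have hNn : N t ≤ n :=
    (Finset.single_le_sum (f := N) (fun _ _ => Nat.zero_le _) (Finset.mem_univ _)).trans hn
  have hn3 : 3 ≤ n := (hN _).trans hNn
  have hlg := one_le_log hn3
  have hMp := hM t n x (by omega)
  refine (h t n hNn x).trans ?_
  have hCs := Finset.single_le_sum (f := C) (fun t _ => (hC t).le) (Finset.mem_univ t)
  have hCp := hC t
  have hPs := Finset.single_le_sum (f := P) (fun _ _ => Nat.zero_le _) (Finset.mem_univ t)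
  have hpw := pow_le_pow_right₀ hlg hPs
  have hl0 : 0 ≤ Real.log n ^ P t := by positivity
  exact mul_le_mul_of_nonneg_right (mul_le_mul hCs hpw hl0 (hCp.le.trans hCs)) hMp.le

/-- uniform version over all triples -/
lemma third_unif (B : Box) : ∃ C > (0:ℝ), ∃ P N : ℕ, 3 ≤ N ∧ ∀ n ≥ N, ∀ θ ∈ B.Om, ∀ y : ℝ,
    ∀ a b c : Fin 3,
    |pderiv a (fun θ' => pderiv b (fun θ'' => pderiv c (fun θ''' =>
      Real.log (pdens n θ''' y)) θ'') θ') θ| ≤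
      C * Real.log n ^ P *
        MM (decide (c ≠ 0) || decide (b ≠ 0) || decide (a ≠ 0)) 3 n (Real.sqrt n * y) θ := by
  obtain ⟨C, hC, P, N, hN, h⟩ := unif_of_finite (ι := Fin 3 × Fin 3 × Fin 3) (X := B.Om × ℝ)
    (fun t n x => |pderiv t.1 (fun θ' => pderiv t.2.1 (fun θ'' => pderiv t.2.2 (fun θ''' =>
      Real.log (pdens n θ''' x.2)) θ'') θ') x.1.1|)
    (fun t n x => MM (decide (t.2.2 ≠ 0) || decide (t.2.1 ≠ 0) || decide (t.1 ≠ 0)) 3 n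
      (Real.sqrt n * x.2) x.1.1)
    (fun t n x hn => MM_pos hn x.1.2 _ _ _) (by
      rintro ⟨a, b, c⟩
      obtain ⟨D3, ⟨C, hC, P, N, hN, hb⟩, N', h⟩ := third B a b c
      refine ⟨C, hC, P, max N N', hN.trans (le_max_left _ _), fun n hn x => ?_⟩
      have h1 := h n ((le_max_right _ _).trans hn) x.1.1 x.1.2 x.2
      have h2 := hb n ((le_max_left _ _).trans hn) x.1.1 x.1.2 (Real.sqrt n * x.2)
      rw [← h1] at h2
      exact h2)
  exact ⟨C, hC, P, N, hN, fun n hn θ hθ y a b c => h n hn (⟨θ, hθ⟩, y) (a, b, c)⟩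

/-- bounds on the third-order partial derivatives of `ln p_{1/n}`, uniformly
over a compact subset `V` of the parameter space. -/
theorem statement16 (V : Set (Fin 3 → ℝ)) (hV : IsCompact V)
    (hVsub : V ⊆ {θ : Fin 3 → ℝ | 0 < θ 0 ∧ 0 < θ 1 ∧ θ 2 ∈ Set.Ioo (0 : ℝ) 2})
    (ψ : ℝ → ℕ → ℝ → ℝ) (hψ : IsPsiFamily ψ) :
    ∃ C > (0 : ℝ), ∃ p > (0 : ℝ), ∃ N : ℕ, ∀ n ≥ N, ∀ θ ∈ V, ∀ y : ℝ,
      |pderiv 0 (fun θ' => pderiv 0 (fun θ'' =>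
          pderiv 0 (fun θ''' => Real.log (pdens n θ''' y)) θ'') θ') θ| ≤
        C * Real.log n ^ p ∧
      ∀ a b c : Fin 3, ¬(a = 0 ∧ b = 0 ∧ c = 0) →
        |pderiv a (fun θ' => pderiv b (fun θ'' =>
            pderiv c (fun θ''' => Real.log (pdens n θ''' y)) θ'') θ') θ| ≤
          C * Real.log n ^ p *
            (wn n (θ 0) (θ 1) (θ 2) ^ (θ 2) * ψ (θ 2) 3 (Real.sqrt n * y / θ 0)) /
            (gauss (Real.sqrt n * y / θ 0)
              + wn n (θ 0) (θ 1) (θ 2) ^ (θ 2) * ψ (θ 2) 0 (Real.sqrt n * y / θ 0)) := by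
  rcases V.eq_empty_or_nonempty with rfl | hne
  · exact ⟨1, one_pos, 1, one_pos, 0, fun n _ θ hθ => absurd hθ (Set.notMem_empty θ)⟩
  obtain ⟨B, hB⟩ := box_exists hV hne hVsub
  obtain ⟨C, hC, P, N, hN, h⟩ := third_unif B
  obtain ⟨K, hK, hmu⟩ := mu_le_psi B hψ
  refine ⟨C * (1 + K), by positivity, ((P + 1 : ℕ) : ℝ), by positivity, N,
    fun n hn θ hθ y => ?_⟩
  have hn3 : 3 ≤ n := hN.trans hn
  have hlg := one_le_log hn3
  have hlg0 : 0 < Real.log n := by linarith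
  have hpow : Real.log n ^ P ≤ Real.log n ^ (P + 1) := pow_le_pow_right₀ hlg (Nat.le_succ P)
  have hT := hB hθ
  rw [Real.rpow_natCast]
  refine ⟨?_, fun a b c habc => ?_⟩
  · have := h n hn θ hT y 0 0 0
    refine this.trans ?_
    simp only [MM, ne_eq, not_true_eq_false, decide_false, Bool.or_self, Bool.false_eq_true,
      if_false, mul_one]
    gcongr
    nlinarith
  · have h1 := h n hn θ hT y a b c
    have hf : (decide (c ≠ 0) || decide (b ≠ 0) || decide (a ≠ 0)) = true := by
      by_contra hcon
      apply habc
      simp at hcon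
      tauto
    rw [hf] at h1
    simp only [MM, if_true] at h1
    have h2 := hmu n (by omega) θ hT y
    have hpos := mu_pos (n := n) (by omega) hT (Real.sqrt n * y)
    have hL := one_le_LL (Real.sqrt n * y)
    rw [mul_div_assoc]
    set R := wn n (θ 0) (θ 1) (θ 2) ^ (θ 2) * ψ (θ 2) 3 (Real.sqrt n * y / θ 0) /
            (gauss (Real.sqrt n * y / θ 0)
              + wn n (θ 0) (θ 1) (θ 2) ^ (θ 2) * ψ (θ 2) 0 (Real.sqrt n * y / θ 0)) with hR
    have hKR : 0 < K * R := lt_of_lt_of_le (by positivity) h2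
    have hR0 : 0 < R := pos_of_mul_pos_right hKR hK.le
    calc _ ≤ C * Real.log n ^ P * (K * R) := h1.trans (by gcongr)
      _ ≤ C * Real.log n ^ (P + 1) * ((1 + K) * R) := by
        gcongr
        linarith
      _ = _ := by ring

end LevyLAN
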